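/- arXiv:2109.06357 — 15 statements merged into one kernel-verified Lean document; each statement's English description precedes it below -/
import Mathlib

section
/- Let B be an associative unital ℂ-algebra, M a ℂ-vector space, and Φ : B × B → M a ℂ-bilinear skew-symmetric map satisfying the cyclic identity Φ(A,B·C) + Φ(B,C·A) + Φ(C,A·B) = 0 for all A,B,C ∈ B. Let K = {b ∈ B : Φ(A,b) = 0 for all A ∈ B} be the annihilator of Φ. Then: (i) 1 ∈ K; (ii) K is a subalgebra of B (closed under addition, scalar multiplication, and multiplication); and (iii) Φ(A, b·C) = Φ(A·b, C) for all A, C ∈ B and all b ∈ K. -/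
/-- Lemma on the annihilator of a cyclic Frobenius (CF) algebra form:
if `Φ : B × B → M` is ℂ-bilinear, skew-symmetric and satisfies the cyclic identity
`Φ(A,B·C) + Φ(B,C·A) + Φ(C,A·B) = 0`, then its annihilator
`K = {b | Φ(A,b) = 0 for all A}` contains `1`, is a subalgebra, and
`Φ(A, b·C) = Φ(A·b, C)` for all `A, C` and `b ∈ K`. -/
theorem cf_algebra_annihilator
    (B : Type*) [Ring B] [Algebra ℂ B]
    (M : Type*) [AddCommGroup M] [Module ℂ M]
    (Φ : B →ₗ[ℂ] B →ₗ[ℂ] M)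
    (hskew : ∀ A C : B, Φ A C = - Φ C A)
    (hcyc : ∀ A C E : B, Φ A (C * E) + Φ C (E * A) + Φ E (A * C) = 0)
    (K : Set B) (hK : K = {b : B | ∀ A : B, Φ A b = 0}) :
    (1 : B) ∈ K ∧
    (∀ b c : B, b ∈ K → c ∈ K → b + c ∈ K) ∧
    (∀ (z : ℂ) (b : B), b ∈ K → z • b ∈ K) ∧
    (∀ b c : B, b ∈ K → c ∈ K → b * c ∈ K) ∧
    (∀ (A C b : B), b ∈ K → Φ A (b * C) = Φ (A * b) C) := by
  subst hK
  have left_zero : ∀ b : B, (∀ A, Φ A b = 0) → ∀ A, Φ b A = 0 := fun b hb A => by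
    rw [hskew, hb, neg_zero]
  refine ⟨fun A => ?_, fun b c hb hc A => ?_, fun z b hb A => ?_, fun b c hb hc A => ?_,
    fun A C b hb => ?_⟩
  · have h := hcyc A 1 1
    rw [one_mul, one_mul, mul_one, hskew A 1, neg_add_cancel, zero_add] at h
    rw [hskew, h, neg_zero]
  · rw [map_add, hb A, hc A, add_zero]
  · rw [map_smul, hb A, smul_zero]
  · simpa [left_zero b hb, left_zero c hc] using hcyc A b c
  · have h := hcyc A b C
    rw [left_zero b hb, add_zero] at h
    rw [hskew (A * b), eq_neg_of_add_eq_zero_left h]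
end

section
/- For every integer m > 0, the derivation D is injective on the homogeneous component of weight m of 𝔄₀; that is, if p ∈ 𝔄₀ is weighted-homogeneous of weight m > 0 (with respect to the weights |u_k| = k+2) and D(p) = 0, then p = 0. -/
open MvPolynomial

/-- A polynomial over a domain of characteristic zero whose partial derivatives all vanish has no
nonconstant monomials. -/
theorem MvPolynomial.coeff_eq_zero_of_pderiv_eq_zero {σ R : Type*} [CommSemiring R]
    [NoZeroDivisors R] [CharZero R] {p : MvPolynomial σ R} (h : ∀ i, pderiv i p = 0)
    {d : σ →₀ ℕ} (hd : d ≠ 0) : coeff d p = 0 := by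
  obtain ⟨i, hi⟩ := Finsupp.ne_iff.mp hd
  have hle : Finsupp.single i 1 ≤ d := by
    simpa [Finsupp.single_le_iff, Nat.one_le_iff_ne_zero] using hi
  have hc := coeff_pderiv (i := i) p (d - Finsupp.single i 1)
  rw [h i, coeff_zero, tsub_add_cancel_of_le hle] at hc
  exact (mul_eq_zero.mp hc.symm).resolve_right (Nat.cast_add_one_ne_zero _)

/-- The commutator of `∂/∂u_{k+1}` with the derivation `u_j ↦ u_{j+1}` is `∂/∂u_k`. -/
theorem lie_pderiv_succ_of_map_X_eq_X_succ {R : Type*} [CommRing R]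
    (D : Derivation R (MvPolynomial ℕ R) (MvPolynomial ℕ R))
    (hD : ∀ k : ℕ, D (X k) = X (k + 1)) (k : ℕ) :
    ⁅(pderiv (k + 1) : Derivation R (MvPolynomial ℕ R) (MvPolynomial ℕ R)), D⁆ = pderiv k := by
  refine derivation_ext fun j => ?_
  rw [Derivation.commutator_apply, hD, pderiv_X, pderiv_X, pderiv_X]
  simp only [Pi.single_apply, Nat.add_right_cancel_iff]
  split_ifs <;> simp

/-- The partial derivatives of an element of the kernel of `u_j ↦ u_{j+1}` all vanish. -/
theorem pderiv_eq_zero_of_map_X_eq_X_succ {R : Type*} [CommRing R]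
    (D : Derivation R (MvPolynomial ℕ R) (MvPolynomial ℕ R))
    (hD : ∀ k : ℕ, D (X k) = X (k + 1)) {p : MvPolynomial ℕ R} (hDp : D p = 0) (k : ℕ) :
    pderiv k p = 0 := by
  obtain ⟨N, hN⟩ := p.vars.exists_nat_subset_range
  rcases le_total N k with h | h
  · exact pderiv_eq_zero_of_notMem_vars fun hk => by
      have := Finset.mem_range.mp (hN hk)
      omega
  · induction h using Nat.decreasingInduction with
    | self => exact pderiv_eq_zero_of_notMem_vars fun hk => by simpa using hN hk
    | of_succ k _ ih =>
      rw [← lie_pderiv_succ_of_map_X_eq_X_succ D hD k, Derivation.commutator_apply, hDp, ih]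
      simp

/-- For `𝔄₀ = ℂ[u₀,u₁,…]` with weights `|u_k| = k+2` and the derivation `D` with
`D(u_k) = u_{k+1}`, `D` is injective on each homogeneous component of positive weight. -/
theorem D_injective_on_positive_weight_component
    (D : Derivation ℂ (MvPolynomial ℕ ℂ) (MvPolynomial ℕ ℂ))
    (hD : ∀ k : ℕ, D (X k) = X (k + 1))
    (p : MvPolynomial ℕ ℂ) (m : ℕ) (hm : 0 < m)
    (hp : MvPolynomial.IsWeightedHomogeneous (fun k : ℕ => k + 2) p m)
    (hDp : D p = 0) : p = 0 := by
  ext d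
  rw [coeff_zero]
  by_cases hd : d = 0
  · subst hd
    by_contra hc
    have := hp hc
    rw [map_zero] at this
    exact hm.ne this
  · exact coeff_eq_zero_of_pderiv_eq_zero (pderiv_eq_zero_of_map_X_eq_X_succ D hD hDp) hd
end

section
/- Let R be a commutative ring, d : R → R a derivation, and a, b ∈ R. For every integer K ≥ 0, d( Σ_{s=0}^{K} (−1)^s dˢ(a) · d^{K−s}(b) ) = a·d^{K+1}(b) + (−1)^K · b·d^{K+1}(a). Consequently, for any integers n ≥ 1 and m ≤ −1 with K = n+m ≥ 0, the element σ(aDⁿ,bDᵐ) := C(n,K+1) · Σ_{s=0}^{K} (−1)^s dˢ(a) d^{K−s}(b) (where C(n,K+1) is the binomial coefficient) satisfies d(σ(aDⁿ,bDᵐ)) = C(n,K+1)·( a·d^{K+1}(b) + (−1)^K · b·d^{K+1}(a) ). -/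
/-- For a derivation `d` on a commutative ring,
`d(Σ_{s=0}^{K} (−1)^s dˢ(a)·d^{K−s}(b)) = a·d^{K+1}(b) + (−1)^K·b·d^{K+1}(a)`,
and consequently, for integers `n ≥ 1`, `m ≤ −1` with `K = n + m ≥ 0`, the element
`σ(aDⁿ,bDᵐ) = C(n,K+1)·Σ_{s=0}^{K} (−1)^s dˢ(a) d^{K−s}(b)` satisfies
`d(σ(aDⁿ,bDᵐ)) = C(n,K+1)·(a·d^{K+1}(b) + (−1)^K·b·d^{K+1}(a))`. -/
theorem derivation_alternating_sum_identity
    (R : Type*) [CommRing R] (d : R → R)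
    (hadd : ∀ x y : R, d (x + y) = d x + d y)
    (hmul : ∀ x y : R, d (x * y) = d x * y + x * d y)
    (a b : R) :
    (∀ K : ℕ,
      d (∑ s ∈ Finset.range (K + 1), (-1 : R) ^ s * (d^[s] a * d^[K - s] b))
        = a * d^[K + 1] b + (-1 : R) ^ K * (b * d^[K + 1] a)) ∧
    (∀ (n : ℕ) (m : ℤ) (K : ℕ), 1 ≤ n → m ≤ -1 → (K : ℤ) = (n : ℤ) + m →
      d ((n.choose (K + 1)) •
          ∑ s ∈ Finset.range (K + 1), (-1 : R) ^ s * (d^[s] a * d^[K - s] b))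
        = (n.choose (K + 1)) •
            (a * d^[K + 1] b + (-1 : R) ^ K * (b * d^[K + 1] a))) := by
  have hneg (s : ℕ) (x : R) : d ((-1) ^ s * x) = (-1) ^ s * d x := by
    have h : d (-x) = -d x := map_neg (AddMonoidHom.mk' d hadd) x
    rcases neg_one_pow_eq_or R s with hs | hs <;> simp [hs, h]
  have key (K : ℕ) :
      d (∑ s ∈ Finset.range (K + 1), (-1 : R) ^ s * (d^[s] a * d^[K - s] b))
        = a * d^[K + 1] b + (-1 : R) ^ K * (b * d^[K + 1] a) := by
    let f (s : ℕ) : R := (-1) ^ s * (d^[s] a * d^[K + 1 - s] b)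
    have hterm : ∀ s ∈ Finset.range (K + 1),
        d ((-1) ^ s * (d^[s] a * d^[K - s] b)) = f s - f (s + 1) := by
      intro s hs
      have hK : K + 1 - s = (K - s) + 1 := Nat.succ_sub (Finset.mem_range_succ_iff.mp hs)
      simp only [f, hneg, hmul, hK, Nat.add_sub_add_right, Function.iterate_succ_apply']
      ring
    calc d (∑ s ∈ Finset.range (K + 1), (-1 : R) ^ s * (d^[s] a * d^[K - s] b))
        = ∑ s ∈ Finset.range (K + 1), d ((-1) ^ s * (d^[s] a * d^[K - s] b)) :=
          map_sum (AddMonoidHom.mk' d hadd) _ _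
      _ = f 0 - f (K + 1) := by
          rw [Finset.sum_congr rfl hterm, Finset.sum_range_sub']
      _ = a * d^[K + 1] b + (-1 : R) ^ K * (b * d^[K + 1] a) := by
          simp only [f, Nat.sub_self, Nat.sub_zero, Function.iterate_zero_apply]
          ring
  refine ⟨key, fun n m K _ _ _ => ?_⟩
  rw [← key K]
  exact map_nsmul (AddMonoidHom.mk' d hadd) _ _
end

section
/- Let 𝒯 : 𝔅₀ → 𝔅₀ be the ℂ-linear map defined on the monomial basis by 𝒯(1) = 1 and 𝒯(u_ξ) = u_{T(ξ)}, where for a word ξ = (j₁,…,j_k), T(ξ) denotes the lexicographically greatest word among the k cyclic rotations of ξ (comparing words letter by letter using the usual order on non-negative integers). Then 𝒯 is a projector, i.e. 𝒯∘𝒯 = 𝒯, and its kernel equals the ℂ-linear span of all commutators: ker 𝒯 = Span_ℂ{ab − ba : a, b ∈ 𝔅₀}. In particular 𝒯 induces a ℂ-linear isomorphism from its image onto the quotient vector space 𝔅₀ / Span_ℂ[𝔅₀,𝔅₀]. -/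
/-- The lexicographically greatest word among all cyclic rotations of `l`. -/
def maxRotation (l : List ℕ) : List ℕ :=
  ((List.range l.length).map (fun i => l.rotate i)).foldr max l

/-- The map `T` on words: `T(ξ)` is the lexicographically greatest cyclic rotation of `ξ`. -/
def Tword (w : FreeMonoid ℕ) : FreeMonoid ℕ :=
  FreeMonoid.ofList (maxRotation (FreeMonoid.toList w))

theorem List.le_foldr_max {α : Type*} [LinearOrder α] {a b : α} {L : List α}
    (h : b ∈ L) : b ≤ L.foldr max a := by
  induction L with
  | nil => simp at h
  | cons c L ih =>
    rcases List.mem_cons.mp h with rfl | h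
    · exact le_max_left _ _
    · exact (ih h).trans (le_max_right _ _)

theorem List.foldr_max_mem_cons {α : Type*} [LinearOrder α] (a : α) (L : List α) :
    L.foldr max a ∈ a :: L := by
  induction L with
  | nil => simp
  | cons c L ih =>
    rcases max_choice c (L.foldr max a) with h | h <;> simp only [List.foldr_cons, h] <;>
      simp only [List.mem_cons] at ih ⊢ <;> tauto

theorem maxRotation_isRotated (l : List ℕ) : l ~r maxRotation l := by
  rcases List.mem_cons.mp (List.foldr_max_mem_cons l
    ((List.range l.length).map fun i => l.rotate i)) with h | h
  · exact ⟨0, by rw [List.rotate_zero]; exact h.symm⟩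
  · obtain ⟨i, -, hi⟩ := List.mem_map.mp h
    exact ⟨i, hi⟩

theorem List.IsRotated.le_maxRotation {l l' : List ℕ} (h : l ~r l') : l' ≤ maxRotation l := by
  rcases eq_or_ne l [] with rfl | hl
  · obtain rfl := List.isRotated_nil_iff'.mp h
    exact le_refl ([] : List ℕ)
  · obtain ⟨i, rfl⟩ := h
    rw [← List.rotate_mod]
    exact List.le_foldr_max (List.mem_map_of_mem
      (List.mem_range.mpr (Nat.mod_lt _ (List.length_pos_of_ne_nil hl))))

theorem List.IsRotated.maxRotation_eq {l l' : List ℕ} (h : l ~r l') :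
    maxRotation l = maxRotation l' :=
  le_antisymm (h.symm.trans (maxRotation_isRotated l)).le_maxRotation
    (h.trans (maxRotation_isRotated l')).le_maxRotation

theorem Tword_Tword (w : FreeMonoid ℕ) : Tword (Tword w) = Tword w :=
  congrArg FreeMonoid.ofList (maxRotation_isRotated w.toList).maxRotation_eq.symm

theorem Tword_mul_comm (v w : FreeMonoid ℕ) : Tword (v * w) = Tword (w * v) :=
  congrArg FreeMonoid.ofList
    (List.IsRotated.maxRotation_eq (List.isRotated_append (l := v.toList) (l' := w.toList)))

theorem exists_mul_eq_and_Tword_eq (w : FreeMonoid ℕ) :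
    ∃ a b : FreeMonoid ℕ, w = a * b ∧ Tword w = b * a := by
  obtain ⟨i, hi, h⟩ := (List.isRotated_iff_mod).mp (maxRotation_isRotated w.toList)
  rw [List.rotate_eq_drop_append_take hi] at h
  exact ⟨FreeMonoid.ofList (w.toList.take i), FreeMonoid.ofList (w.toList.drop i),
    (List.take_append_drop i w.toList).symm, h.symm⟩

theorem FreeAlgebra.basisFreeMonoid_mul (R X : Type*) [CommSemiring R] (v w : FreeMonoid X) :
    basisFreeMonoid R X (v * w) = basisFreeMonoid R X v * basisFreeMonoid R X w := by
  simp [basisFreeMonoid, ← map_mul]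

/-- The ℂ-linear map `𝒯` on the free algebra `𝔅₀ = ℂ⟨u₀,u₁,…⟩` sending each basis word
`u_ξ` to `u_{T(ξ)}` is a projector whose kernel is the linear span of all commutators. -/
theorem cyclic_T_projector_ker_commutators
    (𝒯 : FreeAlgebra ℂ ℕ →ₗ[ℂ] FreeAlgebra ℂ ℕ)
    (h𝒯 : ∀ w : FreeMonoid ℕ,
      𝒯 (FreeAlgebra.basisFreeMonoid ℂ ℕ w) = FreeAlgebra.basisFreeMonoid ℂ ℕ (Tword w)) :
    𝒯 ∘ₗ 𝒯 = 𝒯 ∧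
    LinearMap.ker 𝒯 =
      Submodule.span ℂ {x : FreeAlgebra ℂ ℕ |
        ∃ a b : FreeAlgebra ℂ ℕ, x = a * b - b * a} := by
  have h_comm (a b : FreeAlgebra ℂ ℕ) : 𝒯 (a * b) = 𝒯 (b * a) := by
    have h : (LinearMap.mul ℂ (FreeAlgebra ℂ ℕ)).compr₂ 𝒯 =
        (LinearMap.mul ℂ (FreeAlgebra ℂ ℕ)).flip.compr₂ 𝒯 := by
      refine LinearMap.ext_basis (FreeAlgebra.basisFreeMonoid ℂ ℕ)
        (FreeAlgebra.basisFreeMonoid ℂ ℕ) fun v w => ?_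
      simp only [LinearMap.compr₂_apply, LinearMap.flip_apply, LinearMap.mul_apply',
        ← FreeAlgebra.basisFreeMonoid_mul, h𝒯, Tword_mul_comm v w]
    exact LinearMap.congr_fun₂ h a b
  refine ⟨(FreeAlgebra.basisFreeMonoid ℂ ℕ).ext fun w => ?_, le_antisymm (fun x hx => ?_) ?_⟩
  · simp only [LinearMap.comp_apply, h𝒯, Tword_Tword]
  · set S := Submodule.span ℂ {x : FreeAlgebra ℂ ℕ |
        ∃ a b : FreeAlgebra ℂ ℕ, x = a * b - b * a}
    have h_quot : S.mkQ = S.mkQ ∘ₗ 𝒯 := by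
      refine (FreeAlgebra.basisFreeMonoid ℂ ℕ).ext fun w => ?_
      obtain ⟨a, b, hab, hba⟩ := exists_mul_eq_and_Tword_eq w
      rw [LinearMap.comp_apply, h𝒯, hba, hab, FreeAlgebra.basisFreeMonoid_mul,
        FreeAlgebra.basisFreeMonoid_mul]
      exact (Submodule.Quotient.eq S).mpr (Submodule.subset_span ⟨_, _, rfl⟩)
    rw [← Submodule.ker_mkQ S, h_quot]
    exact LinearMap.ker_le_ker_comp 𝒯 S.mkQ hx
  · rw [Submodule.span_le]
    rintro _ ⟨a, b, rfl⟩
    rw [SetLike.mem_coe, LinearMap.mem_ker, map_sub, h_comm a b, sub_self]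
end

section
/- Fix α₄, α₆ ∈ ℂ. Let R = ℂ[u,u₁,u₂,u₃] and let 𝒟 be the unique ℂ-derivation of R with 𝒟(u) = u₁, 𝒟(u₁) = u₂, 𝒟(u₂) = u₃, and 𝒟(u₃) = 32α₆ − 10u³ − 16α₄u + 10u₂u + 5u₁². Then the polynomials H_{3,5} = −(3/128)·(5u⁴ + 16α₄u² − 64α₆u − 10u₁²u − u₂² + 2u₃u₁) and H_{5,5} = (5/512)·(24u⁵ + 64α₄u³ − 20u₂u³ − 192α₆u² − 30u₁²u² − 32α₄u₂u + 16α₄u₁² + 64α₆u₂ + 4u₂²u + 12u₃u₁u − u₃² − 2u₂u₁²) are first integrals: 𝒟(H_{3,5}) = 0 and 𝒟(H_{5,5}) = 0. -/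
open MvPolynomial

/-- `H_{3,5}` and `H_{5,5}` are first integrals of the commutative `N = 2` Novikov
equation, written as the derivation `𝒟` of `ℂ[u,u₁,u₂,u₃]` with `𝒟(u_k) = u_{k+1}`
(`k = 0,1,2`) and `𝒟(u₃) = 32α₆ − 10u³ − 16α₄u + 10u₂u + 5u₁²`. -/
theorem firstIntegrals_N2_novikov (α₄ α₆ : ℂ)
    (𝒟 : Derivation ℂ (MvPolynomial (Fin 4) ℂ) (MvPolynomial (Fin 4) ℂ))
    (h0 : 𝒟 (X 0) = X 1)
    (h1 : 𝒟 (X 1) = X 2)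
    (h2 : 𝒟 (X 2) = X 3)
    (h3 : 𝒟 (X 3) = C (32 * α₆) - 10 * X 0 ^ 3 - C (16 * α₄) * X 0
        + 10 * X 2 * X 0 + 5 * X 1 ^ 2) :
    𝒟 (C (-(3 / 128) : ℂ) *
        (5 * X 0 ^ 4 + C (16 * α₄) * X 0 ^ 2 - C (64 * α₆) * X 0
          - 10 * X 1 ^ 2 * X 0 - X 2 ^ 2 + 2 * X 3 * X 1)) = 0 ∧
    𝒟 (C ((5 : ℂ) / 512) *
        (24 * X 0 ^ 5 + C (64 * α₄) * X 0 ^ 3 - 20 * X 2 * X 0 ^ 3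
          - C (192 * α₆) * X 0 ^ 2 - 30 * X 1 ^ 2 * X 0 ^ 2
          - C (32 * α₄) * X 2 * X 0 + C (16 * α₄) * X 1 ^ 2 + C (64 * α₆) * X 2
          + 4 * X 2 ^ 2 * X 0 + 12 * X 3 * X 1 * X 0 - X 3 ^ 2
          - 2 * X 2 * X 1 ^ 2)) = 0 := by
  have hC (a : ℂ) : 𝒟 (C a) = 0 := 𝒟.map_algebraMap a
  have hN (n : ℕ) [n.AtLeastTwo] : 𝒟 (OfNat.ofNat n) = 0 := 𝒟.map_natCast n
  constructor <;>
  · rw [Derivation.leibniz, hC, smul_zero, add_zero, smul_eq_mul]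
    refine mul_eq_zero_of_right _ ?_
    simp only [map_add, map_sub, Derivation.leibniz, Derivation.leibniz_pow, hC, hN,
      h0, h1, h2, h3, smul_eq_mul, nsmul_eq_mul, map_mul, map_ofNat]
    push_cast
    ring
end

section
/- Fix α₄, α₆ ∈ ℂ. Let R = ℂ[u,u₁,u₂,u₃], let 𝒟 be the unique ℂ-derivation of R with 𝒟(u) = u₁, 𝒟(u₁) = u₂, 𝒟(u₂) = u₃, 𝒟(u₃) = 32α₆ − 10u³ − 16α₄u + 10u₂u + 5u₁², and let 𝒟₃ be the unique ℂ-derivation of R with 𝒟₃(u_s) = (1/4)·𝒟^{s+1}(u₂ − 3u²) for s = 0,1,2,3. Then the two derivations commute: 𝒟∘𝒟₃ = 𝒟₃∘𝒟. -/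
open MvPolynomial

/-- The `N = 2` Novikov derivation `𝒟` of `ℂ[u,u₁,u₂,u₃]` commutes with the
derivation `𝒟₃` given by `𝒟₃(u_s) = (1/4)·𝒟^{s+1}(u₂ − 3u²)`, `s = 0,1,2,3`. -/
theorem commuting_derivations_N2_novikov (α₄ α₆ : ℂ)
    (𝒟 𝒟₃ : Derivation ℂ (MvPolynomial (Fin 4) ℂ) (MvPolynomial (Fin 4) ℂ))
    (h0 : 𝒟 (X 0) = X 1)
    (h1 : 𝒟 (X 1) = X 2)
    (h2 : 𝒟 (X 2) = X 3)
    (h3 : 𝒟 (X 3) = C (32 * α₆) - 10 * X 0 ^ 3 - C (16 * α₄) * X 0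
        + 10 * X 2 * X 0 + 5 * X 1 ^ 2)
    (h𝒟₃ : ∀ s : Fin 4,
      𝒟₃ (X s) = C ((1 : ℂ) / 4) * (⇑𝒟)^[(s : ℕ) + 1] (X 2 - 3 * X 0 ^ 2)) :
    ∀ p : MvPolynomial (Fin 4) ℂ, 𝒟 (𝒟₃ p) = 𝒟₃ (𝒟 p) := by
  have hC (a : ℂ) : 𝒟 (C a) = 0 := 𝒟.map_algebraMap a
  have hC₃ (a : ℂ) : 𝒟₃ (C a) = 0 := 𝒟₃.map_algebraMap a
  have hn (n : ℕ) [n.AtLeastTwo] : 𝒟 (ofNat(n)) = 0 := 𝒟.map_natCast n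
  have hn₃ (n : ℕ) [n.AtLeastTwo] : 𝒟₃ (ofNat(n)) = 0 := 𝒟₃.map_natCast n
  have hcomm : ⁅𝒟, 𝒟₃⁆ = 0 := by
    apply MvPolynomial.derivation_ext
    intro s
    have e0 := h𝒟₃ 0
    have e1 := h𝒟₃ 1
    have e2 := h𝒟₃ 2
    have e3 := h𝒟₃ 3
    simp only [Fin.val_zero, Fin.val_one, Fin.val_two, Fin.isValue, Function.iterate_succ,
      Function.iterate_zero, Function.comp_apply, id_eq,
      show ((3 : Fin 4) : ℕ) = 3 from rfl, zero_add, Nat.reduceAdd] at e0 e1 e2 e3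
    simp only [map_sub, map_add, Derivation.leibniz, Derivation.leibniz_pow, hC, hn, h0, h1, h2, h3,
      smul_eq_mul, nsmul_eq_mul, mul_zero, add_zero, Nat.cast_ofNat,
      Nat.add_one_sub_one, pow_one, map_zero] at e0 e1 e2 e3
    rw [Derivation.commutator_apply, Derivation.zero_apply, sub_eq_zero]
    fin_cases s <;>
    simp only [Fin.zero_eta, Fin.mk_one, Fin.reduceFinMk, Fin.isValue, h0, h1, h2, h3, e0, e1, e2, e3,
      map_sub, map_add, Derivation.leibniz, Derivation.leibniz_pow, hC, hC₃, hn, hn₃,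
      smul_eq_mul, nsmul_eq_mul, mul_zero, add_zero, Nat.cast_ofNat,
      Nat.add_one_sub_one, pow_one, map_zero]
    all_goals ring
  intro p
  have := DFunLike.congr_fun hcomm p
  rwa [Derivation.commutator_apply, Derivation.zero_apply, sub_eq_zero] at this
end

section
/- Fix α₄, α₆, α₈ ∈ ℂ. Let R = ℂ[u,u₁,u₂,u₃,u₄,u₅] and let 𝒟 be the unique ℂ-derivation of R with 𝒟(u_k) = u_{k+1} for 0 ≤ k ≤ 4 (writing u = u₀) and 𝒟(u₅) = 128α₈ + 35u⁴ + 48α₄u² − 70u₂u² − 64α₆u − 16α₄u₂ − 70u₁²u + 14u₄u + 21u₂² + 28u₁u₃. Then 𝒟 annihilates the following three polynomials: H_{3,7} = (3/2⁹)·(14u⁵ + 32α₄u³ − 64α₆u² − 70u₁²u² + 256α₈u − 16α₄u₁² − 14u₂²u + 28u₃u₁u − u₃² + 28u₂u₁² + 2u₄u₂ − 2u₅u₁); H_{5,7} = −(5/2¹¹)·(70u⁶ + 144α₄u⁴ − 70u₂u⁴ − 256α₆u³ − 280u₁²u³ − 96α₄u₂u² + 768α₈u² − 14u₂²u² + 168u₃u₁u²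 + 128α₆u₂u + 16α₄u₂² − 64α₆u₁² − 256α₈u₂ − 20u₃²u + 140u₂u₁²u + 12u₄u₂u − 12u₅u₁u − 35u₁⁴ − 2u₂³ − u₄² − 36u₃u₂u₁ + 12u₄u₁² + 2u₅u₃); H_{7,7} = (7/2¹³)·(300u⁷ + 576α₄u⁵ − 700u₂u⁵ − 960α₆u⁴ − 1050u₁²u⁴ + 70u₄u⁴ − 960α₄u₂u³ + 2560α₈u³ + 420u₂²u³ + 560u₃u₁u³ + 96α₄u₄u² + 1280α₆u₂u² − 100u₃²u² + 1400u₂u₁²u² − 80u₄u₂u² − 60u₅u₁u² + 256α₄u₂²u − 192α₄u₃u₁u − 128α₆u₄u − 2560α₈u₂u + 16α₄u₃² + 192α₄u₂u₁² − 32α₄u₄u₂ − 64α₆u₂² + 128α₆u₃u₁ − 1280α₈u₁² + 256α₈u₄ − 20u₂³u + 4u₄²u − 360u₃u₂u₁u − 20u₄u₁²u + 20u₅u₃u − 410u₂²u₁² − u₅² + 20u₃u₁³ + 2u₄u₂² − 4u₄u₃u₁ + 40u₅u₂u₁). -/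
open MvPolynomial

set_option maxHeartbeats 4000000
set_option maxRecDepth 4000

/-- `H_{3,7}`, `H_{5,7}`, `H_{7,7}` are first integrals of the commutative `N = 3`
Novikov equation, i.e. they are annihilated by the derivation `𝒟` of `ℂ[u,u₁,…,u₅]`
with `𝒟(u_k) = u_{k+1}` (`0 ≤ k ≤ 4`) and
`𝒟(u₅) = 128α₈ + 35u⁴ + 48α₄u² − 70u₂u² − 64α₆u − 16α₄u₂ − 70u₁²u + 14u₄u + 21u₂² + 28u₁u₃`. -/
theorem firstIntegrals_N3_novikov (α₄ α₆ α₈ : ℂ)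
    (𝒟 : Derivation ℂ (MvPolynomial (Fin 6) ℂ) (MvPolynomial (Fin 6) ℂ))
    (hk : ∀ k : Fin 5, 𝒟 (X k.castSucc) = X k.succ)
    (h5 : 𝒟 (X 5) = C (128 * α₈) + 35 * X 0 ^ 4 + C (48 * α₄) * X 0 ^ 2
        - 70 * X 2 * X 0 ^ 2 - C (64 * α₆) * X 0 - C (16 * α₄) * X 2
        - 70 * X 1 ^ 2 * X 0 + 14 * X 4 * X 0 + 21 * X 2 ^ 2 + 28 * X 1 * X 3) :
    𝒟 (C ((3 : ℂ) / 2 ^ 9) *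
        (14 * X 0 ^ 5 + C (32 * α₄) * X 0 ^ 3 - C (64 * α₆) * X 0 ^ 2
          - 70 * X 1 ^ 2 * X 0 ^ 2 + C (256 * α₈) * X 0 - C (16 * α₄) * X 1 ^ 2
          - 14 * X 2 ^ 2 * X 0 + 28 * X 3 * X 1 * X 0 - X 3 ^ 2
          + 28 * X 2 * X 1 ^ 2 + 2 * X 4 * X 2 - 2 * X 5 * X 1)) = 0 ∧
    𝒟 (C (-((5 : ℂ) / 2 ^ 11)) *
        (70 * X 0 ^ 6 + C (144 * α₄) * X 0 ^ 4 - 70 * X 2 * X 0 ^ 4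
          - C (256 * α₆) * X 0 ^ 3 - 280 * X 1 ^ 2 * X 0 ^ 3
          - C (96 * α₄) * X 2 * X 0 ^ 2 + C (768 * α₈) * X 0 ^ 2
          - 14 * X 2 ^ 2 * X 0 ^ 2 + 168 * X 3 * X 1 * X 0 ^ 2
          + C (128 * α₆) * X 2 * X 0 + C (16 * α₄) * X 2 ^ 2
          - C (64 * α₆) * X 1 ^ 2 - C (256 * α₈) * X 2 - 20 * X 3 ^ 2 * X 0
          + 140 * X 2 * X 1 ^ 2 * X 0 + 12 * X 4 * X 2 * X 0
          - 12 * X 5 * X 1 * X 0 - 35 * X 1 ^ 4 - 2 * X 2 ^ 3 - X 4 ^ 2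
          - 36 * X 3 * X 2 * X 1 + 12 * X 4 * X 1 ^ 2 + 2 * X 5 * X 3)) = 0 ∧
    𝒟 (C ((7 : ℂ) / 2 ^ 13) *
        (300 * X 0 ^ 7 + C (576 * α₄) * X 0 ^ 5 - 700 * X 2 * X 0 ^ 5
          - C (960 * α₆) * X 0 ^ 4 - 1050 * X 1 ^ 2 * X 0 ^ 4 + 70 * X 4 * X 0 ^ 4
          - C (960 * α₄) * X 2 * X 0 ^ 3 + C (2560 * α₈) * X 0 ^ 3
          + 420 * X 2 ^ 2 * X 0 ^ 3 + 560 * X 3 * X 1 * X 0 ^ 3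
          + C (96 * α₄) * X 4 * X 0 ^ 2 + C (1280 * α₆) * X 2 * X 0 ^ 2
          - 100 * X 3 ^ 2 * X 0 ^ 2 + 1400 * X 2 * X 1 ^ 2 * X 0 ^ 2
          - 80 * X 4 * X 2 * X 0 ^ 2 - 60 * X 5 * X 1 * X 0 ^ 2
          + C (256 * α₄) * X 2 ^ 2 * X 0 - C (192 * α₄) * X 3 * X 1 * X 0
          - C (128 * α₆) * X 4 * X 0 - C (2560 * α₈) * X 2 * X 0
          + C (16 * α₄) * X 3 ^ 2 + C (192 * α₄) * X 2 * X 1 ^ 2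
          - C (32 * α₄) * X 4 * X 2 - C (64 * α₆) * X 2 ^ 2
          + C (128 * α₆) * X 3 * X 1 - C (1280 * α₈) * X 1 ^ 2 + C (256 * α₈) * X 4
          - 20 * X 2 ^ 3 * X 0 + 4 * X 4 ^ 2 * X 0 - 360 * X 3 * X 2 * X 1 * X 0
          - 20 * X 4 * X 1 ^ 2 * X 0 + 20 * X 5 * X 3 * X 0
          - 410 * X 2 ^ 2 * X 1 ^ 2 - X 5 ^ 2 + 20 * X 3 * X 1 ^ 3
          + 2 * X 4 * X 2 ^ 2 - 4 * X 4 * X 3 * X 1 + 40 * X 5 * X 2 * X 1)) = 0 := by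
  have h0 : 𝒟 (X 0) = X 1 := hk 0
  have h1 : 𝒟 (X 1) = X 2 := hk 1
  have h2 : 𝒟 (X 2) = X 3 := hk 2
  have h3 : 𝒟 (X 3) = X 4 := hk 3
  have h4 : 𝒟 (X 4) = X 5 := hk 4
  have hC (a : ℂ) : 𝒟 (C a) = 0 := 𝒟.map_algebraMap a
  have hn (n : ℕ) [n.AtLeastTwo] : 𝒟 (OfNat.ofNat n : MvPolynomial (Fin 6) ℂ) = 0 :=
    𝒟.map_natCast n
  refine ⟨?_, ?_, ?_⟩ <;>
  · rw [Derivation.leibniz, hC, smul_zero, add_zero]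
    refine smul_eq_zero_of_right _ ?_
    simp only [map_add, map_sub, Derivation.leibniz, Derivation.leibniz_pow, hC, hn,
      h0, h1, h2, h3, h4, h5, smul_eq_mul, nsmul_eq_mul, C_mul, map_ofNat]
    push_cast
    ring
end

section
/- Fix α₄, α₆, α₈ ∈ ℂ. Let R = ℂ[u,u₁,u₂,u₃,u₄,u₅], let 𝒟 be the unique ℂ-derivation of R with 𝒟(u_k) = u_{k+1} for 0 ≤ k ≤ 4 (writing u = u₀) and 𝒟(u₅) = 128α₈ + 35u⁴ + 48α₄u² − 70u₂u² − 64α₆u − 16α₄u₂ − 70u₁²u + 14u₄u + 21u₂² + 28u₁u₃, and define the derivations 𝒟₃ and 𝒟₅ of R by 𝒟₃(u_s) = (1/4)·𝒟^{s+1}(u₂ − 3u²) and 𝒟₅(u_s) = (1/16)·𝒟^{s+1}(u₄ − 5u₁² − 10uu₂ + 10u³ + 16α₄u), for s = 0,…,5. Then the three derivations 𝒟, 𝒟₃, 𝒟₅ pairwise commute. -/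
open MvPolynomial

set_option maxHeartbeats 2000000
set_option maxRecDepth 4000
set_option linter.unusedSimpArgs false

section Derivation

variable {R σ : Type*} [CommRing R]

/-- Two composites of derivations that commute on the variables commute everywhere. -/
theorem Derivation.commute_of_commute_X {D E : Derivation R (MvPolynomial σ R) (MvPolynomial σ R)}
    (h : ∀ i, D (E (X i)) = E (D (X i))) (p : MvPolynomial σ R) : D (E p) = E (D p) := by
  have hDE : ⁅D, E⁆ = 0 := MvPolynomial.derivation_ext fun i => by
    rw [Derivation.commutator_apply, h i, sub_self, Derivation.zero_apply]
  rw [← sub_eq_zero, ← Derivation.commutator_apply, hDE, Derivation.zero_apply]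

/-- If `D` shifts the variables and `E (X s) = c * D^[s + 1] f`, then `D` and `E` commute as soon
as they commute on the last variable. -/
theorem Derivation.commute_of_shift {n : ℕ}
    {D E : Derivation R (MvPolynomial (Fin (n + 1)) R) (MvPolynomial (Fin (n + 1)) R)}
    (hD : ∀ k : Fin n, D (X k.castSucc) = X k.succ) {c : R} {f : MvPolynomial (Fin (n + 1)) R}
    (hE : ∀ s : Fin (n + 1), E (X s) = C c * (⇑D)^[(s : ℕ) + 1] f)
    (hlast : D (E (X (Fin.last n))) = E (D (X (Fin.last n)))) (p) : D (E p) = E (D p) := by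
  refine commute_of_commute_X (fun i => ?_) p
  induction i using Fin.lastCases with
  | last => exact hlast
  | cast k =>
    rw [hD, hE, hE, Derivation.leibniz, MvPolynomial.derivation_C, smul_zero, add_zero,
      smul_eq_mul, ← Function.iterate_succ_apply' (⇑D), Fin.val_castSucc, Fin.val_succ]

/-- If `D` shifts the variables and commutes with `E` and `F`, then `E` and `F` commute as soon as
they commute on the first variable. -/
theorem Derivation.commute_of_commute_shift {n : ℕ}
    {D E F : Derivation R (MvPolynomial (Fin (n + 1)) R) (MvPolynomial (Fin (n + 1)) R)}
    (hD : ∀ k : Fin n, D (X k.castSucc) = X k.succ)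
    (hE : ∀ p, D (E p) = E (D p)) (hF : ∀ p, D (F p) = F (D p))
    (h0 : E (F (X 0)) = F (E (X 0))) (p) : E (F p) = F (E p) := by
  refine commute_of_commute_X (fun i => ?_) p
  induction i using Fin.induction with
  | zero => exact h0
  | succ k ih => rw [← hD, ← hF, ← hE, ← hE, ← hF, ih]

end Derivation

/-- The derivations `𝒟`, `𝒟₃`, `𝒟₅` of the commutative `N = 3` Novikov hierarchy
pairwise commute, where `𝒟₃(u_s) = (1/4)𝒟^{s+1}(u₂ − 3u²)` and
`𝒟₅(u_s) = (1/16)𝒟^{s+1}(u₄ − 5u₁² − 10uu₂ + 10u³ + 16α₄u)`. -/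
theorem commuting_derivations_N3_novikov (α₄ α₆ α₈ : ℂ)
    (𝒟 𝒟₃ 𝒟₅ : Derivation ℂ (MvPolynomial (Fin 6) ℂ) (MvPolynomial (Fin 6) ℂ))
    (hk : ∀ k : Fin 5, 𝒟 (X k.castSucc) = X k.succ)
    (h5 : 𝒟 (X 5) = C (128 * α₈) + 35 * X 0 ^ 4 + C (48 * α₄) * X 0 ^ 2
        - 70 * X 2 * X 0 ^ 2 - C (64 * α₆) * X 0 - C (16 * α₄) * X 2
        - 70 * X 1 ^ 2 * X 0 + 14 * X 4 * X 0 + 21 * X 2 ^ 2 + 28 * X 1 * X 3)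
    (h𝒟₃ : ∀ s : Fin 6,
      𝒟₃ (X s) = C ((1 : ℂ) / 4) * (⇑𝒟)^[(s : ℕ) + 1] (X 2 - 3 * X 0 ^ 2))
    (h𝒟₅ : ∀ s : Fin 6,
      𝒟₅ (X s) = C ((1 : ℂ) / 16) * (⇑𝒟)^[(s : ℕ) + 1]
        (X 4 - 5 * X 1 ^ 2 - 10 * X 0 * X 2 + 10 * X 0 ^ 3 + C (16 * α₄) * X 0)) :
    ∀ p : MvPolynomial (Fin 6) ℂ,
      𝒟 (𝒟₃ p) = 𝒟₃ (𝒟 p) ∧ 𝒟 (𝒟₅ p) = 𝒟₅ (𝒟 p) ∧ 𝒟₃ (𝒟₅ p) = 𝒟₅ (𝒟₃ p) := by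
  have hC : ∀ (n : ℕ) [n.AtLeastTwo] (a : ℂ),
      (C (ofNat(n) * a) : MvPolynomial (Fin 6) ℂ) = ofNat(n) * C a := fun n _ a => by
    rw [map_mul, map_ofNat]
  have hnum : ∀ (D : Derivation ℂ (MvPolynomial (Fin 6) ℂ) (MvPolynomial (Fin 6) ℂ)) (n : ℕ)
      [n.AtLeastTwo], D ofNat(n) = 0 := fun D n _ => D.map_natCast n
  simp only [hC] at h5 h𝒟₅
  have x0 : 𝒟 (X 0) = X 1 := hk 0
  have x1 : 𝒟 (X 1) = X 2 := hk 1
  have x2 : 𝒟 (X 2) = X 3 := hk 2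
  have x3 : 𝒟 (X 3) = X 4 := hk 3
  have x4 : 𝒟 (X 4) = X 5 := hk 4
  have x5 := h5
  have f1 : (⇑𝒟)^[1] (X 2 - 3 * X 0 ^ 2) =
        -6 * X 0 * X 1 + X 3 := by
    rw [Function.iterate_succ_apply', Function.iterate_zero_apply]
    simp only [map_add, map_sub, map_neg, Derivation.leibniz, Derivation.leibniz_pow, smul_eq_mul,
      nsmul_eq_mul, hnum, MvPolynomial.derivation_C, x0, x1, x2, x3, x4, x5]
    push_cast
    ring
  have f2 : (⇑𝒟)^[2] (X 2 - 3 * X 0 ^ 2) =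
        -6 * X 1 ^ 2 - 6 * X 0 * X 2 + X 4 := by
    rw [Function.iterate_succ_apply', f1]
    simp only [map_add, map_sub, map_neg, Derivation.leibniz, Derivation.leibniz_pow, smul_eq_mul,
      nsmul_eq_mul, hnum, MvPolynomial.derivation_C, x0, x1, x2, x3, x4, x5]
    ring
  have f3 : (⇑𝒟)^[3] (X 2 - 3 * X 0 ^ 2) =
        -18 * X 1 * X 2 - 6 * X 0 * X 3 + X 5 := by
    rw [Function.iterate_succ_apply', f2]
    simp only [map_add, map_sub, map_neg, Derivation.leibniz, Derivation.leibniz_pow, smul_eq_mul,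
      nsmul_eq_mul, hnum, MvPolynomial.derivation_C, x0, x1, x2, x3, x4, x5]
    push_cast
    ring
  have f4 : (⇑𝒟)^[4] (X 2 - 3 * X 0 ^ 2) =
        4 * X 1 * X 3 + 3 * X 2 ^ 2 + 8 * X 0 * X 4 + 128 * C α₈ + 35 * X 0 ^ 4 + 48 * X 0 ^ 2 *
        C α₄ - 70 * X 0 ^ 2 * X 2 - 64 * X 0 * C α₆ - 16 * X 2 * C α₄ - 70 * X 0 * X 1 ^ 2 := by
    rw [Function.iterate_succ_apply', f3]
    simp only [map_add, map_sub, map_neg, Derivation.leibniz, Derivation.leibniz_pow, smul_eq_mul,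
      nsmul_eq_mul, hnum, MvPolynomial.derivation_C, x0, x1, x2, x3, x4, x5]
    ring
  have f5 : (⇑𝒟)^[5] (X 2 - 3 * X 0 ^ 2) =
        12 * X 1 * X 4 + 140 * X 0 ^ 3 * X 1 + 96 * X 0 * X 1 * C α₄ - 280 * X 0 * X 1 * X 2 -
        64 * X 1 * C α₆ - 70 * X 1 ^ 3 + 10 * X 2 * X 3 - 70 * X 0 ^ 2 * X 3 - 16 * X 3 * C α₄ +
        8 * X 0 * X 5 := by
    rw [Function.iterate_succ_apply', f4]
    simp only [map_add, map_sub, map_neg, Derivation.leibniz, Derivation.leibniz_pow, smul_eq_mul,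
      nsmul_eq_mul, hnum, MvPolynomial.derivation_C, x0, x1, x2, x3, x4, x5]
    push_cast
    ring
  have f6 : (⇑𝒟)^[6] (X 2 - 3 * X 0 ^ 2) =
        -140 * X 0 ^ 2 * X 1 ^ 2 + 96 * X 1 ^ 2 * C α₄ - 490 * X 1 ^ 2 * X 2 - 196 * X 0 * X 1 *
        X 3 + 20 * X 1 * X 5 + 22 * X 2 * X 4 - 420 * X 0 ^ 3 * X 2 - 32 * X 0 * X 2 * C α₄ -
        112 * X 0 * X 2 ^ 2 - 64 * X 2 * C α₆ + 10 * X 3 ^ 2 + 42 * X 0 ^ 2 * X 4 - 16 * X 4 * C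
        α₄ + 1024 * X 0 * C α₈ + 280 * X 0 ^ 5 + 384 * X 0 ^ 3 * C α₄ - 512 * X 0 ^ 2 * C α₆ := by
    rw [Function.iterate_succ_apply', f5]
    simp only [map_add, map_sub, map_neg, Derivation.leibniz, Derivation.leibniz_pow, smul_eq_mul,
      nsmul_eq_mul, hnum, MvPolynomial.derivation_C, x0, x1, x2, x3, x4, x5]
    push_cast
    ring
  have g1 : (⇑𝒟)^[1] (X 4 - 5 * X 1 ^ 2 - 10 * X 0 * X 2 + 10 * X 0 ^ 3 + 16 * C α₄ * X 0) =
        -20 * X 1 * X 2 + 30 * X 0 ^ 2 * X 1 + 16 * X 1 * C α₄ - 10 * X 0 * X 3 + X 5 := by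
    rw [Function.iterate_succ_apply', Function.iterate_zero_apply]
    simp only [map_add, map_sub, map_neg, Derivation.leibniz, Derivation.leibniz_pow, smul_eq_mul,
      nsmul_eq_mul, hnum, MvPolynomial.derivation_C, x0, x1, x2, x3, x4, x5]
    push_cast
    ring
  have g2 : (⇑𝒟)^[2] (X 4 - 5 * X 1 ^ 2 - 10 * X 0 * X 2 + 10 * X 0 ^ 3 + 16 * C α₄ * X 0) =
        -10 * X 0 * X 1 ^ 2 - 2 * X 1 * X 3 + X 2 ^ 2 - 40 * X 0 ^ 2 * X 2 + 4 * X 0 * X 4 + 128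
        * C α₈ + 35 * X 0 ^ 4 + 48 * X 0 ^ 2 * C α₄ - 64 * X 0 * C α₆ := by
    rw [Function.iterate_succ_apply', g1]
    simp only [map_add, map_sub, map_neg, Derivation.leibniz, Derivation.leibniz_pow, smul_eq_mul,
      nsmul_eq_mul, hnum, MvPolynomial.derivation_C, x0, x1, x2, x3, x4, x5]
    push_cast
    ring
  have g3 : (⇑𝒟)^[3] (X 4 - 5 * X 1 ^ 2 - 10 * X 0 * X 2 + 10 * X 0 ^ 3 + 16 * C α₄ * X 0) =
        -10 * X 1 ^ 3 - 100 * X 0 * X 1 * X 2 + 2 * X 1 * X 4 + 140 * X 0 ^ 3 * X 1 + 96 * X 0 *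
        X 1 * C α₄ - 64 * X 1 * C α₆ - 40 * X 0 ^ 2 * X 3 + 4 * X 0 * X 5 := by
    rw [Function.iterate_succ_apply', g2]
    simp only [map_add, map_sub, map_neg, Derivation.leibniz, Derivation.leibniz_pow, smul_eq_mul,
      nsmul_eq_mul, hnum, MvPolynomial.derivation_C, x0, x1, x2, x3, x4, x5]
    push_cast
    ring
  have g4 : (⇑𝒟)^[4] (X 4 - 5 * X 1 ^ 2 - 10 * X 0 * X 2 + 10 * X 0 ^ 3 + 16 * C α₄ * X 0) =
        -130 * X 1 ^ 2 * X 2 + 140 * X 0 ^ 2 * X 1 ^ 2 + 96 * X 1 ^ 2 * C α₄ - 68 * X 0 * X 1 *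
        X 3 + 6 * X 1 * X 5 - 16 * X 0 * X 2 ^ 2 + 2 * X 2 * X 4 - 140 * X 0 ^ 3 * X 2 + 32 * X
        0 * X 2 * C α₄ - 64 * X 2 * C α₆ + 16 * X 0 ^ 2 * X 4 + 512 * X 0 * C α₈ + 140 * X 0 ^ 5
        + 192 * X 0 ^ 3 * C α₄ - 256 * X 0 ^ 2 * C α₆ := by
    rw [Function.iterate_succ_apply', g3]
    simp only [map_add, map_sub, map_neg, Derivation.leibniz, Derivation.leibniz_pow, smul_eq_mul,
      nsmul_eq_mul, hnum, MvPolynomial.derivation_C, x0, x1, x2, x3, x4, x5]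
    push_cast
    ring
  have g5 : (⇑𝒟)^[5] (X 4 - 5 * X 1 ^ 2 - 10 * X 0 * X 2 + 10 * X 0 ^ 3 + 16 * C α₄ * X 0) =
        -140 * X 0 * X 1 ^ 3 - 30 * X 1 ^ 2 * X 3 - 150 * X 1 * X 2 ^ 2 - 560 * X 0 ^ 2 * X 1 *
        X 2 + 128 * X 1 * X 2 * C α₄ + 48 * X 0 * X 1 * X 4 + 1280 * X 1 * C α₈ + 910 * X 0 ^ 4
        * X 1 + 864 * X 0 ^ 2 * X 1 * C α₄ - 896 * X 0 * X 1 * C α₆ - 100 * X 0 * X 2 * X 3 + 8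
        * X 2 * X 5 + 2 * X 3 * X 4 - 140 * X 0 ^ 3 * X 3 + 32 * X 0 * X 3 * C α₄ - 64 * X 3 * C
        α₆ + 16 * X 0 ^ 2 * X 5 := by
    rw [Function.iterate_succ_apply', g4]
    simp only [map_add, map_sub, map_neg, Derivation.leibniz, Derivation.leibniz_pow, smul_eq_mul,
      nsmul_eq_mul, hnum, MvPolynomial.derivation_C, x0, x1, x2, x3, x4, x5]
    push_cast
    ring
  have g6 : (⇑𝒟)^[6] (X 4 - 5 * X 1 ^ 2 - 10 * X 0 * X 2 + 10 * X 0 ^ 3 + 16 * C α₄ * X 0) =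
        -140 * X 1 ^ 4 - 2100 * X 0 * X 1 ^ 2 * X 2 + 18 * X 1 ^ 2 * X 4 + 2520 * X 0 ^ 3 * X 1
        ^ 2 + 1728 * X 0 * X 1 ^ 2 * C α₄ - 896 * X 1 ^ 2 * C α₆ - 236 * X 1 * X 2 * X 3 - 532 *
        X 0 ^ 2 * X 1 * X 3 + 160 * X 1 * X 3 * C α₄ + 80 * X 0 * X 1 * X 5 + 18 * X 2 ^ 3 - 784
        * X 0 ^ 2 * X 2 ^ 2 + 60 * X 0 * X 2 * X 4 + 2304 * X 2 * C α₈ + 70 * X 0 ^ 4 * X 2 +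
        992 * X 0 ^ 2 * X 2 * C α₄ - 1408 * X 0 * X 2 * C α₆ - 100 * X 0 * X 3 ^ 2 + 10 * X 3 *
        X 5 + 2 * X 4 ^ 2 + 84 * X 0 ^ 3 * X 4 + 32 * X 0 * X 4 * C α₄ - 64 * X 4 * C α₆ + 2048
        * X 0 ^ 2 * C α₈ + 560 * X 0 ^ 6 + 768 * X 0 ^ 4 * C α₄ - 1024 * X 0 ^ 3 * C α₆ := by
    rw [Function.iterate_succ_apply', g5]
    simp only [map_add, map_sub, map_neg, Derivation.leibniz, Derivation.leibniz_pow, smul_eq_mul,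
      nsmul_eq_mul, hnum, MvPolynomial.derivation_C, x0, x1, x2, x3, x4, x5]
    push_cast
    ring
  have y0 := (h𝒟₃ 0).trans (congrArg _ f1)
  have y1 := (h𝒟₃ 1).trans (congrArg _ f2)
  have y2 := (h𝒟₃ 2).trans (congrArg _ f3)
  have y3 := (h𝒟₃ 3).trans (congrArg _ f4)
  have y4 := (h𝒟₃ 4).trans (congrArg _ f5)
  have y5 := (h𝒟₃ 5).trans (congrArg _ f6)
  have z0 := (h𝒟₅ 0).trans (congrArg _ g1)
  have z1 := (h𝒟₅ 1).trans (congrArg _ g2)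
  have z2 := (h𝒟₅ 2).trans (congrArg _ g3)
  have z3 := (h𝒟₅ 3).trans (congrArg _ g4)
  have z4 := (h𝒟₅ 4).trans (congrArg _ g5)
  have z5 := (h𝒟₅ 5).trans (congrArg _ g6)
  have c3 : ∀ p, 𝒟 (𝒟₃ p) = 𝒟₃ (𝒟 p) := by
    refine Derivation.commute_of_shift hk h𝒟₃ ?_
    change 𝒟 (𝒟₃ (X 5)) = 𝒟₃ (𝒟 (X 5))
    simp only [map_add, map_sub, map_neg, Derivation.leibniz, Derivation.leibniz_pow, smul_eq_mul,
      nsmul_eq_mul, hnum, MvPolynomial.derivation_C, x0, x1, x2, x3, x4, x5, y0, y1, y2, y3, y4, y5]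
    push_cast
    ring
  have c5 : ∀ p, 𝒟 (𝒟₅ p) = 𝒟₅ (𝒟 p) := by
    refine Derivation.commute_of_shift hk h𝒟₅ ?_
    change 𝒟 (𝒟₅ (X 5)) = 𝒟₅ (𝒟 (X 5))
    simp only [map_add, map_sub, map_neg, Derivation.leibniz, Derivation.leibniz_pow, smul_eq_mul,
      nsmul_eq_mul, hnum, MvPolynomial.derivation_C, x0, x1, x2, x3, x4, x5, z0, z1, z2, z3, z4, z5]
    push_cast
    ring
  refine fun p => ⟨c3 p, c5 p, Derivation.commute_of_commute_shift hk c3 c5 ?_ p⟩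
  simp only [map_add, map_sub, map_neg, Derivation.leibniz, Derivation.leibniz_pow, smul_eq_mul,
    nsmul_eq_mul, hnum, MvPolynomial.derivation_C, y0, y1, y2, y3, y5,
      z0, z1, z3]
  push_cast
  ring
end

section
/- Let F = ℂ⟨u,u₁⟩ be the free associative unital ℂ-algebra on two generators, fix α₄ ∈ ℂ, and let 𝒟 be the unique ℂ-derivation of F with 𝒟(u) = u₁ and 𝒟(u₁) = 3u² + 8α₄. Then 𝒟(u₁² − 2u³ − 16α₄u) = [u₁u, u] + [u, uu₁] = u₁u² + u²u₁ − 2uu₁u. In particular, 𝒟( (1/2)u₁² − u³ − 8α₄u ) lies in the ℂ-linear span of commutators Span_ℂ{ab − ba : a,b ∈ F}, i.e. Ĥ_{3,3} = −(3/16)·( (1/2)u₁² − u³ − 8α₄u ) is a first integral of the non-commutative N=1 Novikov equation. -/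
/-- For the non-commutative `N = 1` Novikov equation (`𝒟(u) = u₁`,
`𝒟(u₁) = 3u² + 8α₄` on `F = ℂ⟨u,u₁⟩`):
`𝒟(u₁² − 2u³ − 16α₄u) = [u₁u,u] + [u,uu₁] = u₁u² + u²u₁ − 2uu₁u`, and in particular
`𝒟((1/2)u₁² − u³ − 8α₄u)` lies in the span of commutators. -/
theorem nc_N1_first_integral (α₄ : ℂ)
    (𝒟 : FreeAlgebra ℂ (Fin 2) →ₗ[ℂ] FreeAlgebra ℂ (Fin 2))
    (hleib : ∀ x y : FreeAlgebra ℂ (Fin 2), 𝒟 (x * y) = 𝒟 x * y + x * 𝒟 y)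
    (u u₁ : FreeAlgebra ℂ (Fin 2))
    (hu : u = FreeAlgebra.ι ℂ 0) (hu₁ : u₁ = FreeAlgebra.ι ℂ 1)
    (h0 : 𝒟 u = u₁)
    (h1 : 𝒟 u₁ = 3 * u ^ 2 + algebraMap ℂ (FreeAlgebra ℂ (Fin 2)) (8 * α₄)) :
    𝒟 (u₁ ^ 2 - 2 * u ^ 3 - (16 * α₄) • u)
        = ((u₁ * u) * u - u * (u₁ * u)) + (u * (u * u₁) - (u * u₁) * u) ∧
    𝒟 (u₁ ^ 2 - 2 * u ^ 3 - (16 * α₄) • u)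
        = u₁ * u ^ 2 + u ^ 2 * u₁ - 2 * (u * u₁ * u) ∧
    𝒟 (((1 : ℂ) / 2) • u₁ ^ 2 - u ^ 3 - (8 * α₄) • u) ∈
      Submodule.span ℂ {x : FreeAlgebra ℂ (Fin 2) |
        ∃ a b : FreeAlgebra ℂ (Fin 2), x = a * b - b * a} := by
  have hsq : 𝒟 (u₁ ^ 2) = 3 * (u ^ 2 * u₁) + 3 * (u₁ * u ^ 2) + (16 * α₄) • u₁ := by
    rw [pow_two u₁, hleib, h1, Algebra.algebraMap_eq_smul_one, add_mul, mul_add, smul_mul_assoc,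
      mul_smul_comm, one_mul, mul_one, show 16 * α₄ = 8 * α₄ + 8 * α₄ by ring, add_smul]
    noncomm_ring
  have hcube : 𝒟 (u ^ 3) = u₁ * u ^ 2 + u * u₁ * u + u ^ 2 * u₁ := by
    rw [pow_succ, pow_two, hleib, hleib, h0]
    noncomm_ring
  have hexpanded : 𝒟 (u₁ ^ 2 - 2 * u ^ 3 - (16 * α₄) • u)
      = u₁ * u ^ 2 + u ^ 2 * u₁ - 2 * (u * u₁ * u) := by
    rw [two_mul (u ^ 3), map_sub, map_sub, map_add, map_smul, hsq, hcube, h0]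
    noncomm_ring
  have hcomm : 𝒟 (u₁ ^ 2 - 2 * u ^ 3 - (16 * α₄) • u)
      = ((u₁ * u) * u - u * (u₁ * u)) + (u * (u * u₁) - (u * u₁) * u) := by
    rw [hexpanded]
    noncomm_ring
  refine ⟨hcomm, hexpanded, ?_⟩
  have hhalf : ((1 : ℂ) / 2) • u₁ ^ 2 - u ^ 3 - (8 * α₄) • u
      = ((1 : ℂ) / 2) • (u₁ ^ 2 - 2 * u ^ 3 - (16 * α₄) • u) := by
    rw [two_mul (u ^ 3)]
    module
  rw [hhalf, map_smul, hcomm]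
  exact Submodule.smul_mem _ _ (Submodule.add_mem _ (Submodule.subset_span ⟨_, _, rfl⟩)
    (Submodule.subset_span ⟨_, _, rfl⟩))
end

section
/- Let F = ℂ⟨u,u₁⟩ be the free associative unital ℂ-algebra on two generators, fix α₄ ∈ ℂ, and let 𝒟 be the unique ℂ-derivation of F with 𝒟(u) = u₁ and 𝒟(u₁) = 3u² + 8α₄. Let S be the unique ℂ-derivation of F with 16·S(u) = u₁u² + u²u₁ − 2uu₁u − 16α₄u₁ and 16·S(u₁) = −(uu₁² + u₁²u) + 2u₁uu₁ − 48α₄u² − 128α₄². Then S is a symmetry of the non-commutative N=1 Novikov equation: 𝒟∘S = S∘𝒟. -/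
section Derivations

variable {R A : Type*} [CommRing R] [Ring A] [Algebra R A]

/-- A linear map satisfying the Leibniz rule kills the scalars. -/
theorem LinearMap.map_algebraMap_of_leibniz (d : A →ₗ[R] A)
    (hd : ∀ x y : A, d (x * y) = d x * y + x * d y) (r : R) : d (algebraMap R A r) = 0 := by
  have h1 : d 1 = 0 := by simpa using hd 1 1
  rw [Algebra.algebraMap_eq_smul_one, map_smul, h1, smul_zero]

/-- Two derivations of a free algebra commute as soon as they commute on the generators. -/
theorem FreeAlgebra.comm_of_leibniz_of_comm_ι {X : Type*}
    (d e : FreeAlgebra R X →ₗ[R] FreeAlgebra R X)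
    (hd : ∀ x y : FreeAlgebra R X, d (x * y) = d x * y + x * d y)
    (he : ∀ x y : FreeAlgebra R X, e (x * y) = e x * y + x * e y)
    (hι : ∀ i : X, d (e (FreeAlgebra.ι R i)) = e (d (FreeAlgebra.ι R i)))
    (a : FreeAlgebra R X) : d (e a) = e (d a) := by
  induction a using FreeAlgebra.induction with
  | grade0 r =>
    rw [LinearMap.map_algebraMap_of_leibniz d hd, LinearMap.map_algebraMap_of_leibniz e he,
      map_zero, map_zero]
  | grade1 i => exact hι i
  | mul x y hx hy =>
    simp only [hd, he, map_add, hx, hy]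
    abel
  | add x y hx hy => simp only [map_add, hx, hy]

end Derivations


/-- The fifth-order KdV flow `S` is a symmetry of the non-commutative `N = 1`
Novikov equation: `𝒟 ∘ S = S ∘ 𝒟` on `F = ℂ⟨u,u₁⟩`. -/
theorem nc_N1_fifth_symmetry (α₄ : ℂ)
    (𝒟 S : FreeAlgebra ℂ (Fin 2) →ₗ[ℂ] FreeAlgebra ℂ (Fin 2))
    (h𝒟leib : ∀ x y : FreeAlgebra ℂ (Fin 2), 𝒟 (x * y) = 𝒟 x * y + x * 𝒟 y)
    (hSleib : ∀ x y : FreeAlgebra ℂ (Fin 2), S (x * y) = S x * y + x * S y)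
    (u u₁ : FreeAlgebra ℂ (Fin 2))
    (hu : u = FreeAlgebra.ι ℂ 0) (hu₁ : u₁ = FreeAlgebra.ι ℂ 1)
    (h0 : 𝒟 u = u₁)
    (h1 : 𝒟 u₁ = 3 * u ^ 2 + algebraMap ℂ (FreeAlgebra ℂ (Fin 2)) (8 * α₄))
    (hS0 : (16 : ℂ) • S u = u₁ * u ^ 2 + u ^ 2 * u₁ - 2 * (u * u₁ * u) - (16 * α₄) • u₁)
    (hS1 : (16 : ℂ) • S u₁ = -(u * u₁ ^ 2 + u₁ ^ 2 * u) + 2 * (u₁ * u * u₁)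
        - (48 * α₄) • u ^ 2 - algebraMap ℂ (FreeAlgebra ℂ (Fin 2)) (128 * α₄ ^ 2)) :
    ∀ a : FreeAlgebra ℂ (Fin 2), 𝒟 (S a) = S (𝒟 a) := by
  have h𝒟one : 𝒟 1 = 0 := by simpa using h𝒟leib 1 1
  have hSone : S 1 = 0 := by simpa using hSleib 1 1
  have h2 : (2 : FreeAlgebra ℂ (Fin 2)) = (2 : ℂ) • 1 := by
    rw [← Algebra.algebraMap_eq_smul_one, map_ofNat]
  have h3 : (3 : FreeAlgebra ℂ (Fin 2)) = (3 : ℂ) • 1 := by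
    rw [← Algebra.algebraMap_eq_smul_one, map_ofNat]
  simp only [h2, h3, Algebra.algebraMap_eq_smul_one, pow_two u, pow_two u₁, smul_mul_assoc,
    one_mul] at h1 hS0 hS1
  have h16 {x y : FreeAlgebra ℂ (Fin 2)} (h : (16 : ℂ) • x = (16 : ℂ) • y) : x = y :=
    smul_right_injective _ (by norm_num : (16 : ℂ) ≠ 0) h
  have hcu : 𝒟 (S u) = S (𝒟 u) := by
    apply h16
    rw [h0, ← map_smul 𝒟, hS0, hS1]
    simp only [map_add, map_sub, map_smul, h𝒟leib, h0, h1, mul_add, add_mul, smul_mul_assoc,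
      mul_smul_comm, mul_assoc, mul_one, one_mul]
    module
  have hcu₁ : 𝒟 (S u₁) = S (𝒟 u₁) := by
    apply h16
    have hSuu : (16 : ℂ) • S (u * u) = ((16 : ℂ) • S u) * u + u * ((16 : ℂ) • S u) := by
      rw [hSleib, smul_add, smul_mul_assoc, mul_smul_comm]
    have hS𝒟 : (16 : ℂ) • S (𝒟 u₁) = (3 : ℂ) • ((16 : ℂ) • S (u * u)) := by
      rw [h1, map_add, map_smul, map_smul, hSone, smul_zero, add_zero, smul_comm]
    rw [hS𝒟, hSuu, ← map_smul 𝒟, hS0, hS1]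
    simp only [map_add, map_sub, map_neg, map_smul, h𝒟leib, h0, h1, h𝒟one, mul_add, add_mul,
      mul_sub, sub_mul, smul_mul_assoc, mul_smul_comm, mul_assoc, mul_one, one_mul]
    module
  refine FreeAlgebra.comm_of_leibniz_of_comm_ι 𝒟 S h𝒟leib hSleib fun i => ?_
  fin_cases i
  · simpa [hu] using hcu
  · simpa [hu₁] using hcu₁
end

section
/- Fix α₄, α₆ ∈ ℂ. Let F = ℂ⟨u,u₁,u₂,u₃⟩ be the free associative unital ℂ-algebra on four generators, let 𝒟 be the unique ℂ-derivation of F with 𝒟(u) = u₁, 𝒟(u₁) = u₂, 𝒟(u₂) = u₃, and 𝒟(u₃) = 𝒢₆ := 5(u₂u + uu₂) + 5u₁² − 10u³ − 16α₄u + 32α₆, and let 𝒟₃ be the unique ℂ-derivation of F with 𝒟₃(u_s) = (1/4)·𝒟^{s+1}(u₂ − 3u²) for s = 0,1,2,3. Then 𝒟∘𝒟₃ = 𝒟₃∘𝒟. -/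
/-- Two linear maps obeying the Leibniz rule commute on a free algebra as soon as they commute on
the generators. -/
theorem FreeAlgebra.leibniz_comm_of_ι {R X : Type*} [CommRing R]
    (D E : FreeAlgebra R X →ₗ[R] FreeAlgebra R X)
    (hD : ∀ x y, D (x * y) = D x * y + x * D y)
    (hE : ∀ x y, E (x * y) = E x * y + x * E y)
    (h : ∀ i, D (E (FreeAlgebra.ι R i)) = E (D (FreeAlgebra.ι R i))) (a : FreeAlgebra R X) :
    D (E a) = E (D a) := by
  have hD1 : D 1 = 0 := by simpa using hD 1 1
  have hE1 : E 1 = 0 := by simpa using hE 1 1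
  induction a using FreeAlgebra.induction with
  | grade0 r => simp [Algebra.algebraMap_eq_smul_one, hD1, hE1]
  | grade1 i => exact h i
  | mul a b ha hb =>
    simp only [hD, hE, map_add, ha, hb]
    abel
  | add a b ha hb => simp only [map_add, ha, hb]

/-- For the non-commutative `N = 2` Novikov equation on `F = ℂ⟨u,u₁,u₂,u₃⟩`
(with `𝒟(u₃) = 𝒢₆ = 5(u₂u + uu₂) + 5u₁² − 10u³ − 16α₄u + 32α₆`), the derivation `𝒟₃`
with `𝒟₃(u_s) = (1/4)𝒟^{s+1}(u₂ − 3u²)` commutes with `𝒟`. -/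
theorem nc_N2_commuting_derivations (α₄ α₆ : ℂ)
    (𝒟 𝒟₃ : FreeAlgebra ℂ (Fin 4) →ₗ[ℂ] FreeAlgebra ℂ (Fin 4))
    (h𝒟leib : ∀ x y : FreeAlgebra ℂ (Fin 4), 𝒟 (x * y) = 𝒟 x * y + x * 𝒟 y)
    (h𝒟₃leib : ∀ x y : FreeAlgebra ℂ (Fin 4), 𝒟₃ (x * y) = 𝒟₃ x * y + x * 𝒟₃ y)
    (u : Fin 4 → FreeAlgebra ℂ (Fin 4)) (hu : ∀ k, u k = FreeAlgebra.ι ℂ k)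
    (h0 : 𝒟 (u 0) = u 1) (h1 : 𝒟 (u 1) = u 2) (h2 : 𝒟 (u 2) = u 3)
    (h3 : 𝒟 (u 3) = 5 * (u 2 * u 0 + u 0 * u 2) + 5 * (u 1) ^ 2 - 10 * (u 0) ^ 3
        - (16 * α₄) • u 0 + algebraMap ℂ (FreeAlgebra ℂ (Fin 4)) (32 * α₆))
    (h𝒟₃ : ∀ s : Fin 4,
      𝒟₃ (u s) = ((1 : ℂ) / 4) • (⇑𝒟)^[(s : ℕ) + 1] (u 2 - 3 * (u 0) ^ 2)) :
    ∀ a : FreeAlgebra ℂ (Fin 4), 𝒟 (𝒟₃ a) = 𝒟₃ (𝒟 a) := by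
  have hD1 : 𝒟 1 = 0 := by simpa using h𝒟leib 1 1
  have hE1 : 𝒟₃ 1 = 0 := by simpa using h𝒟₃leib 1 1
  have e3 (x : FreeAlgebra ℂ (Fin 4)) : 3 * x = (3 : ℂ) • x := by
    rw [ofNat_smul_eq_nsmul ℂ, nsmul_eq_mul, Nat.cast_ofNat]
  have e5 (x : FreeAlgebra ℂ (Fin 4)) : 5 * x = (5 : ℂ) • x := by
    rw [ofNat_smul_eq_nsmul ℂ, nsmul_eq_mul, Nat.cast_ofNat]
  have e10 (x : FreeAlgebra ℂ (Fin 4)) : 10 * x = (10 : ℂ) • x := by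
    rw [ofNat_smul_eq_nsmul ℂ, nsmul_eq_mul, Nat.cast_ofNat]
  have key (s : Fin 4) : 𝒟 (𝒟₃ (u s)) = 𝒟₃ (𝒟 (u s)) := by
    match s with
    | 0 => rw [h0, h𝒟₃, h𝒟₃, map_smul]; rfl
    | 1 => rw [h1, h𝒟₃, h𝒟₃, map_smul]; rfl
    | 2 => rw [h2, h𝒟₃, h𝒟₃, map_smul]; rfl
    | 3 =>
      have E0 := h𝒟₃ 0
      have E1 := h𝒟₃ 1
      have E2 := h𝒟₃ 2
      rw [h𝒟₃ 3, h3]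
      simp only [Algebra.algebraMap_eq_smul_one, e3, e5, e10, pow_succ, pow_zero, one_mul]
        at h3 E0 E1 E2 ⊢
      simp only [Fin.isValue, Fin.coe_ofNat_eq_mod, Nat.reduceMod, Nat.reduceAdd,
        Function.iterate_succ, Function.iterate_zero, Function.comp_apply, id_eq, map_add, map_sub,
        map_smul, h𝒟leib, h𝒟₃leib, h0, h1, h2, h3, hD1, hE1, smul_zero, add_zero, mul_add,
        add_mul, mul_sub, sub_mul, smul_mul_assoc, mul_smul_comm, mul_one, one_mul, mul_assoc]
        at E0 E1 E2 ⊢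
      simp only [E0, E1, E2, mul_add, add_mul, mul_sub, sub_mul, smul_mul_assoc, mul_smul_comm,
        mul_one, one_mul, mul_assoc]
      module
  refine FreeAlgebra.leibniz_comm_of_ι 𝒟 𝒟₃ h𝒟leib h𝒟₃leib fun i => ?_
  rw [← hu]
  exact key i
end

section
/- Let F = ℂ⟨u,u₁⟩ be the free associative unital ℂ-algebra on two generators, fix α₄ ∈ ℂ, and let 𝒟 be the unique ℂ-derivation of F with 𝒟(u) = u₁ and 𝒟(u₁) = 3u² + 8α₄. For q, q₂, q₁, q₀, c ∈ ℂ with q ≠ 0, let p = uu₁ − q·u₁u − q₂u² − q₁u₁ − q₀u − c and let Q ⊆ F be the two-sided ideal generated by p. Then the following are equivalent: (1) 𝒟(Q) ⊆ Q and the images of the normally ordered monomials u₁^a u^b (a, b ≥ 0) form a ℂ-basis of the quotient algebra F/Q; (2) q = 1 and q₂ = q₁ = q₀ = 0 (with c ∈ ℂ arbitrary). -/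
/-- The span of all products `a * p * b` is stable under left multiplication. -/
theorem mul_left_mem_span_mul_mul {A : Type*} [Ring A] [Algebra ℂ A] (p y : A) {x : A}
    (hx : x ∈ Submodule.span ℂ {x : A | ∃ a b : A, x = a * p * b}) :
    y * x ∈ Submodule.span ℂ {x : A | ∃ a b : A, x = a * p * b} := by
  induction hx using Submodule.span_induction with
  | mem x hx =>
    obtain ⟨a, b, rfl⟩ := hx
    exact Submodule.subset_span ⟨y * a, b, by simp only [mul_assoc]⟩
  | zero => simp
  | add x z _ _ hx hz => rw [mul_add]; exact add_mem hx hz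
  | smul r x _ hx => rw [mul_smul_comm]; exact Submodule.smul_mem _ r hx

/-- A derivation killing `p` preserves the two-sided ideal generated by `p`. -/
theorem derivation_mem_span_mul_mul {A : Type*} [Ring A] [Algebra ℂ A] (D : A →ₗ[ℂ] A)
    (hD : ∀ x y : A, D (x * y) = D x * y + x * D y) {p : A} (hp : D p = 0) {x : A}
    (hx : x ∈ Submodule.span ℂ {x : A | ∃ a b : A, x = a * p * b}) :
    D x ∈ Submodule.span ℂ {x : A | ∃ a b : A, x = a * p * b} := by
  induction hx using Submodule.span_induction with
  | mem x hx =>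
    obtain ⟨a, b, rfl⟩ := hx
    rw [hD, hD, hp, mul_zero, add_zero]
    exact add_mem (Submodule.subset_span ⟨_, _, rfl⟩) (Submodule.subset_span ⟨_, _, rfl⟩)
  | zero => simp
  | add x z _ _ hx hz => rw [map_add]; exact add_mem hx hz
  | smul r x _ hx => rw [map_smul]; exact Submodule.smul_mem _ r hx

/-- A submodule of a free algebra on two generators that contains `1` and is stable under left
multiplication by the generators is everything. -/
theorem FreeAlgebra.submodule_eq_top_of_mul_mem (N : Submodule ℂ (FreeAlgebra ℂ (Fin 2)))
    (h1 : (1 : FreeAlgebra ℂ (Fin 2)) ∈ N)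
    (hι : ∀ i, ∀ y ∈ N, FreeAlgebra.ι ℂ i * y ∈ N) : N = ⊤ := by
  have key : ∀ x : FreeAlgebra ℂ (Fin 2), ∀ y ∈ N, x * y ∈ N := by
    intro x
    induction x using FreeAlgebra.induction with
    | grade0 r =>
      intro y hy
      rw [← Algebra.smul_def]
      exact N.smul_mem r hy
    | grade1 i => exact hι i
    | mul a b ha hb =>
      intro y hy
      rw [mul_assoc]
      exact ha _ (hb _ hy)
    | add a b ha hb =>
      intro y hy
      rw [add_mul]
      exact add_mem (ha _ hy) (hb _ hy)
  exact eq_top_iff.2 fun x _ => by simpa using key x 1 h1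

/-- Normally ordered monomials span the Weyl algebra `[u, v] = c`. -/
theorem weyl_span_eq_top (c : ℂ) (Q : Submodule ℂ (FreeAlgebra ℂ (Fin 2)))
    (hQ : Q = Submodule.span ℂ {x | ∃ a b, x = a * (FreeAlgebra.ι ℂ 0 * FreeAlgebra.ι ℂ 1
      - FreeAlgebra.ι ℂ 1 * FreeAlgebra.ι ℂ 0 - c • (1 : FreeAlgebra ℂ (Fin 2))) * b}) :
    Submodule.span ℂ (Set.range fun ab : ℕ × ℕ =>
      Submodule.Quotient.mk (p := Q)
        (FreeAlgebra.ι ℂ (1 : Fin 2) ^ ab.1 * FreeAlgebra.ι ℂ 0 ^ ab.2)) = ⊤ := by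
  set u : FreeAlgebra ℂ (Fin 2) := FreeAlgebra.ι ℂ 0 with hu
  set v : FreeAlgebra ℂ (Fin 2) := FreeAlgebra.ι ℂ 1 with hv
  set S := Submodule.span ℂ (Set.range fun ab : ℕ × ℕ =>
    Submodule.Quotient.mk (p := Q) (v ^ ab.1 * u ^ ab.2)) with hS
  have hmon : ∀ a b : ℕ, v ^ a * u ^ b ∈ S.comap Q.mkQ := fun a b =>
    Submodule.subset_span ⟨(a, b), rfl⟩
  have hQS : Q ≤ S.comap Q.mkQ := fun x hx => by
    rw [Submodule.mem_comap, Submodule.mkQ_apply, (Submodule.Quotient.mk_eq_zero Q).2 hx]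
    exact S.zero_mem
  have ext_mul : ∀ w, (∀ a b : ℕ, w * (v ^ a * u ^ b) ∈ S.comap Q.mkQ) →
      ∀ y ∈ S.comap Q.mkQ, w * y ∈ S.comap Q.mkQ := by
    intro w hw y hy
    have hmap : S = (Submodule.span ℂ (Set.range fun ab : ℕ × ℕ =>
        v ^ ab.1 * u ^ ab.2)).map Q.mkQ := by
      rw [Submodule.map_span, ← Set.range_comp]
      rfl
    have hy' := hy
    rw [Submodule.mem_comap, hmap] at hy'
    obtain ⟨z, hz, hzy⟩ := hy'
    have hdiff : y - z ∈ Q := by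
      rw [← Submodule.Quotient.eq]
      exact hzy.symm
    have hwz : w * z ∈ S.comap Q.mkQ := by
      clear hzy hdiff
      induction hz using Submodule.span_induction with
      | mem x hx =>
        obtain ⟨ab, rfl⟩ := hx
        exact hw _ _
      | zero => simp
      | add x z _ _ hx hz => rw [mul_add]; exact add_mem hx hz
      | smul r x _ hx => rw [mul_smul_comm]; exact Submodule.smul_mem _ r hx
    have hwd : w * (y - z) ∈ Q := by
      rw [hQ] at hdiff ⊢
      exact mul_left_mem_span_mul_mul _ w hdiff
    have := add_mem hwz (hQS hwd)
    rwa [← mul_add, add_sub_cancel] at this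
  have hvmul := ext_mul v fun a b => by
    rw [← mul_assoc, ← pow_succ']
    exact hmon _ _
  have humul := ext_mul u fun a b => by
    induction a with
    | zero =>
      rw [pow_zero, one_mul, ← pow_succ']
      simpa using hmon 0 (b + 1)
    | succ a ih =>
      have e : u * (v ^ (a + 1) * u ^ b) = 1 * (u * v - v * u - c • 1) * (v ^ a * u ^ b)
          + v * (u * (v ^ a * u ^ b)) + c • (v ^ a * u ^ b) := by
        rw [pow_succ']
        simp only [one_mul, sub_mul, smul_mul_assoc, mul_assoc]
        abel
      rw [e]
      refine add_mem (add_mem (hQS ?_) (hvmul _ ih)) (Submodule.smul_mem _ _ (hmon a b))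
      rw [hQ]
      exact Submodule.subset_span ⟨_, _, rfl⟩
  have htop : S.comap Q.mkQ = ⊤ := by
    refine FreeAlgebra.submodule_eq_top_of_mul_mem _ (by simpa using hmon 0 0) fun i => ?_
    fin_cases i
    · exact humul
    · exact hvmul
  refine eq_top_iff.2 fun x _ => ?_
  obtain ⟨y, rfl⟩ := Q.mkQ_surjective x
  exact Submodule.mem_comap.1 (htop ▸ Submodule.mem_top)

/-- The representation of `[u, v] = c` on polynomials with `v ↦ X₁` and `u ↦ c ∂₁ + X₀`. -/
noncomputable def weylRep (c : ℂ) :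
    FreeAlgebra ℂ (Fin 2) →ₐ[ℂ] Module.End ℂ (MvPolynomial (Fin 2) ℂ) :=
  FreeAlgebra.lift ℂ ![c • (MvPolynomial.pderiv 1).toLinearMap
    + LinearMap.mulLeft ℂ (MvPolynomial.X 0), LinearMap.mulLeft ℂ (MvPolynomial.X 1)]

theorem weylRep_u (c : ℂ) (f : MvPolynomial (Fin 2) ℂ) :
    weylRep c (FreeAlgebra.ι ℂ 0) f = c • MvPolynomial.pderiv 1 f + MvPolynomial.X 0 * f := by
  simp [weylRep]

theorem weylRep_v (c : ℂ) (f : MvPolynomial (Fin 2) ℂ) :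
    weylRep c (FreeAlgebra.ι ℂ 1) f = MvPolynomial.X 1 * f := by
  simp [weylRep]

theorem weylRep_relation (c : ℂ) :
    weylRep c (FreeAlgebra.ι ℂ 0 * FreeAlgebra.ι ℂ 1 - FreeAlgebra.ι ℂ 1 * FreeAlgebra.ι ℂ 0
      - c • (1 : FreeAlgebra ℂ (Fin 2))) = 0 := by
  refine LinearMap.ext fun f => ?_
  simp only [map_sub, map_mul, map_smul, map_one, LinearMap.sub_apply, Module.End.mul_apply,
    LinearMap.smul_apply, Module.End.one_apply, weylRep_u, weylRep_v, Derivation.leibniz,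
    MvPolynomial.pderiv_X_self, LinearMap.zero_apply, MvPolynomial.smul_eq_C_mul, smul_eq_mul]
  ring

theorem weylRep_monomial (c : ℂ) (a b : ℕ) :
    weylRep c (FreeAlgebra.ι ℂ (1 : Fin 2) ^ a * FreeAlgebra.ι ℂ 0 ^ b) 1
      = MvPolynomial.X 1 ^ a * MvPolynomial.X 0 ^ b := by
  have hu : weylRep c (FreeAlgebra.ι ℂ 0 ^ b) 1 = MvPolynomial.X 0 ^ b := by
    induction b with
    | zero => simp
    | succ b ih =>
      rw [pow_succ', map_mul, Module.End.mul_apply, ih, weylRep_u, Derivation.leibniz_pow,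
        MvPolynomial.pderiv_X_of_ne (by decide), pow_succ']
      simp
  induction a with
  | zero => rw [pow_zero, one_mul, hu, pow_zero, one_mul]
  | succ a ih =>
    rw [pow_succ', mul_assoc, map_mul, Module.End.mul_apply, ih, weylRep_v, pow_succ', mul_assoc]

theorem MvPolynomial.linearIndependent_X_pow_mul_X_pow {K : Type*} [CommRing K] :
    LinearIndependent K (fun ab : ℕ × ℕ =>
      (MvPolynomial.X 1 ^ ab.1 * MvPolynomial.X 0 ^ ab.2 : MvPolynomial (Fin 2) K)) := by
  have h := (MvPolynomial.basisMonomials (Fin 2) K).linearIndependent.comp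
    (fun ab : ℕ × ℕ => Finsupp.single 1 ab.1 + Finsupp.single 0 ab.2) (by
      intro x y hxy
      have h0 := DFunLike.congr_fun hxy 0
      have h1 := DFunLike.congr_fun hxy 1
      simp at h0 h1
      exact Prod.ext h1 h0)
  have e : (fun ab : ℕ × ℕ =>
      (MvPolynomial.X 1 ^ ab.1 * MvPolynomial.X 0 ^ ab.2 : MvPolynomial (Fin 2) K)) =
      MvPolynomial.basisMonomials (Fin 2) K ∘
        fun ab : ℕ × ℕ => Finsupp.single 1 ab.1 + Finsupp.single 0 ab.2 := by
    funext ab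
    simp [MvPolynomial.X_pow_eq_monomial, MvPolynomial.monomial_mul]
  rw [e]
  exact h

/-- Normally ordered monomials are linearly independent in the Weyl algebra `[u, v] = c`. -/
theorem weyl_linearIndependent (c : ℂ) (Q : Submodule ℂ (FreeAlgebra ℂ (Fin 2)))
    (hQ : Q = Submodule.span ℂ {x | ∃ a b, x = a * (FreeAlgebra.ι ℂ 0 * FreeAlgebra.ι ℂ 1
      - FreeAlgebra.ι ℂ 1 * FreeAlgebra.ι ℂ 0 - c • (1 : FreeAlgebra ℂ (Fin 2))) * b}) :
    LinearIndependent ℂ (fun ab : ℕ × ℕ =>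
      Submodule.Quotient.mk (p := Q)
        (FreeAlgebra.ι ℂ (1 : Fin 2) ^ ab.1 * FreeAlgebra.ι ℂ 0 ^ ab.2)) := by
  let φ : FreeAlgebra ℂ (Fin 2) →ₗ[ℂ] MvPolynomial (Fin 2) ℂ :=
    LinearMap.applyₗ 1 ∘ₗ (weylRep c).toLinearMap
  have hφ : Q ≤ LinearMap.ker φ := by
    rw [hQ, Submodule.span_le]
    rintro _ ⟨a, b, rfl⟩
    change weylRep c _ 1 = 0
    rw [map_mul, map_mul, weylRep_relation, mul_zero, zero_mul, LinearMap.zero_apply]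
  have e : Q.liftQ φ hφ ∘ (fun ab : ℕ × ℕ => Submodule.Quotient.mk (p := Q)
      (FreeAlgebra.ι ℂ (1 : Fin 2) ^ ab.1 * FreeAlgebra.ι ℂ 0 ^ ab.2)) =
      fun ab : ℕ × ℕ => MvPolynomial.X 1 ^ ab.1 * MvPolynomial.X 0 ^ ab.2 :=
    funext fun ab => weylRep_monomial c ab.1 ab.2
  refine LinearIndependent.of_comp (Q.liftQ φ hφ) ?_
  rw [e]
  exact MvPolynomial.linearIndependent_X_pow_mul_X_pow

/-- Classification of quantisation ideals for the non-commutative `N = 1` Novikov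
equation: the two-sided ideal `Q` generated by
`p = uu₁ − q·u₁u − q₂u² − q₁u₁ − q₀u − c` (`q ≠ 0`) is `𝒟`-invariant and the
normally ordered monomials `u₁^a u^b` project to a ℂ-basis of `F/Q` if and only if
`q = 1` and `q₂ = q₁ = q₀ = 0`. -/
theorem nc_N1_quantisation_ideal (α₄ q q₂ q₁ q₀ c : ℂ) (hq : q ≠ 0)
    (𝒟 : FreeAlgebra ℂ (Fin 2) →ₗ[ℂ] FreeAlgebra ℂ (Fin 2))
    (hleib : ∀ x y : FreeAlgebra ℂ (Fin 2), 𝒟 (x * y) = 𝒟 x * y + x * 𝒟 y)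
    (u u₁ : FreeAlgebra ℂ (Fin 2))
    (hu : u = FreeAlgebra.ι ℂ 0) (hu₁ : u₁ = FreeAlgebra.ι ℂ 1)
    (h0 : 𝒟 u = u₁)
    (h1 : 𝒟 u₁ = 3 * u ^ 2 + algebraMap ℂ (FreeAlgebra ℂ (Fin 2)) (8 * α₄))
    (p : FreeAlgebra ℂ (Fin 2))
    (hp : p = u * u₁ - q • (u₁ * u) - q₂ • u ^ 2 - q₁ • u₁ - q₀ • u
        - algebraMap ℂ (FreeAlgebra ℂ (Fin 2)) c)
    -- `Q` is the two-sided ideal generated by `p`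
    (Q : Submodule ℂ (FreeAlgebra ℂ (Fin 2)))
    (hQ : Q = Submodule.span ℂ
        {x : FreeAlgebra ℂ (Fin 2) | ∃ a b : FreeAlgebra ℂ (Fin 2), x = a * p * b}) :
    ((∀ x ∈ Q, 𝒟 x ∈ Q) ∧
      LinearIndependent ℂ (fun ab : ℕ × ℕ =>
        (Submodule.Quotient.mk (p := Q) (u₁ ^ ab.1 * u ^ ab.2))) ∧
      Submodule.span ℂ (Set.range (fun ab : ℕ × ℕ =>
        (Submodule.Quotient.mk (p := Q) (u₁ ^ ab.1 * u ^ ab.2)))) = ⊤)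
    ↔ (q = 1 ∧ q₂ = 0 ∧ q₁ = 0 ∧ q₀ = 0) := by
  subst hu hu₁
  have h1' : 𝒟 (FreeAlgebra.ι ℂ 1) = (3 : ℂ) • FreeAlgebra.ι ℂ 0 ^ 2
      + (8 * α₄) • (1 : FreeAlgebra ℂ (Fin 2)) := by
    rw [h1, Algebra.algebraMap_eq_smul_one, Algebra.smul_def (3 : ℂ), map_ofNat]
  have hD1 : 𝒟 1 = 0 := by simpa using hleib 1 1
  rw [Algebra.algebraMap_eq_smul_one] at hp
  constructor
  · rintro ⟨hinv, hli, -⟩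
    have hpQ : p ∈ Q := hQ ▸ Submodule.subset_span ⟨1, 1, by simp⟩
    have hmem : 𝒟 p + q₂ • p ∈ Q := add_mem (hinv p hpQ) (Q.smul_mem _ hpQ)
    let l : ℕ × ℕ →₀ ℂ := Finsupp.single (2, 0) (1 - q) + Finsupp.single (0, 3) (3 * (1 - q))
      + Finsupp.single (1, 1) (-(q₂ * (q + 1))) + Finsupp.single (0, 2) (-(q₂ ^ 2 + 3 * q₁))
      + Finsupp.single (1, 0) (-(q₂ * q₁ + q₀))
      + Finsupp.single (0, 1) (8 * α₄ * (1 - q) - q₂ * q₀)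
      + Finsupp.single (0, 0) (-(8 * α₄ * q₁ + q₂ * c))
    have hl : l = 0 := by
      refine linearIndependent_iff.1 hli l ?_
      simp only [l, map_add, Finsupp.linearCombination_single, ← Submodule.Quotient.mk_smul,
        ← Submodule.Quotient.mk_add]
      rw [Submodule.Quotient.mk_eq_zero]
      convert hmem using 1
      rw [hp]
      simp only [map_sub, map_smul, hleib, h0, h1', hD1, pow_succ, pow_zero, one_mul, mul_one,
        mul_add, add_mul, mul_smul_comm, smul_mul_assoc, mul_assoc]
      module
    have hcoeff := DFunLike.congr_fun hl
    have e20 := hcoeff (2, 0)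
    have e11 := hcoeff (1, 1)
    have e02 := hcoeff (0, 2)
    have e10 := hcoeff (1, 0)
    simp only [l, Finsupp.add_apply, Finsupp.single_apply, Finsupp.zero_apply, Prod.mk.injEq]
      at e20 e11 e02 e10
    norm_num at e20 e11 e02 e10
    have hq1 : q = 1 := by linear_combination -e20
    subst hq1
    have hq2 : q₂ = 0 := by
      rcases e11 with h | h
      · exact h
      · norm_num at h
    subst hq2
    have hq1 : q₁ = 0 := by linear_combination -e02 / 3
    subst hq1
    exact ⟨rfl, rfl, rfl, by linear_combination -e10⟩
  · rintro ⟨rfl, rfl, rfl, rfl⟩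
    simp only [one_smul, zero_smul, sub_zero] at hp
    have hDp : 𝒟 p = 0 := by
      rw [hp]
      simp only [map_sub, map_smul, hleib, h0, h1', hD1, pow_succ, pow_zero, one_mul,
        mul_add, add_mul, mul_smul_comm, smul_mul_assoc, mul_assoc, mul_one]
      module
    refine ⟨fun x hx => ?_, ?_, ?_⟩
    · rw [hQ] at hx ⊢
      exact derivation_mem_span_mul_mul 𝒟 hleib hDp hx
    · exact weyl_linearIndependent c Q (hp ▸ hQ)
    · exact weyl_span_eq_top c Q (hp ▸ hQ)
end

section
/- Fix α₄, α₆ ∈ ℂ. Let F = ℂ⟨u₀,u₁,u₂,u₃⟩ be the free associative unital ℂ-algebra on four generators and let 𝒟 be the unique ℂ-derivation of F with 𝒟(u_k) = u_{k+1} for k = 0,1,2 and 𝒟(u₃) = 5(u₂u₀ + u₀u₂) + 5u₁² − 10u₀³ − 16α₄u₀ + 32α₆. For 0 ≤ i < j ≤ 3, let q_{ij} ∈ ℂ∖{0} and let h_{ij} be an element of the ℂ-linear span of the normally ordered monomials u₃^{a₃}u₂^{a₂}u₁^{a₁}u₀^{a₀} of weight 5a₃ + 4a₂ + 3a₁ +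 2a₀ < i + j + 4. Let Q ⊆ F be the two-sided ideal generated by the six polynomials p_{ij} = u_iu_j − q_{ij}·u_ju_i + h_{ij}. If 𝒟(Q) ⊆ Q and the images of the normally ordered monomials u₃^{a₃}u₂^{a₂}u₁^{a₁}u₀^{a₀} form a ℂ-basis of F/Q, then q_{ij} = 1 for all 0 ≤ i < j ≤ 3. -/
section WeightFiltration

variable {A : Type*} [Ring A]

/-- The weight of a word in the letters `u₀, …, u₃`, the letter `u_k` having weight `k + 2`. -/
def wordWeight (L : List (Fin 4)) : ℕ := (L.map fun k : Fin 4 => (k : ℕ) + 2).sum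

/-- The value of a word in `A`. -/
def wordProd (u : Fin 4 → A) (L : List (Fin 4)) : A := (L.map u).prod

/-- The normally ordered word with prescribed multiplicities. -/
def normalWord (a : Fin 4 → ℕ) : List (Fin 4) :=
  List.replicate (a 3) 3 ++ List.replicate (a 2) 2 ++ List.replicate (a 1) 1 ++
    List.replicate (a 0) 0

@[simp] theorem wordWeight_nil : wordWeight [] = 0 := rfl

@[simp] theorem wordWeight_cons (k : Fin 4) (L : List (Fin 4)) :
    wordWeight (k :: L) = k + 2 + wordWeight L := by simp [wordWeight]

@[simp] theorem wordWeight_append (L M : List (Fin 4)) :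
    wordWeight (L ++ M) = wordWeight L + wordWeight M := by simp [wordWeight]

theorem wordWeight_replicate (n : ℕ) (k : Fin 4) :
    wordWeight (List.replicate n k) = n * (k + 2) := by
  simp only [wordWeight, List.map_replicate, List.sum_replicate, smul_eq_mul]

theorem wordWeight_normalWord (a : Fin 4 → ℕ) :
    wordWeight (normalWord a) = 5 * a 3 + 4 * a 2 + 3 * a 1 + 2 * a 0 := by
  simp only [normalWord, wordWeight_append, wordWeight_replicate, Fin.isValue, Fin.val_zero,
    Fin.val_one, Fin.val_two, show ((3 : Fin 4) : ℕ) = 3 from rfl]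
  ring

theorem pairwise_normalWord (a : Fin 4 → ℕ) : (normalWord a).Pairwise (· ≥ ·) := by
  simp only [normalWord, List.pairwise_append, List.pairwise_replicate, List.mem_append,
    List.mem_replicate]
  grind

theorem count_normalWord (a : Fin 4 → ℕ) (k : Fin 4) : (normalWord a).count k = a k := by
  fin_cases k <;> simp [normalWord, List.count_replicate]

theorem normalWord_count {L : List (Fin 4)} (hL : L.Pairwise (· ≥ ·)) :
    normalWord (fun k => L.count k) = L :=
  List.Perm.eq_of_pairwise (le := (· ≥ ·)) (fun _ _ _ _ h₁ h₂ => le_antisymm h₂ h₁)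
    (pairwise_normalWord _) hL (List.perm_iff_count.2 fun k => count_normalWord _ k)

variable {u : Fin 4 → A}

@[simp] theorem wordProd_nil : wordProd u [] = 1 := rfl

@[simp] theorem wordProd_cons (k : Fin 4) (L : List (Fin 4)) :
    wordProd u (k :: L) = u k * wordProd u L := by simp [wordProd]

@[simp] theorem wordProd_append (L M : List (Fin 4)) :
    wordProd u (L ++ M) = wordProd u L * wordProd u M := by simp [wordProd]

theorem wordProd_normalWord (a : Fin 4 → ℕ) :
    wordProd u (normalWord a) = u 3 ^ a 3 * u 2 ^ a 2 * u 1 ^ a 1 * u 0 ^ a 0 := by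
  simp [wordProd, normalWord, mul_assoc]

variable [Algebra ℂ A]

/-- The span of all words of weight `< n`. -/
def wordSpan (u : Fin 4 → A) (n : ℕ) : Submodule ℂ A :=
  Submodule.span ℂ (wordProd u '' {L | wordWeight L < n})

/-- The span of the words of weight `< n` whose letters have weakly decreasing indices. -/
def normalSpan (u : Fin 4 → A) (n : ℕ) : Submodule ℂ A :=
  Submodule.span ℂ (wordProd u '' {L | L.Pairwise (· ≥ ·) ∧ wordWeight L < n})

theorem wordProd_mem {L : List (Fin 4)} {n : ℕ} (h : wordWeight L < n) :
    wordProd u L ∈ wordSpan u n :=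
  Submodule.subset_span ⟨L, h, rfl⟩

theorem wordProd_mem_normalSpan {L : List (Fin 4)} {n : ℕ} (hL : L.Pairwise (· ≥ ·))
    (h : wordWeight L < n) : wordProd u L ∈ normalSpan u n :=
  Submodule.subset_span ⟨L, ⟨hL, h⟩, rfl⟩

theorem normalSpan_mono {m n : ℕ} (h : m ≤ n) : normalSpan u m ≤ normalSpan u n :=
  Submodule.span_mono (Set.image_mono fun _ hL => ⟨hL.1, hL.2.trans_le h⟩)

theorem mul_wordProd_mem {m : ℕ} {x : A} (hx : x ∈ wordSpan u m) (L : List (Fin 4)) {n : ℕ}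
    (hn : m + wordWeight L ≤ n) : x * wordProd u L ∈ wordSpan u n := by
  induction hx using Submodule.span_induction with
  | mem x hx =>
    obtain ⟨M, hM, rfl⟩ := hx
    rw [← wordProd_append]
    exact wordProd_mem (by simp only [wordWeight_append, Set.mem_ofPred_eq] at *; omega)
  | zero => simp
  | add x y _ _ hx hy => rw [add_mul]; exact add_mem hx hy
  | smul c x _ hx => rw [smul_mul_assoc]; exact Submodule.smul_mem _ _ hx

theorem wordProd_mul_mem {m : ℕ} {x : A} (hx : x ∈ wordSpan u m) (L : List (Fin 4)) {n : ℕ}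
    (hn : m + wordWeight L ≤ n) : wordProd u L * x ∈ wordSpan u n := by
  induction hx using Submodule.span_induction with
  | mem x hx =>
    obtain ⟨M, hM, rfl⟩ := hx
    rw [← wordProd_append]
    exact wordProd_mem (by simp only [wordWeight_append, Set.mem_ofPred_eq] at *; omega)
  | zero => simp
  | add x y _ _ hx hy => rw [mul_add]; exact add_mem hx hy
  | smul c x _ hx => rw [mul_smul_comm]; exact Submodule.smul_mem _ _ hx

/-- A derivation raising the weight of each letter by at most one does so on all words. -/
theorem derivation_mem_wordSpan {D : A →ₗ[ℂ] A} (hD : ∀ x y, D (x * y) = D x * y + x * D y)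
    (hu : ∀ k : Fin 4, D (u k) ∈ wordSpan u (k + 4)) {n : ℕ} {x : A} (hx : x ∈ wordSpan u n) :
    D x ∈ wordSpan u (n + 1) := by
  have hD1 : D 1 = 0 := by simpa using hD 1 1
  induction hx using Submodule.span_induction with
  | mem x hx =>
    obtain ⟨L, hL, rfl⟩ := hx
    rw [Set.mem_ofPred_eq] at hL
    induction L generalizing n with
    | nil => simp [hD1]
    | cons k L ih =>
      rw [wordWeight_cons] at hL
      rw [wordProd_cons, hD]
      refine add_mem (mul_wordProd_mem (hu k) L (by omega)) ?_
      simpa using wordProd_mul_mem (ih (n := n - (k + 2)) (by omega)) [k] (n := n + 1)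
        (by simp only [wordWeight_cons, wordWeight_nil]; omega)
  | zero => simp
  | add x y _ _ hx hy => rw [map_add]; exact add_mem hx hy
  | smul c x _ hx => rw [map_smul]; exact Submodule.smul_mem _ _ hx

variable {Q : Submodule ℂ A} {q : Fin 4 → Fin 4 → ℂ} {h : Fin 4 → Fin 4 → A}

theorem letter_mul_mem_normalSpan_sup (hl : ∀ a, ∀ x ∈ Q, a * x ∈ Q) (hr : ∀ a, ∀ x ∈ Q, x * a ∈ Q)
    (hh : ∀ i j : Fin 4, i < j → h i j ∈ wordSpan u (i + j + 4))
    (hp : ∀ i j : Fin 4, i < j → u i * u j - q i j • (u j * u i) + h i j ∈ Q)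
    {n : ℕ} (ih : ∀ m < n, wordSpan u m ≤ normalSpan u m ⊔ Q) (k : Fin 4) {m : ℕ}
    (hm : m + (k + 2) ≤ n) {x : A} (hx : x ∈ normalSpan u m ⊔ Q) :
    u k * x ∈ normalSpan u n ⊔ Q := by
  induction k using WellFoundedGT.induction generalizing m x with
  | ind k ihk =>
  obtain ⟨y, hy, z, hz, rfl⟩ := Submodule.mem_sup.1 hx
  rw [mul_add]
  refine add_mem ?_ (Submodule.mem_sup_right (hl _ _ hz))
  clear hx
  induction hy using Submodule.span_induction with
  | mem x hx =>
    obtain ⟨L, ⟨hL, hLm⟩, rfl⟩ := hx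
    cases L with
    | nil =>
      rw [← wordProd_cons]
      exact Submodule.mem_sup_left (wordProd_mem_normalSpan (by simp) (by simp at *; omega))
    | cons j L =>
      rw [wordWeight_cons] at hLm
      by_cases hjk : j ≤ k
      · rw [← wordProd_cons]
        refine Submodule.mem_sup_left (wordProd_mem_normalSpan (List.pairwise_cons.2 ⟨?_, hL⟩)
          (by simp only [wordWeight_cons]; omega))
        intro i hi
        rcases List.mem_cons.1 hi with rfl | hi
        · exact hjk
        · exact ((List.pairwise_cons.1 hL).1 i hi).trans hjk
      · have hkj : k < j := not_le.1 hjk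
        have hkj' : (k : ℕ) < j := hkj
        have key : u k * wordProd u (j :: L) =
            (u k * u j - q k j • (u j * u k) + h k j) * wordProd u L +
              q k j • (u j * wordProd u (k :: L)) - h k j * wordProd u L := by
          simp only [wordProd_cons, add_mul, sub_mul, smul_mul_assoc, mul_assoc]
          abel
        rw [key]
        refine sub_mem (add_mem (Submodule.mem_sup_right (hr _ _ (hp k j hkj)))
          (Submodule.smul_mem _ _ (ihk j hkj (m := wordWeight (k :: L) + 1) ?_ ?_))) ?_
        · rw [wordWeight_cons]; omega
        · exact ih _ (by rw [wordWeight_cons]; omega) (wordProd_mem (Nat.lt_succ_self _))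
        · exact sup_le_sup_right (normalSpan_mono (by omega)) Q
            (ih (k + j + 4 + wordWeight L) (by omega) (mul_wordProd_mem (hh k j hkj) L le_rfl))
  | zero => simp
  | add x y _ _ hx hy => rw [mul_add]; exact add_mem hx hy
  | smul c x _ hx => rw [mul_smul_comm]; exact Submodule.smul_mem _ _ hx

/-- Modulo the ideal `Q`, every word is a combination of normally ordered words of no larger
weight. -/
theorem wordSpan_le_normalSpan_sup (hl : ∀ a, ∀ x ∈ Q, a * x ∈ Q) (hr : ∀ a, ∀ x ∈ Q, x * a ∈ Q)
    (hh : ∀ i j : Fin 4, i < j → h i j ∈ wordSpan u (i + j + 4))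
    (hp : ∀ i j : Fin 4, i < j → u i * u j - q i j • (u j * u i) + h i j ∈ Q) (n : ℕ) :
    wordSpan u n ≤ normalSpan u n ⊔ Q := by
  induction n using Nat.strong_induction_on with
  | _ n ih =>
  refine Submodule.span_le.2 ?_
  rintro _ ⟨L, hL, rfl⟩
  rw [Set.mem_ofPred_eq] at hL
  cases L with
  | nil => exact Submodule.mem_sup_left (wordProd_mem_normalSpan List.Pairwise.nil hL)
  | cons k L =>
    rw [wordWeight_cons] at hL
    rw [wordProd_cons]
    exact letter_mul_mem_normalSpan_sup hl hr hh hp ih k (m := n - (k + 2)) (by omega)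
      (ih _ (by omega) (wordProd_mem (by omega)))

/-- If the normally ordered monomials form a basis modulo `Q`, then the coefficient of a normally
ordered monomial is a functional that kills `Q` and every word of smaller weight. -/
theorem exists_coefficient_functional (hl : ∀ a, ∀ x ∈ Q, a * x ∈ Q)
    (hr : ∀ a, ∀ x ∈ Q, x * a ∈ Q)
    (hh : ∀ i j : Fin 4, i < j → h i j ∈ wordSpan u (i + j + 4))
    (hp : ∀ i j : Fin 4, i < j → u i * u j - q i j • (u j * u i) + h i j ∈ Q)
    (hindep : LinearIndependent ℂ (fun a : Fin 4 → ℕ =>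
      (Submodule.Quotient.mk (p := Q) (u 3 ^ a 3 * u 2 ^ a 2 * u 1 ^ a 1 * u 0 ^ a 0))))
    (hspan : Submodule.span ℂ (Set.range (fun a : Fin 4 → ℕ =>
      (Submodule.Quotient.mk (p := Q)
        (u 3 ^ a 3 * u 2 ^ a 2 * u 1 ^ a 1 * u 0 ^ a 0)))) = ⊤) (a : Fin 4 → ℕ) :
    ∃ φ : A →ₗ[ℂ] ℂ, (∀ x ∈ Q, φ x = 0) ∧
      (∀ x ∈ wordSpan u (5 * a 3 + 4 * a 2 + 3 * a 1 + 2 * a 0), φ x = 0) ∧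
      ∀ b : Fin 4 → ℕ, φ (u 3 ^ b 3 * u 2 ^ b 2 * u 1 ^ b 1 * u 0 ^ b 0) =
        if b = a then 1 else 0 := by
  let B := Module.Basis.mk hindep hspan.ge
  let φ : A →ₗ[ℂ] ℂ := B.coord a ∘ₗ Q.mkQ
  have hφQ : ∀ x ∈ Q, φ x = 0 := fun x hx => by
    simp [φ, (Submodule.Quotient.mk_eq_zero Q).2 hx]
  have hφ : ∀ b : Fin 4 → ℕ, φ (u 3 ^ b 3 * u 2 ^ b 2 * u 1 ^ b 1 * u 0 ^ b 0) =
      if b = a then 1 else 0 := fun b => by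
    have hb : Submodule.Quotient.mk (p := Q) (u 3 ^ b 3 * u 2 ^ b 2 * u 1 ^ b 1 * u 0 ^ b 0) =
        B b := by simp [B]
    simp only [φ, LinearMap.comp_apply, Submodule.mkQ_apply, hb, Module.Basis.coord_apply,
      Module.Basis.repr_self, Finsupp.single_apply]
  refine ⟨φ, hφQ, fun x hx => ?_, hφ⟩
  obtain ⟨y, hy, z, hz, rfl⟩ :=
    Submodule.mem_sup.1 (wordSpan_le_normalSpan_sup hl hr hh hp _ hx)
  rw [map_add, hφQ z hz, add_zero]
  suffices hle : normalSpan u (5 * a 3 + 4 * a 2 + 3 * a 1 + 2 * a 0) ≤ LinearMap.ker φ from hle hy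
  refine Submodule.span_le.2 ?_
  rintro _ ⟨L, ⟨hL, hLa⟩, rfl⟩
  rw [SetLike.mem_coe, LinearMap.mem_ker, ← normalWord_count hL, wordProd_normalWord,
    hφ (fun k => L.count k), if_neg]
  rintro rfl
  rw [← wordWeight_normalWord fun k => L.count k, normalWord_count hL] at hLa
  exact lt_irrefl _ hLa

end WeightFiltration


/-- For the non-commutative `N = 2` Novikov equation: if the two-sided ideal `Q`
generated by the six polynomials `p_{ij} = u_iu_j − q_{ij}u_ju_i + h_{ij}`
(`0 ≤ i < j ≤ 3`, `q_{ij} ≠ 0`, `h_{ij}` a span of normally ordered monomials of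
weight `< i + j + 4`) is `𝒟`-invariant and the normally ordered monomials project
to a ℂ-basis of `F/Q`, then `q_{ij} = 1` for all `i < j`. -/
theorem nc_N2_quantisation_q_eq_one (α₄ α₆ : ℂ)
    (𝒟 : FreeAlgebra ℂ (Fin 4) →ₗ[ℂ] FreeAlgebra ℂ (Fin 4))
    (hleib : ∀ x y : FreeAlgebra ℂ (Fin 4), 𝒟 (x * y) = 𝒟 x * y + x * 𝒟 y)
    (u : Fin 4 → FreeAlgebra ℂ (Fin 4)) (hu : ∀ k, u k = FreeAlgebra.ι ℂ k)
    (h0 : 𝒟 (u 0) = u 1) (h1 : 𝒟 (u 1) = u 2) (h2 : 𝒟 (u 2) = u 3)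
    (h3 : 𝒟 (u 3) = 5 * (u 2 * u 0 + u 0 * u 2) + 5 * (u 1) ^ 2 - 10 * (u 0) ^ 3
        - (16 * α₄) • u 0 + algebraMap ℂ (FreeAlgebra ℂ (Fin 4)) (32 * α₆))
    (q : Fin 4 → Fin 4 → ℂ) (hq : ∀ i j : Fin 4, i < j → q i j ≠ 0)
    (h : Fin 4 → Fin 4 → FreeAlgebra ℂ (Fin 4))
    (hh : ∀ i j : Fin 4, i < j →
      h i j ∈ Submodule.span ℂ {m : FreeAlgebra ℂ (Fin 4) | ∃ a : Fin 4 → ℕ,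
        5 * a 3 + 4 * a 2 + 3 * a 1 + 2 * a 0 < (i : ℕ) + (j : ℕ) + 4 ∧
        m = u 3 ^ a 3 * u 2 ^ a 2 * u 1 ^ a 1 * u 0 ^ a 0})
    -- `Q` is the two-sided ideal generated by the six polynomials `p_{ij}`
    (Q : Submodule ℂ (FreeAlgebra ℂ (Fin 4)))
    (hQ : Q = Submodule.span ℂ
        {x : FreeAlgebra ℂ (Fin 4) | ∃ (a b : FreeAlgebra ℂ (Fin 4)) (i j : Fin 4),
          i < j ∧ x = a * (u i * u j - q i j • (u j * u i) + h i j) * b})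
    (hinv : ∀ x ∈ Q, 𝒟 x ∈ Q)
    (hindep : LinearIndependent ℂ (fun a : Fin 4 → ℕ =>
      (Submodule.Quotient.mk (p := Q) (u 3 ^ a 3 * u 2 ^ a 2 * u 1 ^ a 1 * u 0 ^ a 0))))
    (hspan : Submodule.span ℂ (Set.range (fun a : Fin 4 → ℕ =>
      (Submodule.Quotient.mk (p := Q)
        (u 3 ^ a 3 * u 2 ^ a 2 * u 1 ^ a 1 * u 0 ^ a 0)))) = ⊤) :
    ∀ i j : Fin 4, i < j → q i j = 1 := by
  have hl : ∀ a, ∀ x ∈ Q, a * x ∈ Q := by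
    intro a x hx
    rw [hQ] at hx ⊢
    induction hx using Submodule.span_induction with
    | mem x hx =>
      obtain ⟨c, d, i, j, hij, rfl⟩ := hx
      exact Submodule.subset_span ⟨a * c, d, i, j, hij, by simp only [mul_assoc]⟩
    | zero => simp
    | add x y _ _ hx hy => rw [mul_add]; exact add_mem hx hy
    | smul c x _ hx => rw [mul_smul_comm]; exact Submodule.smul_mem _ _ hx
  have hr : ∀ a, ∀ x ∈ Q, x * a ∈ Q := by
    intro a x hx
    rw [hQ] at hx ⊢
    induction hx using Submodule.span_induction with
    | mem x hx =>
      obtain ⟨c, d, i, j, hij, rfl⟩ := hx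
      exact Submodule.subset_span ⟨c, d * a, i, j, hij, by simp only [mul_assoc]⟩
    | zero => simp
    | add x y _ _ hx hy => rw [add_mul]; exact add_mem hx hy
    | smul c x _ hx => rw [smul_mul_assoc]; exact Submodule.smul_mem _ _ hx
  have hp : ∀ i j : Fin 4, i < j → u i * u j - q i j • (u j * u i) + h i j ∈ Q := by
    intro i j hij
    rw [hQ]
    exact Submodule.subset_span ⟨1, 1, i, j, hij, by simp⟩
  have hhw : ∀ i j : Fin 4, i < j → h i j ∈ wordSpan u (i + j + 4) := by
    intro i j hij
    refine Submodule.span_le.2 ?_ (hh i j hij)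
    rintro _ ⟨a, ha, rfl⟩
    rw [← wordProd_normalWord]
    exact wordProd_mem (by rwa [wordWeight_normalWord])
  have hw : ∀ (L : List (Fin 4)) (n : ℕ), wordWeight L < n → wordProd u L ∈ wordSpan u n :=
    fun L n hL => wordProd_mem hL
  have hDu : ∀ k : Fin 4, 𝒟 (u k) ∈ wordSpan u (k + 4) := by
    intro k
    fin_cases k
    · simpa [h0] using hw [1] 4 (by decide)
    · simpa [h1] using hw [2] 5 (by decide)
    · simpa [h2] using hw [3] 6 (by decide)
    · have e : 𝒟 (u 3) = (5 : ℂ) • wordProd u [2, 0] + (5 : ℂ) • wordProd u [0, 2] +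
          (5 : ℂ) • wordProd u [1, 1] - (10 : ℂ) • wordProd u [0, 0, 0] -
          (16 * α₄) • wordProd u [0] + (32 * α₆) • wordProd u [] := by
        rw [h3, Algebra.algebraMap_eq_smul_one]
        simp only [wordProd_cons, wordProd_nil, mul_one, ofNat_smul_eq_nsmul, pow_succ, pow_zero,
          one_mul]
        noncomm_ring
      change 𝒟 (u 3) ∈ wordSpan u 7
      rw [e]
      refine add_mem (sub_mem (sub_mem (add_mem (add_mem ?_ ?_) ?_) ?_) ?_) ?_ <;>
        exact Submodule.smul_mem _ _ (hw _ _ (by decide))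
  have hDh : ∀ i j : Fin 4, i < j → 𝒟 (h i j) ∈ wordSpan u (i + j + 5) := fun i j hij =>
    derivation_mem_wordSpan hleib hDu (hhw i j hij)
  have hDp : ∀ i j : Fin 4, i < j → 𝒟 (u i) * u j + u i * 𝒟 (u j) -
      q i j • (𝒟 (u j) * u i + u j * 𝒟 (u i)) + 𝒟 (h i j) ∈ Q := by
    intro i j hij
    simpa [hleib] using hinv _ (hp i j hij)
  have hcoeff := exists_coefficient_functional hl hr hhw hp hindep hspan
  have hswap : ∀ (n : ℕ) (φ : FreeAlgebra ℂ (Fin 4) →ₗ[ℂ] ℂ), (∀ x ∈ Q, φ x = 0) →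
      (∀ x ∈ wordSpan u n, φ x = 0) → ∀ i j : Fin 4, i < j → (i : ℕ) + j + 4 = n →
      φ (u i * u j) = q i j * φ (u j * u i) := by
    intro n φ hφQ hφ i j hij hn
    have e := hφQ _ (hp i j hij)
    rw [map_add, hφ (h i j) (hn ▸ hhw i j hij), map_sub, map_smul, smul_eq_mul, add_zero] at e
    exact sub_eq_zero.1 e
  have key01 : ∀ φ : FreeAlgebra ℂ (Fin 4) →ₗ[ℂ] ℂ, (∀ x ∈ Q, φ x = 0) →
      (∀ x ∈ wordSpan u 6, φ x = 0) →
      (1 - q 0 1) * φ (u 1 * u 1) + (q 0 2 - q 0 1) * φ (u 2 * u 0) = 0 := by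
    intro φ hφQ hφ
    have e := hφQ _ (hDp 0 1 (by decide))
    rw [map_add, hφ _ (hDh 0 1 (by decide)), h0, h1, map_sub, map_smul, map_add, map_add,
      hswap 6 φ hφQ hφ 0 2 (by decide) rfl, smul_eq_mul] at e
    linear_combination e
  have key02 : ∀ φ : FreeAlgebra ℂ (Fin 4) →ₗ[ℂ] ℂ, (∀ x ∈ Q, φ x = 0) →
      (∀ x ∈ wordSpan u 7, φ x = 0) →
      (q 1 2 - q 0 2) * φ (u 2 * u 1) + (q 0 3 - q 0 2) * φ (u 3 * u 0) = 0 := by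
    intro φ hφQ hφ
    have e := hφQ _ (hDp 0 2 (by decide))
    rw [map_add, hφ _ (hDh 0 2 (by decide)), h0, h2, map_sub, map_smul, map_add, map_add,
      hswap 7 φ hφQ hφ 0 3 (by decide) rfl, hswap 7 φ hφQ hφ 1 2 (by decide) rfl,
      smul_eq_mul] at e
    linear_combination e
  have key12 : ∀ φ : FreeAlgebra ℂ (Fin 4) →ₗ[ℂ] ℂ, (∀ x ∈ Q, φ x = 0) →
      (∀ x ∈ wordSpan u 8, φ x = 0) →
      (1 - q 1 2) * φ (u 2 * u 2) + (q 1 3 - q 1 2) * φ (u 3 * u 1) = 0 := by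
    intro φ hφQ hφ
    have e := hφQ _ (hDp 1 2 (by decide))
    rw [map_add, hφ _ (hDh 1 2 (by decide)), h1, h2, map_sub, map_smul, map_add, map_add,
      hswap 8 φ hφQ hφ 1 3 (by decide) rfl, smul_eq_mul] at e
    linear_combination e
  have q01 : q 0 1 = 1 := by
    obtain ⟨φ, hφQ, hφ, hφm⟩ := hcoeff ![0, 2, 0, 0]
    have e := key01 φ hφQ hφ
    have e₁ := hφm ![0, 2, 0, 0]
    have e₂ := hφm ![1, 0, 1, 0]
    simp [pow_two] at e₁ e₂
    rw [e₁, e₂] at e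
    linear_combination -e
  have q02 : q 0 2 = 1 := by
    obtain ⟨φ, hφQ, hφ, hφm⟩ := hcoeff ![1, 0, 1, 0]
    have e := key01 φ hφQ hφ
    have e₁ := hφm ![1, 0, 1, 0]
    simp at e₁
    rw [e₁, q01] at e
    linear_combination e
  have q12 : q 1 2 = 1 := by
    obtain ⟨φ, hφQ, hφ, hφm⟩ := hcoeff ![0, 1, 1, 0]
    have e := key02 φ hφQ hφ
    have e₁ := hφm ![0, 1, 1, 0]
    have e₂ := hφm ![1, 0, 0, 1]
    simp at e₁ e₂
    rw [e₁, e₂, q02] at e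
    linear_combination e
  have q03 : q 0 3 = 1 := by
    obtain ⟨φ, hφQ, hφ, hφm⟩ := hcoeff ![1, 0, 0, 1]
    have e := key02 φ hφQ hφ
    have e₁ := hφm ![1, 0, 0, 1]
    simp at e₁
    rw [e₁, q02, q12] at e
    linear_combination e
  have q13 : q 1 3 = 1 := by
    obtain ⟨φ, hφQ, hφ, hφm⟩ := hcoeff ![0, 1, 0, 1]
    have e := key12 φ hφQ hφ
    have e₁ := hφm ![0, 1, 0, 1]
    simp at e₁
    rw [e₁, q12] at e
    linear_combination e
  have q23 : q 2 3 = 1 := by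
    obtain ⟨φ, hφQ, hφ, hφm⟩ := hcoeff ![0, 0, 1, 1]
    replace hφ : ∀ x ∈ wordSpan u 9, φ x = 0 := hφ
    have e₁ := hφm ![0, 0, 1, 1]
    simp at e₁
    -- a commutator lying in `Q` up to terms of lower weight stays so after multiplication by words
    have hcomm : ∀ (i j : Fin 4) (L M : List (Fin 4)), i < j → q i j = 1 →
        (i : ℕ) + j + 4 + wordWeight L + wordWeight M ≤ 9 →
        φ (wordProd u L * (u i * u j - u j * u i) * wordProd u M) = 0 := by
      intro i j L M hij hqij hLM
      have hQLM := hφQ _ (hr (wordProd u M) _ (hl (wordProd u L) _ (hp i j hij)))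
      have hhLM := hφ _ (mul_wordProd_mem (wordProd_mul_mem (hhw i j hij) L le_rfl) M hLM)
      rw [hqij, one_smul, mul_add, add_mul, map_add, hhLM, add_zero] at hQLM
      exact hQLM
    have hcomm₁ : φ (u 1 * 𝒟 (u 3) - 𝒟 (u 3) * u 1) = 0 := by
      have e : u 1 * 𝒟 (u 3) - 𝒟 (u 3) * u 1 =
          (5 : ℂ) • (wordProd u [] * (u 1 * u 2 - u 2 * u 1) * wordProd u [0]) -
          (5 : ℂ) • (wordProd u [2] * (u 0 * u 1 - u 1 * u 0) * wordProd u []) -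
          (5 : ℂ) • (wordProd u [] * (u 0 * u 1 - u 1 * u 0) * wordProd u [2]) +
          (5 : ℂ) • (wordProd u [0] * (u 1 * u 2 - u 2 * u 1) * wordProd u []) +
          (10 : ℂ) • (wordProd u [] * (u 0 * u 1 - u 1 * u 0) * wordProd u [0, 0]) +
          (10 : ℂ) • (wordProd u [0] * (u 0 * u 1 - u 1 * u 0) * wordProd u [0]) +
          (10 : ℂ) • (wordProd u [0, 0] * (u 0 * u 1 - u 1 * u 0) * wordProd u []) +
          (16 * α₄) • (wordProd u [] * (u 0 * u 1 - u 1 * u 0) * wordProd u []) := by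
        rw [h3, Algebra.algebraMap_eq_smul_one]
        simp only [wordProd_cons, wordProd_nil, mul_one, one_mul, ofNat_smul_eq_nsmul, mul_add,
          mul_sub, add_mul, sub_mul, smul_mul_assoc, mul_smul_comm, smul_sub]
        noncomm_ring
      rw [e]
      simp only [map_add, map_sub, map_smul]
      rw [hcomm 1 2 [] [0] (by decide) q12 (by decide), hcomm 0 1 [2] [] (by decide) q01 (by decide),
        hcomm 0 1 [] [2] (by decide) q01 (by decide), hcomm 1 2 [0] [] (by decide) q12 (by decide),
        hcomm 0 1 [] [0, 0] (by decide) q01 (by decide),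
        hcomm 0 1 [0] [0] (by decide) q01 (by decide),
        hcomm 0 1 [0, 0] [] (by decide) q01 (by decide),
        hcomm 0 1 [] [] (by decide) q01 (by decide)]
      simp
    have e := hφQ _ (hDp 1 3 (by decide))
    rw [map_add, hφ _ (hDh 1 3 (by decide)), h1, map_sub, map_smul, map_add, map_add,
      hswap 9 φ hφQ hφ 2 3 (by decide) rfl, e₁, q13, smul_eq_mul] at e
    rw [map_sub] at hcomm₁
    linear_combination e - hcomm₁
  intro i j hij
  fin_cases i <;> fin_cases j <;> first | exact absurd hij (by decide) | assumption
end

section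
/- Fix α₄, α₆ ∈ ℂ and c ∈ ℂ. Let F = ℂ⟨u₀,u₁,u₂,u₃⟩ be the free associative unital ℂ-algebra on four generators, let 𝒟 be the unique ℂ-derivation of F with 𝒟(u_k) = u_{k+1} for k = 0,1,2 and 𝒟(u₃) = 5(u₂u₀ + u₀u₂) + 5u₁² − 10u₀³ − 16α₄u₀ + 32α₆, and let 𝒟₃ be the unique ℂ-derivation of F with 𝒟₃(u_s) = (1/4)·𝒟^{s+1}(u₂ − 3u₀²) for s = 0,1,2,3. Let J(c) ⊆ F be the two-sided ideal generated by the six elements u₀u₁ − u₁u₀, u₀u₂ − u₂u₀, u₁u₃ − u₃u₁, u₀u₃ − u₃u₀ − c, u₂u₁ − u₁u₂ − c, and u₂u₃ − u₃u₂ − 10c·u₀. Then J(c) is invariant under both derivations: 𝒟(J(c)) ⊆ J(c) and 𝒟₃(J(c)) ⊆ J(c). -/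
/-- A linear map satisfying the Leibniz rule that sends a set of generators of a two-sided ideal
into that ideal preserves the ideal. -/
theorem leibniz_map_mem_span {A : Type*} [Ring A] [Algebra ℂ A] (δ : A →ₗ[ℂ] A)
    (hδ : ∀ x y, δ (x * y) = δ x * y + x * δ y) {G : Set A} {J : Submodule ℂ A}
    (hJ : J = Submodule.span ℂ {x : A | ∃ a b g : A, g ∈ G ∧ x = a * g * b})
    (hl : ∀ a x, x ∈ J → a * x ∈ J) (hr : ∀ x b, x ∈ J → x * b ∈ J)
    (hG : ∀ g ∈ G, δ g ∈ J) : ∀ x ∈ J, δ x ∈ J := by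
  intro x hx
  rw [hJ] at hx
  induction hx using Submodule.span_induction with
  | mem x hx =>
    obtain ⟨a, b, g, hg, rfl⟩ := hx
    have hgJ : ∀ a b, a * g * b ∈ J := fun a b => by
      rw [hJ]; exact Submodule.subset_span ⟨a, b, g, hg, rfl⟩
    rw [hδ, hδ, add_mul]
    exact J.add_mem (J.add_mem (hgJ _ _) (hr _ _ (hl _ _ (hG g hg)))) (hgJ _ _)
  | zero => simp
  | add x y _ _ hx hy => rw [map_add]; exact J.add_mem hx hy
  | smul r x _ hx => rw [map_smul]; exact J.smul_mem r hx

/-- The span of the elements `a * g * b` with `g ∈ G` is closed under left and right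
multiplication. -/
theorem mul_mem_span_mul_mul {A : Type*} [Ring A] [Algebra ℂ A] {G : Set A} {J : Submodule ℂ A}
    (hJ : J = Submodule.span ℂ {x : A | ∃ a b g : A, g ∈ G ∧ x = a * g * b}) :
    (∀ a x, x ∈ J → a * x ∈ J) ∧ (∀ x b, x ∈ J → x * b ∈ J) := by
  subst hJ
  constructor
  · intro a x hx
    induction hx using Submodule.span_induction with
    | mem x hx =>
      obtain ⟨p, q, g, hg, rfl⟩ := hx
      exact Submodule.subset_span ⟨a * p, q, g, hg, by simp only [mul_assoc]⟩
    | zero => simp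
    | add x y _ _ hx hy => rw [mul_add]; exact Submodule.add_mem _ hx hy
    | smul r x _ hx => rw [mul_smul_comm]; exact Submodule.smul_mem _ r hx
  · intro x b hx
    induction hx using Submodule.span_induction with
    | mem x hx =>
      obtain ⟨p, q, g, hg, rfl⟩ := hx
      exact Submodule.subset_span ⟨p, q * b, g, hg, by simp only [mul_assoc]⟩
    | zero => simp
    | add x y _ _ hx hy => rw [add_mul]; exact Submodule.add_mem _ hx hy
    | smul r x _ hx => rw [smul_mul_assoc]; exact Submodule.smul_mem _ r hx

/-- A subspace closed under left and right multiplication is the kernel of an algebra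
homomorphism. -/
theorem exists_algHom_ker {A : Type} [Ring A] [Algebra ℂ A] (J : Submodule ℂ A)
    (hl : ∀ a x, x ∈ J → a * x ∈ J) (hr : ∀ x b, x ∈ J → x * b ∈ J) :
    ∃ (B : Type) (_ : Ring B) (_ : Algebra ℂ B) (f : A →ₐ[ℂ] B), ∀ x, f x = 0 ↔ x ∈ J := by
  let I : TwoSidedIdeal A := TwoSidedIdeal.mk' (J : Set A) J.zero_mem
    (fun hx hy => J.add_mem hx hy) (fun hx => J.neg_mem hx)
    (fun {a x} hx => hl a x hx) (fun {x b} hx => hr x b hx)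
  refine ⟨I.ringCon.Quotient, inferInstance, inferInstance, I.ringCon.mkₐ ℂ, fun x => ?_⟩
  have h : x ∈ I ↔ x ∈ J := by simp [I]
  rw [← h, TwoSidedIdeal.mem_iff]
  exact RingCon.eq _


/-- The two-sided ideal `J(c)` of `F = ℂ⟨u₀,u₁,u₂,u₃⟩` generated by the quantum
commutation relations `[u₀,u₁] = [u₀,u₂] = [u₁,u₃] = 0`, `[u₀,u₃] = [u₂,u₁] = c`,
`[u₂,u₃] = 10c·u₀` is invariant under both `𝒟` and `𝒟₃` of the non-commutative
`N = 2` Novikov hierarchy. -/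
theorem nc_N2_quantisation_ideal_invariant (α₄ α₆ c : ℂ)
    (𝒟 𝒟₃ : FreeAlgebra ℂ (Fin 4) →ₗ[ℂ] FreeAlgebra ℂ (Fin 4))
    (h𝒟leib : ∀ x y : FreeAlgebra ℂ (Fin 4), 𝒟 (x * y) = 𝒟 x * y + x * 𝒟 y)
    (h𝒟₃leib : ∀ x y : FreeAlgebra ℂ (Fin 4), 𝒟₃ (x * y) = 𝒟₃ x * y + x * 𝒟₃ y)
    (u : Fin 4 → FreeAlgebra ℂ (Fin 4)) (hu : ∀ k, u k = FreeAlgebra.ι ℂ k)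
    (h0 : 𝒟 (u 0) = u 1) (h1 : 𝒟 (u 1) = u 2) (h2 : 𝒟 (u 2) = u 3)
    (h3 : 𝒟 (u 3) = 5 * (u 2 * u 0 + u 0 * u 2) + 5 * (u 1) ^ 2 - 10 * (u 0) ^ 3
        - (16 * α₄) • u 0 + algebraMap ℂ (FreeAlgebra ℂ (Fin 4)) (32 * α₆))
    (h𝒟₃ : ∀ s : Fin 4,
      𝒟₃ (u s) = ((1 : ℂ) / 4) • (⇑𝒟)^[(s : ℕ) + 1] (u 2 - 3 * (u 0) ^ 2))
    (G : Set (FreeAlgebra ℂ (Fin 4)))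
    (hG : G = {u 0 * u 1 - u 1 * u 0,
               u 0 * u 2 - u 2 * u 0,
               u 1 * u 3 - u 3 * u 1,
               u 0 * u 3 - u 3 * u 0 - algebraMap ℂ (FreeAlgebra ℂ (Fin 4)) c,
               u 2 * u 1 - u 1 * u 2 - algebraMap ℂ (FreeAlgebra ℂ (Fin 4)) c,
               u 2 * u 3 - u 3 * u 2 - (10 * c) • u 0})
    -- `J` is the two-sided ideal generated by `G`
    (J : Submodule ℂ (FreeAlgebra ℂ (Fin 4)))
    (hJ : J = Submodule.span ℂ
        {x : FreeAlgebra ℂ (Fin 4) | ∃ (a b g : FreeAlgebra ℂ (Fin 4)),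
          g ∈ G ∧ x = a * g * b}) :
    ∀ x ∈ J, 𝒟 x ∈ J ∧ 𝒟₃ x ∈ J := by
  obtain ⟨hl, hr⟩ := mul_mem_span_mul_mul hJ
  obtain ⟨B, _, _, f, hf⟩ := exists_algHom_ker J hl hr
  have hGJ : ∀ g ∈ G, f g = 0 := fun g hg => (hf g).2 <| by
    rw [hJ]; exact Submodule.subset_span ⟨1, 1, g, hg, by simp⟩
  have hc : ∀ a : ℂ, algebraMap ℂ (FreeAlgebra ℂ (Fin 4)) a = a • 1 :=
    Algebra.algebraMap_eq_smul_one
  simp only [hc] at hG h3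
  have D1 : 𝒟 1 = 0 := by simpa using h𝒟leib 1 1
  have E1 : 𝒟₃ 1 = 0 := by simpa using h𝒟₃leib 1 1
  have n3 (x : FreeAlgebra ℂ (Fin 4)) : 3 * x = (3 : ℂ) • x := by
    rw [Algebra.smul_def, map_ofNat]
  have n5 (x : FreeAlgebra ℂ (Fin 4)) : 5 * x = (5 : ℂ) • x := by
    rw [Algebra.smul_def, map_ofNat]
  have n10 (x : FreeAlgebra ℂ (Fin 4)) : 10 * x = (10 : ℂ) • x := by
    rw [Algebra.smul_def, map_ofNat]
  simp only [n5, n10, pow_succ, pow_zero, one_mul] at h3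
  have e0 := h𝒟₃ 0
  have e1 := h𝒟₃ 1
  have e2 := h𝒟₃ 2
  have e3 := h𝒟₃ 3
  simp only [Fin.coe_ofNat_eq_mod, Nat.reduceMod, Nat.zero_add, Nat.reduceAdd,
    Function.iterate_succ, Function.iterate_zero, Function.comp_apply, id_eq, n3, pow_succ,
    pow_zero, one_mul, map_add, map_sub, map_smul, h𝒟leib, h0, h1, h2, h3, D1, smul_zero,
    add_zero] at e0 e1 e2 e3
  generalize u 0 = x0, u 1 = x1, u 2 = x2, u 3 = x3 at *
  subst hG
  simp only [Set.mem_insert_iff, Set.mem_singleton_iff, forall_eq_or_imp, forall_eq, map_sub,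
    map_mul, map_smul, map_one] at hGJ
  obtain ⟨g1, g2, g3, g4, g5, g6⟩ := hGJ
  generalize hy0 : f x0 = y0, hy1 : f x1 = y1, hy2 : f x2 = y2, hy3 : f x3 = y3 at *
  have r10 : y1 * y0 = y0 * y1 := by rw [← sub_eq_zero, ← neg_eq_zero, ← g1]; abel
  have r20 : y2 * y0 = y0 * y2 := by rw [← sub_eq_zero, ← neg_eq_zero, ← g2]; abel
  have r31 : y3 * y1 = y1 * y3 := by rw [← sub_eq_zero, ← neg_eq_zero, ← g3]; abel
  have r30 : y3 * y0 = y0 * y3 - c • 1 := by rw [← sub_eq_zero, ← neg_eq_zero, ← g4]; abel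
  have r21 : y2 * y1 = y1 * y2 + c • 1 := by rw [← sub_eq_zero, ← g5]; abel
  have r32 : y3 * y2 = y2 * y3 - (10 * c) • y0 := by
    rw [← sub_eq_zero, ← neg_eq_zero, ← g6]; abel
  have r10' (z : B) : y1 * (y0 * z) = y0 * (y1 * z) := by simp only [← mul_assoc, r10]
  have r20' (z : B) : y2 * (y0 * z) = y0 * (y2 * z) := by simp only [← mul_assoc, r20]
  have r31' (z : B) : y3 * (y1 * z) = y1 * (y3 * z) := by simp only [← mul_assoc, r31]
  have r30' (z : B) : y3 * (y0 * z) = y0 * (y3 * z) - c • z := by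
    simp [← mul_assoc, r30, sub_mul]
  have r21' (z : B) : y2 * (y1 * z) = y1 * (y2 * z) + c • z := by
    simp [← mul_assoc, r21, add_mul]
  refine fun x hx => ⟨leibniz_map_mem_span 𝒟 h𝒟leib hJ hl hr ?_ x hx,
    leibniz_map_mem_span 𝒟₃ h𝒟₃leib hJ hl hr ?_ x hx⟩
  · rintro g (rfl | rfl | rfl | rfl | rfl | rfl) <;> rw [← hf] <;>
    simp only [map_sub, map_add, map_smul, map_mul, map_one, map_zero, h𝒟leib,
      h0, h1, h2, h3, D1, hy0, hy1, hy2, hy3] <;>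
    simp only [mul_add, add_mul, mul_sub, sub_mul, smul_mul_assoc, mul_smul_comm,
      mul_assoc, mul_one, one_mul, smul_zero, r10, r20, r31, r30, r21, r32,
      r10', r20', r21'] <;>
    module
  · rintro g (rfl | rfl | rfl | rfl | rfl | rfl) <;> rw [← hf] <;>
    simp only [map_sub, map_add, map_smul, map_mul, map_one, map_zero, h𝒟₃leib,
      e0, e1, e2, e3, E1, hy0, hy1, hy2, hy3] <;>
    simp only [mul_add, add_mul, mul_sub, sub_mul, smul_mul_assoc, mul_smul_comm,
      mul_assoc, mul_one, one_mul, smul_zero, r10, r20, r31, r30, r21, r32,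
      r10', r20', r31', r30', r21'] <;>
    module
end

section
/- Fix α₄, α₆ ∈ ℂ. Let F = ℂ⟨u₀,u₁,u₂,u₃⟩ be the free associative unital ℂ-algebra on four generators and let 𝒟 be the unique ℂ-derivation of F with 𝒟(u_k) = u_{k+1} for k = 0,1,2 and 𝒟(u₃) = 5(u₂u₀ + u₀u₂) + 5u₁² − 10u₀³ − 16α₄u₀ + 32α₆. For 0 ≤ i < j ≤ 3, let h_{ij} be an element of the ℂ-linear span of the normally ordered monomials u₃^{a₃}u₂^{a₂}u₁^{a₁}u₀^{a₀} of weight 5a₃ + 4a₂ + 3a₁ + 2a₀ < i + j + 4, and let Q ⊆ F be the two-sided ideal generated by the six polynomials p_{ij} = u_iu_j − u_ju_i − h_{ij}. Then Q is a quantisation ideal (i.e. 𝒟(Q) ⊆ Q and the images of the normally ordered monomials form a ℂ-basis of F/Q) if and only if there exists c ∈ ℂ such that h_{01} = h_{02} = h_{13} = 0, h_{03} = c, h_{12} = −c, and h_{23} = 10c·u₀. -/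
namespace Novikov

open FreeAlgebra Polynomial

/-- The free algebra `ℂ⟨u₀, u₁, u₂, u₃⟩`. -/
abbrev Free4 : Type := FreeAlgebra ℂ (Fin 4)

/-- The generator `u_k`. -/
abbrev g (k : Fin 4) : Free4 := ι ℂ k

/-- The weight of the generator `u_k`. -/
def wt (k : Fin 4) : ℕ := k + 2

/-- The weight of the normally ordered monomial with exponents `a`. -/
def expWt (a : Fin 4 → ℕ) : ℕ := 5 * a 3 + 4 * a 2 + 3 * a 1 + 2 * a 0

/-- The normally ordered monomial with exponents `a`. -/
def normalMonomial (a : Fin 4 → ℕ) : Free4 :=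
  g 3 ^ a 3 * g 2 ^ a 2 * g 1 ^ a 1 * g 0 ^ a 0

/-- The span of the words of weight `< n`. -/
def wordFiltration (n : ℕ) : Submodule ℂ Free4 :=
  Submodule.span ℂ {x | ∃ l : List (Fin 4), (l.map wt).sum < n ∧ x = (l.map (ι ℂ)).prod}

/-- The span of the normally ordered monomials of weight `< n`. -/
def normalSpan (n : ℕ) : Submodule ℂ Free4 :=
  Submodule.span ℂ {m | ∃ a, expWt a < n ∧ m = normalMonomial a}

section WordFiltration

lemma word_mem {l : List (Fin 4)} {n : ℕ} (h : (l.map wt).sum < n) :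
    (l.map (ι ℂ)).prod ∈ wordFiltration n :=
  Submodule.subset_span ⟨l, h, rfl⟩

lemma wordFiltration_mono {m n : ℕ} (h : m ≤ n) : wordFiltration m ≤ wordFiltration n :=
  Submodule.span_mono fun _ ⟨l, hl, hx⟩ => ⟨l, hl.trans_le h, hx⟩

lemma mul_mem_wordFiltration {m n k : ℕ} (hk : m + n ≤ k + 1) {x y : Free4}
    (hx : x ∈ wordFiltration m) (hy : y ∈ wordFiltration n) : x * y ∈ wordFiltration k := by
  induction hx using Submodule.span_induction with
  | mem x hx =>
    obtain ⟨l, hl, rfl⟩ := hx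
    induction hy using Submodule.span_induction with
    | mem y hy =>
      obtain ⟨l', hl', rfl⟩ := hy
      rw [← List.prod_append, ← List.map_append]
      exact word_mem (by rw [List.map_append, List.sum_append]; omega)
    | zero => simp
    | add y z _ _ hy hz => rw [mul_add]; exact add_mem hy hz
    | smul c y _ hy => rw [mul_smul_comm]; exact Submodule.smul_mem _ _ hy
  | zero => simp
  | add y z _ _ hy hz => rw [add_mul]; exact add_mem hy hz
  | smul c y _ hy => rw [smul_mul_assoc]; exact Submodule.smul_mem _ _ hy

lemma g_mem (k : Fin 4) {n : ℕ} (h : (k : ℕ) + 2 < n) : g k ∈ wordFiltration n := by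
  simpa using word_mem (l := [k]) (n := n) (by simpa [wt] using h)

lemma algebraMap_mem (c : ℂ) {n : ℕ} (h : 0 < n) :
    algebraMap ℂ Free4 c ∈ wordFiltration n := by
  rw [Algebra.algebraMap_eq_smul_one]
  exact Submodule.smul_mem _ _ (word_mem (l := []) (by simpa using h))

lemma exists_mem_wordFiltration (x : Free4) : ∃ n, x ∈ wordFiltration n := by
  induction x using FreeAlgebra.induction with
  | grade0 c => exact ⟨1, algebraMap_mem c one_pos⟩
  | grade1 k => exact ⟨_, g_mem k (Nat.lt_succ_self _)⟩
  | mul a b ha hb =>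
    obtain ⟨m, hm⟩ := ha
    obtain ⟨n, hn⟩ := hb
    exact ⟨_, mul_mem_wordFiltration (Nat.le_succ _) hm hn⟩
  | add a b ha hb =>
    obtain ⟨m, hm⟩ := ha
    obtain ⟨n, hn⟩ := hb
    exact ⟨m + n, add_mem (wordFiltration_mono (by omega) hm)
      (wordFiltration_mono (by omega) hn)⟩

/-- The sorted word with exponents `a`. -/
def sortedWord (a : Fin 4 → ℕ) : List (Fin 4) :=
  List.replicate (a 3) 3 ++ List.replicate (a 2) 2 ++ List.replicate (a 1) 1 ++
    List.replicate (a 0) 0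

lemma prod_sortedWord (a : Fin 4 → ℕ) :
    ((sortedWord a).map (ι ℂ)).prod = normalMonomial a := by
  simp [sortedWord, normalMonomial, mul_assoc]

lemma weight_sortedWord (a : Fin 4 → ℕ) : ((sortedWord a).map wt).sum = expWt a := by
  simp [sortedWord, expWt, wt]; ring

lemma perm_sortedWord (l : List (Fin 4)) : l.Perm (sortedWord fun k => l.count k) := by
  rw [List.perm_iff_count]
  intro k
  fin_cases k <;> simp [sortedWord, List.count_replicate]

lemma normalSpan_le_wordFiltration (n : ℕ) : normalSpan n ≤ wordFiltration n := by
  refine Submodule.span_le.2 ?_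
  rintro _ ⟨a, ha, rfl⟩
  rw [← prod_sortedWord]
  exact word_mem (by rwa [weight_sortedWord])

end WordFiltration

section Straightening

variable {Q : Submodule ℂ Free4}

/-- A submodule which is a two-sided ideal modulo which the generators commute up to terms of
lower weight. -/
structure IsStraightening (Q : Submodule ℂ Free4) : Prop where
  mul_left : ∀ a x : Free4, x ∈ Q → a * x ∈ Q
  mul_right : ∀ x a : Free4, x ∈ Q → x * a ∈ Q
  comm_mem : ∀ i j : Fin 4, g i * g j - g j * g i ∈ wordFiltration (wt i + wt j) ⊔ Q

lemma IsStraightening.perm (hQ : IsStraightening Q) {l l' : List (Fin 4)} (h : l.Perm l') :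
    (l.map (ι ℂ)).prod - (l'.map (ι ℂ)).prod ∈ wordFiltration (l.map wt).sum ⊔ Q := by
  induction h with
  | nil => simp
  | @cons x l l' _ ih =>
    obtain ⟨v, hv, q, hq, hvq⟩ := Submodule.mem_sup.1 ih
    simp only [List.map_cons, List.prod_cons, List.sum_cons]
    rw [← mul_sub, ← hvq, mul_add]
    refine Submodule.add_mem_sup ?_ (hQ.mul_left _ _ hq)
    exact mul_mem_wordFiltration (m := wt x + 1) (by omega) (g_mem x (by simp [wt])) hv
  | swap x y l =>
    obtain ⟨v, hv, q, hq, hvq⟩ := Submodule.mem_sup.1 (hQ.comm_mem y x)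
    simp only [List.map_cons, List.prod_cons, List.sum_cons]
    rw [← mul_assoc, ← mul_assoc, ← sub_mul, ← hvq, add_mul]
    refine Submodule.add_mem_sup ?_ (hQ.mul_right _ _ hq)
    exact mul_mem_wordFiltration (n := (l.map wt).sum + 1) (by omega) hv
      (word_mem (Nat.lt_succ_self _))
  | @trans l₁ l₂ l₃ h₁ h₂ ih₁ ih₂ =>
    rw [← (h₁.map wt).sum_eq] at ih₂
    simpa using add_mem ih₁ ih₂

lemma IsStraightening.word_sub_normalMonomial (hQ : IsStraightening Q) (l : List (Fin 4)) :
    (l.map (ι ℂ)).prod - normalMonomial (fun k => l.count k) ∈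
      wordFiltration (l.map wt).sum ⊔ Q := by
  rw [← prod_sortedWord]
  exact hQ.perm (perm_sortedWord l)

lemma expWt_count (l : List (Fin 4)) : expWt (fun k => l.count k) = (l.map wt).sum := by
  rw [← weight_sortedWord]
  exact (((perm_sortedWord l).map wt).sum_eq).symm

lemma IsStraightening.wordFiltration_le (hQ : IsStraightening Q) (n : ℕ) :
    wordFiltration n ≤ normalSpan n ⊔ Q := by
  induction n with
  | zero =>
    refine Submodule.span_le.2 ?_
    rintro _ ⟨l, hl, rfl⟩
    omega
  | succ n ih =>
    refine Submodule.span_le.2 ?_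
    rintro _ ⟨l, hl, rfl⟩
    have h1 : normalSpan n ≤ normalSpan (n + 1) :=
      Submodule.span_mono fun _ ⟨a, ha, hx⟩ => ⟨a, ha.trans (Nat.lt_succ_self n), hx⟩
    have h2 := sup_le ((wordFiltration_mono (Nat.lt_succ_iff.1 hl)).trans
      (ih.trans (sup_le_sup_right h1 Q))) le_sup_right (hQ.word_sub_normalMonomial l)
    have h3 : normalMonomial (fun k => l.count k) ∈ normalSpan (n + 1) ⊔ Q :=
      Submodule.mem_sup_left (Submodule.subset_span ⟨_, by rwa [expWt_count], rfl⟩)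
    simpa using add_mem h2 h3

lemma IsStraightening.span_eq_top (hQ : IsStraightening Q) :
    Submodule.span ℂ (Set.range fun a => Submodule.Quotient.mk (p := Q) (normalMonomial a)) =
      ⊤ := by
  refine eq_top_iff.2 fun y _ => ?_
  obtain ⟨x, rfl⟩ := Submodule.mkQ_surjective Q y
  obtain ⟨n, hn⟩ := exists_mem_wordFiltration x
  obtain ⟨z, hz, q, hq, rfl⟩ := Submodule.mem_sup.1 (hQ.wordFiltration_le n hn)
  have hq' : Q.mkQ q = 0 := by simpa using hq
  rw [map_add, hq', add_zero]
  have h := Submodule.mem_map_of_mem (f := Q.mkQ) hz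
  rw [normalSpan, Submodule.map_span] at h
  refine Submodule.span_mono ?_ h
  rintro _ ⟨_, ⟨a, _, rfl⟩, rfl⟩
  exact ⟨a, rfl⟩

end Straightening

section Symbol

variable {Q : Submodule ℂ Free4}

/-- The abelianisation, into `ℂ[u₀, u₁, u₂, u₃]`. -/
noncomputable def abel4 : Free4 →ₐ[ℂ] MvPolynomial (Fin 4) ℂ := FreeAlgebra.lift ℂ MvPolynomial.X

/-- Restriction of a commutative polynomial to the weighted line through `x`. -/
noncomputable def weightedLine (x : Fin 4 → ℂ) : MvPolynomial (Fin 4) ℂ →ₐ[ℂ] ℂ[X] :=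
  MvPolynomial.aeval fun k => C (x k) * X ^ wt k

lemma normalSpan_inter_eq_zero
    (hli : LinearIndependent ℂ fun a => Submodule.Quotient.mk (p := Q) (normalMonomial a))
    {n : ℕ} {x : Free4} (hx : x ∈ normalSpan n) (hxQ : x ∈ Q) : x = 0 := by
  have h : LinearIndependent ℂ (Q.mkQ ∘ normalMonomial) := hli
  refine (Submodule.disjoint_def.1 (Submodule.range_ker_disjoint h)) x ?_ (by simpa using hxQ)
  refine Submodule.span_mono ?_ hx
  rintro _ ⟨a, _, rfl⟩
  exact ⟨a, rfl⟩

/-- The leading part of an element of a straightening ideal with a PBW quotient has vanishing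
abelianisation. -/
lemma IsStraightening.coeff_eq_zero (hQ : IsStraightening Q)
    (hli : LinearIndependent ℂ fun a => Submodule.Quotient.mk (p := Q) (normalMonomial a))
    {n : ℕ} {x : Free4} (hx : x ∈ wordFiltration (n + 1)) (hxQ : x ∈ Q) (v : Fin 4 → ℂ) :
    (weightedLine v (abel4 x)).coeff n = 0 := by
  have key : ∀ x ∈ wordFiltration (n + 1),
      ∃ z ∈ Submodule.span ℂ (normalMonomial '' {a | expWt a = n}),
        x - z ∈ wordFiltration n ⊔ Q ∧
        (weightedLine v (abel4 x)).coeff n = (weightedLine v (abel4 z)).coeff n := by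
    intro x hx
    induction hx using Submodule.span_induction with
    | mem x hx =>
      obtain ⟨l, hl, rfl⟩ := hx
      rcases (Nat.lt_succ_iff.1 hl).lt_or_eq with h | h
      · refine ⟨0, zero_mem _, ?_, ?_⟩
        · rw [sub_zero]
          exact Submodule.mem_sup_left (word_mem h)
        · have : ∀ l : List (Fin 4), weightedLine v (abel4 (l.map (ι ℂ)).prod) =
              C (l.map v).prod * X ^ (l.map wt).sum := by
            intro l
            induction l with
            | nil => simp
            | cons k l ih =>
              simp only [List.map_cons, List.prod_cons, List.sum_cons, map_mul, ih]
              simp only [abel4, weightedLine, lift_ι_apply, MvPolynomial.aeval_X]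
              ring
          rw [this, coeff_C_mul_X_pow, if_neg h.ne']
          simp
      · refine ⟨_, Submodule.subset_span ⟨_, (expWt_count l).trans h, rfl⟩,
          h ▸ hQ.word_sub_normalMonomial l, ?_⟩
        rw [← prod_sortedWord]
        congr 2
        simp only [map_list_prod, List.map_map]
        exact ((perm_sortedWord l).map _).prod_eq
    | zero => exact ⟨0, zero_mem _, by simp, rfl⟩
    | add x y _ _ hx hy =>
      obtain ⟨z, hz, hxz, h⟩ := hx
      obtain ⟨z', hz', hxz', h'⟩ := hy
      refine ⟨z + z', add_mem hz hz', ?_, by simp [h, h']⟩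
      rw [add_sub_add_comm]
      exact add_mem hxz hxz'
    | smul c x _ hx =>
      obtain ⟨z, hz, hxz, h⟩ := hx
      refine ⟨c • z, Submodule.smul_mem _ _ hz, ?_, by simp [h]⟩
      rw [← smul_sub]
      exact Submodule.smul_mem _ _ hxz
  obtain ⟨z, hz, hxz, h⟩ := key x hx
  have hz' : z ∈ normalSpan n ⊔ Q := by
    have := sup_le (hQ.wordFiltration_le n) le_sup_right hxz
    simpa using sub_mem (Submodule.mem_sup_right hxQ) this
  obtain ⟨y, hy, q, hq, rfl⟩ := Submodule.mem_sup.1 hz'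
  have hq' : Q.mkQ q = 0 := by simpa using hq
  have hdis := hli.disjoint_span_image (s := {a | expWt a = n}) (t := {a | expWt a < n})
    (Set.disjoint_left.2 fun a h₁ h₂ => by
      simp only [Set.mem_ofPred_eq] at h₁ h₂
      omega)
  have h₁ := Submodule.mem_map_of_mem (f := Q.mkQ) hz
  rw [Submodule.map_span, ← Set.image_comp] at h₁
  have h₂ := Submodule.mem_map_of_mem (f := Q.mkQ) hy
  have hset : {m | ∃ a, expWt a < n ∧ m = normalMonomial a} =
      normalMonomial '' {a | expWt a < n} := by
    ext m
    simp [eq_comm]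
  rw [normalSpan, hset, Submodule.map_span, ← Set.image_comp] at h₂
  rw [map_add, hq', add_zero] at h₁
  have h₀ : y ∈ Q := by
    simpa using Submodule.disjoint_def.1 hdis _ h₁ h₂
  have hmem : y + q ∈ normalSpan (n + 1) :=
    Submodule.span_mono (by rintro _ ⟨a, ha, rfl⟩; exact ⟨a, ha.trans_lt n.lt_succ_self, rfl⟩) hz
  rw [h, normalSpan_inter_eq_zero hli hmem (add_mem h₀ hq)]
  simp

end Symbol

section Derivation

/-- The value `𝒟(u₃)`. -/
noncomputable def novikovRHS (α₄ α₆ : ℂ) : Free4 :=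
  5 * (g 2 * g 0 + g 0 * g 2) + 5 * (g 1) ^ 2 - 10 * (g 0) ^ 3 - (16 * α₄) • g 0 +
    algebraMap ℂ Free4 (32 * α₆)

/-- The derivation of the free algebra defined by the `N = 2` Novikov equation. -/
structure IsNovikovDerivation (α₄ α₆ : ℂ) (𝒟 : Free4 →ₗ[ℂ] Free4) : Prop where
  leibniz : ∀ x y, 𝒟 (x * y) = 𝒟 x * y + x * 𝒟 y
  map_g0 : 𝒟 (g 0) = g 1
  map_g1 : 𝒟 (g 1) = g 2
  map_g2 : 𝒟 (g 2) = g 3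
  map_g3 : 𝒟 (g 3) = novikovRHS α₄ α₆

/-- The linearisation of `novikovRHS`, in the directions `x₀, x₁, x₂` of `u₀, u₁, u₂`. -/
noncomputable def linearRHS (α₄ : ℂ) (x₀ x₁ x₂ : Free4) : Free4 :=
  5 * (x₂ * g 0 + g 2 * x₀ + x₀ * g 2 + g 0 * x₂) + 5 * (x₁ * g 1 + g 1 * x₁) -
    10 * (x₀ * g 0 ^ 2 + g 0 * x₀ * g 0 + g 0 ^ 2 * x₀) - (16 * α₄) • x₀

lemma comm_novikovRHS (α₄ α₆ : ℂ) (v : Free4) :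
    v * novikovRHS α₄ α₆ - novikovRHS α₄ α₆ * v =
      linearRHS α₄ (v * g 0 - g 0 * v) (v * g 1 - g 1 * v) (v * g 2 - g 2 * v) := by
  have h : v * algebraMap ℂ Free4 (32 * α₆) = algebraMap ℂ Free4 (32 * α₆) * v :=
    (Algebra.commutes _ _).symm
  rw [novikovRHS, linearRHS, mul_add, add_mul, h]
  simp only [mul_sub, sub_mul, mul_smul_comm, smul_mul_assoc, smul_sub]
  noncomm_ring

lemma linearRHS_sub (α₄ : ℂ) (x₀ x₁ x₂ y₀ y₁ y₂ : Free4) :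
    linearRHS α₄ (x₀ - y₀) (x₁ - y₁) (x₂ - y₂) =
      linearRHS α₄ x₀ x₁ x₂ - linearRHS α₄ y₀ y₁ y₂ := by
  simp only [linearRHS, smul_sub]
  noncomm_ring

lemma linearRHS_mem {Q : Submodule ℂ Free4} (hl : ∀ a x : Free4, x ∈ Q → a * x ∈ Q)
    (hr : ∀ x a : Free4, x ∈ Q → x * a ∈ Q) (α₄ : ℂ) {x₀ x₁ x₂ : Free4}
    (h₀ : x₀ ∈ Q) (h₁ : x₁ ∈ Q) (h₂ : x₂ ∈ Q) : linearRHS α₄ x₀ x₁ x₂ ∈ Q := by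
  refine sub_mem (sub_mem (add_mem (hl _ _ (add_mem (add_mem (add_mem ?_ ?_) ?_) ?_))
    (hl _ _ (add_mem ?_ ?_))) (hl _ _ (add_mem (add_mem ?_ ?_) ?_))) (Q.smul_mem _ h₀)
  · exact hr _ _ h₂
  · exact hl _ _ h₀
  · exact hr _ _ h₀
  · exact hl _ _ h₂
  · exact hr _ _ h₁
  · exact hl _ _ h₁
  · exact hr _ _ h₀
  · exact hr _ _ (hl _ _ h₀)
  · exact hl _ _ h₀

lemma natCast_mem (m : ℕ) {n : ℕ} (h : 0 < n) : (m : Free4) ∈ wordFiltration n := by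
  simpa using algebraMap_mem (m : ℂ) h

lemma ofNat_mul_mem (m : ℕ) [m.AtLeastTwo] {n : ℕ} {x : Free4} (h : x ∈ wordFiltration n) :
    (OfNat.ofNat m : Free4) * x ∈ wordFiltration n :=
  mul_mem_wordFiltration (m := 1) (by omega) (natCast_mem m one_pos) h

lemma linearRHS_mem_wordFiltration (α₄ : ℂ) {n : ℕ} {x₀ x₁ x₂ : Free4}
    (h₀ : x₀ ∈ wordFiltration n) (h₁ : x₁ ∈ wordFiltration (n + 1))
    (h₂ : x₂ ∈ wordFiltration (n + 2)) : linearRHS α₄ x₀ x₁ x₂ ∈ wordFiltration (n + 4) := by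
  have g0 : g 0 ∈ wordFiltration 3 := g_mem 0 (by simp)
  have g1 : g 1 ∈ wordFiltration 4 := g_mem 1 (by simp)
  have g2 : g 2 ∈ wordFiltration 5 := g_mem 2 (by simp)
  have g00 : g 0 ^ 2 ∈ wordFiltration 5 := by
    rw [pow_two]
    exact mul_mem_wordFiltration (by omega) g0 g0
  refine sub_mem (sub_mem (add_mem (ofNat_mul_mem 5 (add_mem (add_mem (add_mem ?_ ?_) ?_) ?_))
    (ofNat_mul_mem 5 (add_mem ?_ ?_))) (ofNat_mul_mem 10 (add_mem (add_mem ?_ ?_) ?_)))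
    (Submodule.smul_mem _ _ (wordFiltration_mono (by omega) h₀))
  · exact mul_mem_wordFiltration (by omega) h₂ g0
  · exact mul_mem_wordFiltration (by omega) g2 h₀
  · exact mul_mem_wordFiltration (by omega) h₀ g2
  · exact mul_mem_wordFiltration (by omega) g0 h₂
  · exact mul_mem_wordFiltration (by omega) h₁ g1
  · exact mul_mem_wordFiltration (by omega) g1 h₁
  · exact mul_mem_wordFiltration (by omega) h₀ g00
  · exact mul_mem_wordFiltration (k := n + 4) (m := n + 2) (by omega)
      (mul_mem_wordFiltration (by omega) g0 h₀) g0
  · exact mul_mem_wordFiltration (by omega) g00 h₀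

variable {α₄ α₆ : ℂ} {𝒟 : Free4 →ₗ[ℂ] Free4}

lemma IsNovikovDerivation.map_one (h𝒟 : IsNovikovDerivation α₄ α₆ 𝒟) : 𝒟 1 = 0 := by
  simpa using h𝒟.leibniz 1 1

lemma IsNovikovDerivation.map_algebraMap (h𝒟 : IsNovikovDerivation α₄ α₆ 𝒟) (c : ℂ) :
    𝒟 (algebraMap ℂ Free4 c) = 0 := by
  rw [Algebra.algebraMap_eq_smul_one, map_smul, h𝒟.map_one, smul_zero]

lemma novikovRHS_mem (α₄ α₆ : ℂ) : novikovRHS α₄ α₆ ∈ wordFiltration 7 := by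
  have g0 : g 0 ∈ wordFiltration 3 := g_mem 0 (by simp)
  have g1 : g 1 ∈ wordFiltration 4 := g_mem 1 (by simp)
  have g2 : g 2 ∈ wordFiltration 5 := g_mem 2 (by simp)
  refine add_mem (sub_mem (sub_mem (add_mem (ofNat_mul_mem 5 (add_mem ?_ ?_))
    (ofNat_mul_mem 5 ?_)) (ofNat_mul_mem 10 ?_))
    (Submodule.smul_mem _ _ (wordFiltration_mono (by omega) g0))) (algebraMap_mem _ (by omega))
  · exact mul_mem_wordFiltration (by omega) g2 g0
  · exact mul_mem_wordFiltration (by omega) g0 g2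
  · rw [pow_two]
    exact mul_mem_wordFiltration (by omega) g1 g1
  · rw [pow_three]
    exact mul_mem_wordFiltration (n := 5) (by omega) g0 (mul_mem_wordFiltration (by omega) g0 g0)

lemma IsNovikovDerivation.map_g_mem (h𝒟 : IsNovikovDerivation α₄ α₆ 𝒟) (k : Fin 4) :
    𝒟 (g k) ∈ wordFiltration (wt k + 2) := by
  fin_cases k
  · exact h𝒟.map_g0 ▸ g_mem 1 (by simp [wt])
  · exact h𝒟.map_g1 ▸ g_mem 2 (by simp [wt])
  · exact h𝒟.map_g2 ▸ g_mem 3 (by simp [wt])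
  · exact h𝒟.map_g3 ▸ novikovRHS_mem α₄ α₆

lemma IsNovikovDerivation.map_mem (h𝒟 : IsNovikovDerivation α₄ α₆ 𝒟) {n : ℕ} {x : Free4}
    (hx : x ∈ wordFiltration n) : 𝒟 x ∈ wordFiltration (n + 1) := by
  suffices wordFiltration n ≤ (wordFiltration (n + 1)).comap 𝒟 from this hx
  refine Submodule.span_le.2 ?_
  rintro _ ⟨l, hl, rfl⟩
  suffices 𝒟 (l.map (ι ℂ)).prod ∈ wordFiltration ((l.map wt).sum + 2) from
    wordFiltration_mono (by omega) this
  clear hl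
  induction l with
  | nil => simp [h𝒟.map_one]
  | cons k l ih =>
    simp only [List.map_cons, List.prod_cons, List.sum_cons, h𝒟.leibniz]
    exact add_mem
      (mul_mem_wordFiltration (by omega) (h𝒟.map_g_mem k) (word_mem (Nat.lt_succ_self _)))
      (mul_mem_wordFiltration (m := wt k + 1) (by omega) (g_mem k (by simp [wt])) ih)

/-- The derivation of `ℂ[u₀, u₁, u₂, u₃]` induced by the Novikov derivation. -/
noncomputable def commDerivation (α₄ α₆ : ℂ) :
    Derivation ℂ (MvPolynomial (Fin 4) ℂ) (MvPolynomial (Fin 4) ℂ) :=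
  MvPolynomial.mkDerivation ℂ
    ![MvPolynomial.X 1, MvPolynomial.X 2, MvPolynomial.X 3, abel4 (novikovRHS α₄ α₆)]

lemma IsNovikovDerivation.abel4_map (h𝒟 : IsNovikovDerivation α₄ α₆ 𝒟) (x : Free4) :
    abel4 (𝒟 x) = commDerivation α₄ α₆ (abel4 x) := by
  induction x using FreeAlgebra.induction with
  | grade0 c => simp [h𝒟.map_algebraMap]
  | grade1 k =>
    have : ∀ k, abel4 (g k) = MvPolynomial.X k := fun k => by simp [abel4]
    rw [this, commDerivation, MvPolynomial.mkDerivation_X]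
    fin_cases k
    · exact (congrArg _ h𝒟.map_g0).trans (this 1)
    · exact (congrArg _ h𝒟.map_g1).trans (this 2)
    · exact (congrArg _ h𝒟.map_g2).trans (this 3)
    · exact congrArg _ h𝒟.map_g3
  | mul a b ha hb =>
    rw [h𝒟.leibniz, map_add, map_mul, map_mul, map_mul, ha, hb, Derivation.leibniz]
    simp only [smul_eq_mul]
    ring
  | add a b ha hb => simp only [map_add, ha, hb]

/-- The obstruction to `𝒟`-invariance, for given values `p` of `[u₀, u₁]` and `q` of
`[u₁, u₂]`. -/
noncomputable def obstruction (α₄ : ℂ) (𝒟 : Free4 →ₗ[ℂ] Free4) (p q : Free4) : Free4 :=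
  𝒟 (𝒟 (𝒟 q) - linearRHS α₄ (-p) 0 q) - linearRHS α₄ (-𝒟 p) (-q) 0

lemma IsNovikovDerivation.map_comm₀₁ (h𝒟 : IsNovikovDerivation α₄ α₆ 𝒟) :
    𝒟 (g 0 * g 1 - g 1 * g 0) = g 0 * g 2 - g 2 * g 0 := by
  rw [map_sub, h𝒟.leibniz, h𝒟.leibniz, h𝒟.map_g0, h𝒟.map_g1]
  abel

lemma IsNovikovDerivation.map_comm₀₂ (h𝒟 : IsNovikovDerivation α₄ α₆ 𝒟) :
    𝒟 (g 0 * g 2 - g 2 * g 0) = (g 1 * g 2 - g 2 * g 1) + (g 0 * g 3 - g 3 * g 0) := by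
  rw [map_sub, h𝒟.leibniz, h𝒟.leibniz, h𝒟.map_g0, h𝒟.map_g2]
  abel

lemma IsNovikovDerivation.map_comm₀₃ (h𝒟 : IsNovikovDerivation α₄ α₆ 𝒟) :
    𝒟 (g 0 * g 3 - g 3 * g 0) = (g 1 * g 3 - g 3 * g 1) +
      linearRHS α₄ 0 (g 0 * g 1 - g 1 * g 0) (g 0 * g 2 - g 2 * g 0) := by
  have := comm_novikovRHS α₄ α₆ (g 0)
  rw [sub_self] at this
  rw [map_sub, h𝒟.leibniz, h𝒟.leibniz, h𝒟.map_g0, h𝒟.map_g3, ← this]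
  abel

lemma IsNovikovDerivation.map_comm₁₂ (h𝒟 : IsNovikovDerivation α₄ α₆ 𝒟) :
    𝒟 (g 1 * g 2 - g 2 * g 1) = g 1 * g 3 - g 3 * g 1 := by
  rw [map_sub, h𝒟.leibniz, h𝒟.leibniz, h𝒟.map_g1, h𝒟.map_g2]
  abel

lemma IsNovikovDerivation.map_comm₁₃ (h𝒟 : IsNovikovDerivation α₄ α₆ 𝒟) :
    𝒟 (g 1 * g 3 - g 3 * g 1) = (g 2 * g 3 - g 3 * g 2) +
      linearRHS α₄ (-(g 0 * g 1 - g 1 * g 0)) 0 (g 1 * g 2 - g 2 * g 1) := by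
  have := comm_novikovRHS α₄ α₆ (g 1)
  rw [sub_self] at this
  rw [map_sub, h𝒟.leibniz, h𝒟.leibniz, h𝒟.map_g1, h𝒟.map_g3, neg_sub, ← this]
  abel

lemma IsNovikovDerivation.map_comm₂₃ (h𝒟 : IsNovikovDerivation α₄ α₆ 𝒟) :
    𝒟 (g 2 * g 3 - g 3 * g 2) =
      linearRHS α₄ (-(g 0 * g 2 - g 2 * g 0)) (-(g 1 * g 2 - g 2 * g 1)) 0 := by
  have := comm_novikovRHS α₄ α₆ (g 2)
  rw [sub_self] at this
  rw [map_sub, h𝒟.leibniz, h𝒟.leibniz, h𝒟.map_g2, h𝒟.map_g3, neg_sub, neg_sub, ← this]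
  abel

lemma IsNovikovDerivation.obstruction_comm (h𝒟 : IsNovikovDerivation α₄ α₆ 𝒟) :
    obstruction α₄ 𝒟 (g 0 * g 1 - g 1 * g 0) (g 1 * g 2 - g 2 * g 1) = 0 := by
  rw [obstruction, h𝒟.map_comm₁₂, h𝒟.map_comm₁₃, add_sub_cancel_right, h𝒟.map_comm₂₃,
    h𝒟.map_comm₀₁, sub_self]

lemma IsNovikovDerivation.obstruction_mem (h𝒟 : IsNovikovDerivation α₄ α₆ 𝒟)
    {Q : Submodule ℂ Free4} (hl : ∀ a x : Free4, x ∈ Q → a * x ∈ Q)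
    (hr : ∀ x a : Free4, x ∈ Q → x * a ∈ Q) (hD : ∀ x ∈ Q, 𝒟 x ∈ Q) {p q : Free4}
    (hp : g 0 * g 1 - g 1 * g 0 - p ∈ Q) (hq : g 1 * g 2 - g 2 * g 1 - q ∈ Q) :
    obstruction α₄ 𝒟 p q ∈ Q := by
  have h := h𝒟.obstruction_comm
  have h1 : obstruction α₄ 𝒟 (g 0 * g 1 - g 1 * g 0 - p) (g 1 * g 2 - g 2 * g 1 - q) =
      obstruction α₄ 𝒟 (g 0 * g 1 - g 1 * g 0) (g 1 * g 2 - g 2 * g 1) -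
        obstruction α₄ 𝒟 p q := by
    have e (a b : Free4) : -(a - b) = -a - -b := by abel
    have z : (0 : Free4) = 0 - 0 := by simp
    simp only [obstruction]
    rw [e, map_sub 𝒟 _ p, e (𝒟 _), e (_ - _) q]
    nth_rw 1 [z]
    rw [linearRHS_sub]
    nth_rw 3 [z]
    rw [linearRHS_sub]
    simp only [map_sub]
    abel
  rw [h, zero_sub] at h1
  rw [← neg_mem_iff, ← h1]
  exact sub_mem (hD _ (sub_mem (hD _ (hD _ hq))
    (linearRHS_mem hl hr α₄ (neg_mem hp) (zero_mem Q) hq)))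
    (linearRHS_mem hl hr α₄ (neg_mem (hD _ hp)) (neg_mem hq) (zero_mem Q))

lemma IsNovikovDerivation.obstruction_mem_wordFiltration (h𝒟 : IsNovikovDerivation α₄ α₆ 𝒟)
    {n : ℕ} {p q : Free4} (hp : p ∈ wordFiltration n) (hq : q ∈ wordFiltration (n + 2)) :
    obstruction α₄ 𝒟 p q ∈ wordFiltration (n + 5) :=
  sub_mem (h𝒟.map_mem (sub_mem (h𝒟.map_mem (h𝒟.map_mem hq))
      (linearRHS_mem_wordFiltration α₄ (neg_mem hp) (zero_mem _) hq)))
    (linearRHS_mem_wordFiltration α₄ (neg_mem (h𝒟.map_mem hp)) (neg_mem hq) (zero_mem _))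

end Derivation

section Classification

lemma obstruction_identity {R : Type*} [CommRing R] [Algebra ℂ R] (δ : Derivation ℂ R R)
    {x₀ x₁ x₂ x₃ A B a₀ a₂ a₃ a₄ b₄ c p q : R} (h₀ : δ x₀ = x₁) (h₁ : δ x₁ = x₂) (h₂ : δ x₂ = x₃)
    (h₃ : δ x₃ = 10 * x₀ * x₂ + 5 * x₁ ^ 2 - 10 * x₀ ^ 3 - 16 * A * x₀ + 32 * B)
    (hA : δ A = 0) (hB : δ B = 0) (ha₀ : δ a₀ = 0) (ha₂ : δ a₂ = 0) (ha₃ : δ a₃ = 0)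
    (ha₄ : δ a₄ = 0) (hb₄ : δ b₄ = 0) (hc : δ c = 0)
    (hp : p = a₀ + a₂ * x₀ + a₃ * x₁ + a₄ * x₂ + b₄ * x₀ ^ 2)
    (hq : 2 * q = δ (δ p) - 10 * p * x₀ + c) :
    2 * (δ (δ (δ q) - (10 * (q * x₀ - p * x₂) + 30 * x₀ ^ 2 * p + 16 * A * p)) -
      (- 10 * δ p * x₂ - 10 * q * x₁ + 30 * x₀ ^ 2 * δ p + 16 * A * δ p)) =
    ((200 * a₄ - 220 * b₄) * x₀ ^ 3 * x₁ - (150 * a₄ + 10 * b₄) * x₀ ^ 2 * x₃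
      - (300 * a₄ + 20 * b₄) * x₀ * x₁ * x₂ - (10 * a₄ + 10 * b₄) * x₁ ^ 3
      + (90 * a₄ + 20 * b₄) * x₂ * x₃)
    + a₃ * (100 * x₀ ^ 4 - 150 * x₀ ^ 2 * x₂ - 130 * x₀ * x₁ ^ 2 + 10 * x₁ * x₃ + 30 * x₂ ^ 2)
    - 70 * a₂ * x₀ ^ 2 * x₁
    + ((10 * a₀ - 80 * A * a₄) * x₃ - (20 * a₀ + 320 * A * b₄) * x₀ * x₁)
    + A * a₃ * (160 * x₀ ^ 2 - 80 * x₂)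
    + (320 * B * (a₄ + b₄) - 80 * A * a₂) * x₁
    - 320 * B * a₃ * x₀ := by
  have hn (m : ℕ) [m.AtLeastTwo] : δ (OfNat.ofNat m) = 0 := δ.map_natCast m
  have e₁ : δ p = 2 * b₄ * x₀ * x₁ + a₂ * x₁ + a₃ * x₂ + a₄ * x₃ := by
    rw [hp]
    simp only [map_add, Derivation.leibniz, Derivation.leibniz_pow, smul_eq_mul, nsmul_eq_mul,
      ha₀, ha₂, ha₃, ha₄, hb₄, h₀, h₁, h₂]
    ring
  have hD : 2 * (δ (δ (δ q) - (10 * (q * x₀ - p * x₂) + 30 * x₀ ^ 2 * p + 16 * A * p)) -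
      (- 10 * δ p * x₂ - 10 * q * x₁ + 30 * x₀ ^ 2 * δ p + 16 * A * δ p)) =
      δ (δ (δ (2 * q)) - (10 * (2 * q) * x₀ - 20 * p * x₂ + 60 * x₀ ^ 2 * p + 32 * A * p)) +
      20 * δ p * x₂ + 10 * (2 * q) * x₁ - 60 * x₀ ^ 2 * δ p - 32 * A * δ p := by
    simp only [map_add, map_sub, Derivation.leibniz, Derivation.leibniz_pow, smul_eq_mul,
      nsmul_eq_mul, hn, mul_zero, add_zero]
    ring
  rw [hD, hq, e₁, hp]
  simp only [map_add, map_sub, Derivation.leibniz, Derivation.leibniz_pow, smul_eq_mul,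
    nsmul_eq_mul, hn, hA, hB, ha₀, ha₂, ha₃, ha₄, hb₄, hc, h₀, h₁, h₂, h₃, mul_zero, zero_add,
    add_zero, Nat.cast_ofNat, Nat.add_one_sub_one, pow_one]
  ring

lemma normalSpan_seven_eq {x : Free4} (hx : x ∈ normalSpan 7) :
    ∃ a₀ a₁ a₂ b₀ b₁ c₀ c₁ d e k : ℂ,
      x = a₀ • g 1 ^ 2 + a₁ • (g 2 * g 0) + a₂ • g 0 ^ 3 + b₀ • g 3 + b₁ • (g 1 * g 0) +
        c₀ • g 2 + c₁ • g 0 ^ 2 + d • g 1 + e • g 0 + k • (1 : Free4) := by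
  have h : x ∈ Submodule.span ℂ ({g 1 ^ 2, g 2 * g 0, g 0 ^ 3, g 3, g 1 * g 0, g 2, g 0 ^ 2, g 1,
      g 0, 1} : Set Free4) := by
    refine Submodule.span_mono ?_ hx
    rintro _ ⟨a, ha, rfl⟩
    simp only [expWt] at ha
    unfold normalMonomial
    have h₃ : a 3 ≤ 1 := by omega
    have h₂ : a 2 ≤ 1 := by omega
    have h₁ : a 1 ≤ 2 := by omega
    have h₀ : a 0 ≤ 3 := by omega
    generalize a 3 = k₃ at *
    generalize a 2 = k₂ at *
    generalize a 1 = k₁ at *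
    generalize a 0 = k₀ at *
    interval_cases k₃ <;> interval_cases k₂ <;> interval_cases k₁ <;> interval_cases k₀ <;>
      first | omega | simp
  simp only [Submodule.mem_span_insert, Submodule.mem_span_singleton] at h
  obtain ⟨a₀, _, ⟨a₁, _, ⟨a₂, _, ⟨b₀, _, ⟨b₁, _, ⟨c₀, _, ⟨c₁, _, ⟨d, _, ⟨e, _, ⟨k, rfl⟩, rfl⟩, rfl⟩,
    rfl⟩, rfl⟩, rfl⟩, rfl⟩, rfl⟩, rfl⟩, rfl⟩ := h
  exact ⟨a₀, a₁, a₂, b₀, b₁, c₀, c₁, d, e, k, by abel⟩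

lemma normalSpan_five_eq {x : Free4} (hx : x ∈ normalSpan 5) :
    ∃ c₀ c₁ d e k : ℂ,
      x = k • (1 : Free4) + e • g 0 + d • g 1 + c₀ • g 2 + c₁ • g 0 ^ 2 := by
  have h : x ∈ Submodule.span ℂ ({g 2, g 0 ^ 2, g 1, g 0, 1} : Set Free4) := by
    refine Submodule.span_mono ?_ hx
    rintro _ ⟨a, ha, rfl⟩
    simp only [expWt] at ha
    unfold normalMonomial
    have h₃ : a 3 = 0 := by omega
    have h₂ : a 2 ≤ 1 := by omega
    have h₁ : a 1 ≤ 1 := by omega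
    have h₀ : a 0 ≤ 2 := by omega
    rw [h₃]
    generalize a 2 = k₂ at *
    generalize a 1 = k₁ at *
    generalize a 0 = k₀ at *
    interval_cases k₂ <;> interval_cases k₁ <;> interval_cases k₀ <;> first | omega | simp
  simp only [Submodule.mem_span_insert, Submodule.mem_span_singleton] at h
  obtain ⟨c₀, _, ⟨c₁, _, ⟨d, _, ⟨e, _, ⟨k, rfl⟩, rfl⟩, rfl⟩, rfl⟩, rfl⟩ := h
  exact ⟨c₀, c₁, d, e, k, by abel⟩

lemma abel4_g (k : Fin 4) : abel4 (g k) = MvPolynomial.X k := by simp [abel4]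

lemma abel4_novikovRHS (α₄ α₆ : ℂ) : abel4 (novikovRHS α₄ α₆) =
    10 * MvPolynomial.X 0 * MvPolynomial.X 2 + 5 * MvPolynomial.X 1 ^ 2 -
      10 * MvPolynomial.X 0 ^ 3 - 16 * MvPolynomial.C α₄ * MvPolynomial.X 0 +
      32 * MvPolynomial.C α₆ := by
  simp only [novikovRHS, map_add, map_sub, map_mul, map_pow, map_ofNat, map_smul, abel4_g,
    AlgHom.commutes, MvPolynomial.algebraMap_eq, MvPolynomial.smul_eq_C_mul]
  ring

lemma abel4_linearRHS (α₄ : ℂ) (x₀ x₁ x₂ : Free4) : abel4 (linearRHS α₄ x₀ x₁ x₂) =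
    10 * (abel4 x₂ * MvPolynomial.X 0 + abel4 x₀ * MvPolynomial.X 2) +
      10 * abel4 x₁ * MvPolynomial.X 1 - 30 * MvPolynomial.X 0 ^ 2 * abel4 x₀ -
      16 * MvPolynomial.C α₄ * abel4 x₀ := by
  simp only [linearRHS, map_add, map_sub, map_mul, map_pow, map_ofNat, map_smul, abel4_g,
    MvPolynomial.smul_eq_C_mul]
  ring

lemma commDerivation_X₀ (α₄ α₆ : ℂ) :
    commDerivation α₄ α₆ (MvPolynomial.X 0) = MvPolynomial.X 1 := by
  simp [commDerivation, MvPolynomial.mkDerivation_X]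

lemma commDerivation_X₁ (α₄ α₆ : ℂ) :
    commDerivation α₄ α₆ (MvPolynomial.X 1) = MvPolynomial.X 2 := by
  simp [commDerivation, MvPolynomial.mkDerivation_X]

lemma commDerivation_X₂ (α₄ α₆ : ℂ) :
    commDerivation α₄ α₆ (MvPolynomial.X 2) = MvPolynomial.X 3 := by
  simp [commDerivation, MvPolynomial.mkDerivation_X]

lemma commDerivation_X₃ (α₄ α₆ : ℂ) :
    commDerivation α₄ α₆ (MvPolynomial.X 3) =
      10 * MvPolynomial.X 0 * MvPolynomial.X 2 + 5 * MvPolynomial.X 1 ^ 2 -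
      10 * MvPolynomial.X 0 ^ 3 - 16 * MvPolynomial.C α₄ * MvPolynomial.X 0 +
      32 * MvPolynomial.C α₆ := by
  rw [← abel4_novikovRHS]
  simp [commDerivation, MvPolynomial.mkDerivation_X]

variable {α₄ α₆ : ℂ} {𝒟 : Free4 →ₗ[ℂ] Free4} {Q : Submodule ℂ Free4}

lemma g_mul_mem {x : Free4} {n : ℕ} (k : Fin 4) (hx : x ∈ wordFiltration n) :
    g k * x ∈ wordFiltration (n + (k + 2)) :=
  mul_mem_wordFiltration (m := k + 3) (by omega) (g_mem k (by omega)) hx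

lemma firstIntegral_identity {R : Type*} [CommRing R] [Algebra ℂ R] (δ : Derivation ℂ R R)
    {x₀ x₁ x₂ x₃ A B a₀ a₁ a₂ b₀ b₁ c₀ c₁ d e k : R}
    (h₀ : δ x₀ = x₁) (h₁ : δ x₁ = x₂) (h₂ : δ x₂ = x₃)
    (h₃ : δ x₃ = 10 * x₀ * x₂ + 5 * x₁ ^ 2 - 10 * x₀ ^ 3 - 16 * A * x₀ + 32 * B)
    (ha₀ : δ a₀ = 0) (ha₁ : δ a₁ = 0) (ha₂ : δ a₂ = 0) (hb₀ : δ b₀ = 0) (hb₁ : δ b₁ = 0)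
    (hc₀ : δ c₀ = 0) (hc₁ : δ c₁ = 0) (hd : δ d = 0) (he : δ e = 0) (hk : δ k = 0) :
    δ (a₀ * x₁ ^ 2 + a₁ * (x₂ * x₀) + a₂ * x₀ ^ 3 + b₀ * x₃ + b₁ * (x₁ * x₀) + c₀ * x₂ +
      c₁ * x₀ ^ 2 + d * x₁ + e * x₀ + k) =
    (2 * a₀ * x₁ * x₂ + a₁ * (x₁ * x₂ + x₀ * x₃) + 3 * a₂ * x₀ ^ 2 * x₁) +
      (b₀ * (10 * x₀ * x₂ + 5 * x₁ ^ 2 - 10 * x₀ ^ 3) + b₁ * (x₀ * x₂ + x₁ ^ 2)) +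
      (c₀ * x₃ + 2 * c₁ * x₀ * x₁) + d * x₂ + e * x₁ - 16 * A * b₀ * x₀ + 32 * B * b₀ := by
  simp only [map_add, Derivation.leibniz, Derivation.leibniz_pow, smul_eq_mul, nsmul_eq_mul,
    ha₀, ha₁, ha₂, hb₀, hb₁, hc₀, hc₁, hd, he, hk, h₀, h₁, h₂, h₃, mul_zero, add_zero,
    Nat.cast_ofNat, Nat.add_one_sub_one, pow_one]
  ring

/-- First integrals of weight at most `6` are constant. -/
lemma IsNovikovDerivation.eq_const (h𝒟 : IsNovikovDerivation α₄ α₆ 𝒟) (hQ : IsStraightening Q)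
    (hli : LinearIndependent ℂ fun a => Submodule.Quotient.mk (p := Q) (normalMonomial a))
    {x : Free4} (hx : x ∈ normalSpan 7) (hDx : 𝒟 x ∈ Q) :
    ∃ c : ℂ, x = algebraMap ℂ Free4 c := by
  obtain ⟨a₀, a₁, a₂, b₀, b₁, c₀, c₁, d, e, k, hx⟩ := normalSpan_seven_eq hx
  have hline (v : Fin 4 → ℂ) : weightedLine v (abel4 (𝒟 x)) =
      C (2 * a₀ * v 1 * v 2 + a₁ * (v 1 * v 2 + v 0 * v 3) + 3 * a₂ * v 0 ^ 2 * v 1) * X ^ 7 +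
      C (b₀ * (10 * v 0 * v 2 + 5 * v 1 ^ 2 - 10 * v 0 ^ 3) + b₁ * (v 0 * v 2 + v 1 ^ 2)) * X ^ 6 +
      C (c₀ * v 3 + 2 * c₁ * v 0 * v 1) * X ^ 5 +
      C (d * v 2) * X ^ 4 + C (e * v 1) * X ^ 3 + C (- 16 * α₄ * b₀ * v 0) * X ^ 2 +
      C (32 * α₆ * b₀) := by
    have hc := MvPolynomial.derivation_C (commDerivation α₄ α₆)
    have h := firstIntegral_identity (commDerivation α₄ α₆)
      (commDerivation_X₀ α₄ α₆) (commDerivation_X₁ α₄ α₆) (commDerivation_X₂ α₄ α₆)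
      (commDerivation_X₃ α₄ α₆) (hc a₀) (hc a₁) (hc a₂) (hc b₀) (hc b₁) (hc c₀) (hc c₁)
      (hc d) (hc e) (hc k)
    refine (congrArg (weightedLine v) ((h𝒟.abel4_map x).trans ((congrArg _ ?_).trans h))).trans ?_
    · rw [hx]
      simp only [map_add, map_mul, map_pow, map_smul, _root_.map_one, abel4_g,
        MvPolynomial.smul_eq_C_mul, mul_one]
    · simp only [weightedLine, map_add, map_sub, map_mul, map_pow, map_ofNat,
        MvPolynomial.aeval_X, MvPolynomial.aeval_C, wt, Polynomial.algebraMap_eq, map_neg]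
      norm_num
      ring
  have hcoeff (n : ℕ) (h : x ∈ wordFiltration n) (v : Fin 4 → ℂ) :
      (weightedLine v (abel4 (𝒟 x))).coeff n = 0 :=
    hQ.coeff_eq_zero hli (h𝒟.map_mem h) hDx v
  have m₀ : g 0 ∈ wordFiltration 3 := g_mem 0 (by simp)
  have m₁ : g 1 ∈ wordFiltration 4 := g_mem 1 (by simp)
  have m₂ : g 2 ∈ wordFiltration 5 := g_mem 2 (by simp)
  have m₃ : g 3 ∈ wordFiltration 6 := g_mem 3 (by simp)
  have m₀₀ : g 0 ^ 2 ∈ wordFiltration 5 := by simpa [pow_two] using g_mul_mem 0 m₀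
  have m₁₀ : g 1 * g 0 ∈ wordFiltration 6 := by simpa using g_mul_mem 1 m₀
  have one_mem : (1 : Free4) ∈ wordFiltration 1 := by
    simpa using algebraMap_mem 1 one_pos
  have up {m n : ℕ} {y : Free4} (c : ℂ) (hy : y ∈ wordFiltration m) (h : m ≤ n) :
      c • y ∈ wordFiltration n := Submodule.smul_mem _ _ (wordFiltration_mono h hy)
  have h₇ := hcoeff 7 (normalSpan_le_wordFiltration 7 ‹_›)
  simp only [hline, coeff_add, coeff_C_mul_X_pow, coeff_C] at h₇
  norm_num at h₇
  have ha₂ : a₂ = 0 := by simpa using h₇ ![1, 1, 0, 0]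
  have ha₁ : a₁ = 0 := by simpa using h₇ ![1, 0, 0, 1]
  have ha₀ : a₀ = 0 := by simpa [ha₁] using h₇ ![0, 1, 1, 0]
  subst ha₀ ha₁ ha₂
  simp only [zero_smul, zero_add] at hx
  have h₆ := hcoeff 6 (by
    rw [hx]
    exact add_mem (add_mem (add_mem (add_mem (add_mem (add_mem (up _ m₃ le_rfl) (up _ m₁₀ le_rfl))
      (up _ m₂ (by omega))) (up _ m₀₀ (by omega))) (up _ m₁ (by omega))) (up _ m₀ (by omega)))
      (up _ one_mem (by omega)))
  simp only [hline, coeff_add, coeff_C_mul_X_pow, coeff_C] at h₆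
  norm_num at h₆
  have hb₀ : b₀ = 0 := by simpa using h₆ ![1, 0, 0, 0]
  have hb₁ : b₁ = 0 := by simpa [hb₀] using h₆ ![0, 1, 0, 0]
  subst hb₀ hb₁
  simp only [zero_smul, zero_add] at hx
  have h₅ := hcoeff 5 (by
    rw [hx]
    exact add_mem (add_mem (add_mem (add_mem (up _ m₂ (by omega)) (up _ m₀₀ (by omega)))
      (up _ m₁ (by omega))) (up _ m₀ (by omega))) (up _ one_mem (by omega)))
  simp only [hline, coeff_add, coeff_C_mul_X_pow, coeff_C] at h₅
  norm_num at h₅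
  have hc₀ : c₀ = 0 := by simpa using h₅ ![0, 0, 0, 1]
  have hc₁ : c₁ = 0 := by simpa using h₅ ![1, 1, 0, 0]
  subst hc₀ hc₁
  simp only [zero_smul, zero_add] at hx
  have h₄ := hcoeff 4 (by
    rw [hx]
    exact add_mem (add_mem (up _ m₁ (by omega)) (up _ m₀ (by omega))) (up _ one_mem (by omega)))
  simp only [hline, coeff_add, coeff_C_mul_X_pow, coeff_C] at h₄
  norm_num at h₄
  have hd : d = 0 := by simpa using h₄ ![0, 0, 1, 0]
  subst hd
  simp only [zero_smul, zero_add] at hx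
  have h₃ := hcoeff 3 (by
    rw [hx]
    exact add_mem (up _ m₀ (by omega)) (up _ one_mem (by omega)))
  simp only [hline, coeff_add, coeff_C_mul_X_pow, coeff_C] at h₃
  norm_num at h₃
  have he : e = 0 := by simpa using h₃ ![0, 1, 0, 0]
  subst he
  exact ⟨k, by rw [hx, Algebra.algebraMap_eq_smul_one, zero_smul, zero_add]⟩

/-- If the obstruction vanishes in a PBW quotient, then `[u₀, u₁] = 0` there. -/
lemma IsNovikovDerivation.eq_zero_of_obstruction (h𝒟 : IsNovikovDerivation α₄ α₆ 𝒟)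
    (hQ : IsStraightening Q)
    (hli : LinearIndependent ℂ fun a => Submodule.Quotient.mk (p := Q) (normalMonomial a))
    {p q : Free4} {c : ℂ} (hp : p ∈ normalSpan 5)
    (hq : q = (2⁻¹ : ℂ) • (𝒟 (𝒟 p) - 5 * (p * g 0 + g 0 * p) + algebraMap ℂ Free4 c))
    (hE : obstruction α₄ 𝒟 p q ∈ Q) : p = 0 := by
  obtain ⟨a₄, b₄, a₃, a₂, a₀, hp⟩ := normalSpan_five_eq hp
  have hline (v : Fin 4 → ℂ) : weightedLine v (2 * abel4 (obstruction α₄ 𝒟 p q)) =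
      C ((200 * a₄ - 220 * b₄) * v 0 ^ 3 * v 1 - (150 * a₄ + 10 * b₄) * v 0 ^ 2 * v 3
        - (300 * a₄ + 20 * b₄) * v 0 * v 1 * v 2 - (10 * a₄ + 10 * b₄) * v 1 ^ 3
        + (90 * a₄ + 20 * b₄) * v 2 * v 3) * X ^ 9 +
      C (a₃ * (100 * v 0 ^ 4 - 150 * v 0 ^ 2 * v 2 - 130 * v 0 * v 1 ^ 2 + 10 * v 1 * v 3
        + 30 * v 2 ^ 2)) * X ^ 8 + C (- 70 * a₂ * v 0 ^ 2 * v 1) * X ^ 7 +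
      C ((10 * a₀ - 80 * α₄ * a₄) * v 3 - (20 * a₀ + 320 * α₄ * b₄) * v 0 * v 1) * X ^ 5 +
      C (α₄ * a₃ * (160 * v 0 ^ 2 - 80 * v 2)) * X ^ 4 +
      C ((320 * α₆ * (a₄ + b₄) - 80 * α₄ * a₂) * v 1) * X ^ 3 +
      C (- 320 * α₆ * a₃ * v 0) * X ^ 2 := by
    have hpq := obstruction_identity (commDerivation α₄ α₆) (p := abel4 p) (q := abel4 q)
      (A := MvPolynomial.C α₄) (B := MvPolynomial.C α₆) (a₀ := MvPolynomial.C a₀)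
      (a₂ := MvPolynomial.C a₂) (a₃ := MvPolynomial.C a₃) (a₄ := MvPolynomial.C a₄)
      (b₄ := MvPolynomial.C b₄) (c := MvPolynomial.C c)
      (commDerivation_X₀ α₄ α₆) (commDerivation_X₁ α₄ α₆) (commDerivation_X₂ α₄ α₆)
      (commDerivation_X₃ α₄ α₆)
      (MvPolynomial.derivation_C _ _) (MvPolynomial.derivation_C _ _)
      (MvPolynomial.derivation_C _ _) (MvPolynomial.derivation_C _ _)
      (MvPolynomial.derivation_C _ _) (MvPolynomial.derivation_C _ _)
      (MvPolynomial.derivation_C _ _) (MvPolynomial.derivation_C _ _)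
      (by
        rw [hp]
        simp [abel4_g, MvPolynomial.smul_eq_C_mul])
      (by
        have h2 : (2 : MvPolynomial (Fin 4) ℂ) = MvPolynomial.C 2 := rfl
        rw [hq, map_smul, MvPolynomial.smul_eq_C_mul, ← mul_assoc, h2, ← map_mul,
          mul_inv_cancel₀ two_ne_zero, MvPolynomial.C_1, one_mul]
        simp only [map_add, map_sub, map_mul, map_ofNat, abel4_g, h𝒟.abel4_map,
          AlgHom.commutes, MvPolynomial.algebraMap_eq]
        ring)
    refine (congrArg (weightedLine v) (Eq.trans ?_ hpq)).trans ?_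
    · rw [obstruction, map_sub, h𝒟.abel4_map, map_sub, h𝒟.abel4_map, h𝒟.abel4_map,
        abel4_linearRHS, abel4_linearRHS, map_neg, map_neg, map_neg, map_zero, h𝒟.abel4_map]
      ring_nf
    · simp only [weightedLine, map_add, map_sub, map_mul, map_pow, map_ofNat,
        MvPolynomial.aeval_X, MvPolynomial.aeval_C, wt, Polynomial.algebraMap_eq, map_neg]
      norm_num
      ring
  have hqn (n : ℕ) (h : p ∈ wordFiltration (n + 1)) : q ∈ wordFiltration (n + 3) := by
    rw [hq]
    have g0 : g 0 ∈ wordFiltration 3 := g_mem 0 (by simp)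
    refine Submodule.smul_mem _ _ (add_mem (sub_mem (h𝒟.map_mem (h𝒟.map_mem h))
      (ofNat_mul_mem 5 (add_mem ?_ ?_))) (algebraMap_mem _ (by omega)))
    · exact mul_mem_wordFiltration (by omega) h g0
    · exact mul_mem_wordFiltration (by omega) g0 h
  have hcoeff (n : ℕ) (h : p ∈ wordFiltration (n + 1)) (v : Fin 4 → ℂ) :
      (weightedLine v (2 * abel4 (obstruction α₄ 𝒟 p q))).coeff (n + 5) = 0 := by
    have := hQ.coeff_eq_zero hli (n := n + 5)
      (h𝒟.obstruction_mem_wordFiltration h (hqn n h)) hE v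
    rw [map_mul, map_ofNat, coeff_ofNat_mul, this, mul_zero]
  have m₀ : g 0 ∈ wordFiltration 3 := g_mem 0 (by simp)
  have m₁ : g 1 ∈ wordFiltration 4 := g_mem 1 (by simp)
  have one_mem : (1 : Free4) ∈ wordFiltration 1 := by
    simpa using algebraMap_mem 1 one_pos
  have up {m n : ℕ} {y : Free4} (c : ℂ) (hy : y ∈ wordFiltration m) (h : m ≤ n) :
      c • y ∈ wordFiltration n := Submodule.smul_mem _ _ (wordFiltration_mono h hy)
  have h₄ := hcoeff 4 (normalSpan_le_wordFiltration 5 ‹_›)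
  simp only [hline, coeff_add, coeff_C_mul_X_pow] at h₄
  norm_num at h₄
  have e₁ := h₄ ![1, 1, 0, 0]
  have e₂ := h₄ ![0, 1, 0, 0]
  simp at e₁ e₂
  have ha₄ : a₄ = 0 := by linear_combination (1 / 420) * e₁ - (230 / 4200) * e₂
  have hb₄ : b₄ = 0 := by linear_combination - ha₄ - (1 / 10) * e₂
  subst ha₄ hb₄
  simp only [zero_smul, add_zero] at hp
  have h₃ := hcoeff 3 (by
    rw [hp]
    exact add_mem (add_mem (up _ one_mem (by omega)) (up _ m₀ (by omega))) (up _ m₁ (by omega)))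
  simp only [hline, coeff_add, coeff_C_mul_X_pow] at h₃
  norm_num at h₃
  have ha₃ : a₃ = 0 := by simpa using h₃ ![0, 0, 1, 0]
  subst ha₃
  simp only [zero_smul, add_zero] at hp
  have h₂ := hcoeff 2 (by
    rw [hp]
    exact add_mem (up _ one_mem (by omega)) (up _ m₀ (by omega)))
  simp only [hline, coeff_add, coeff_C_mul_X_pow] at h₂
  norm_num at h₂
  have ha₂ : a₂ = 0 := by simpa using h₂ ![1, 1, 0, 0]
  subst ha₂
  simp only [zero_smul, add_zero] at hp
  have h₀ := hcoeff 0 (by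
    rw [hp]
    exact up _ one_mem (by omega))
  simp only [hline, coeff_add, coeff_C_mul_X_pow] at h₀
  norm_num at h₀
  have ha₀ : a₀ = 0 := by simpa using h₀ ![0, 0, 0, 1]
  rw [hp, ha₀, zero_smul]

end Classification

section Representation

open MvPolynomial in
/-- The operators representing the generators on `ℂ[x₀, x₁, x₂, x₃]`. -/
noncomputable def operator (c : ℂ) : Fin 4 → Module.End ℂ (MvPolynomial (Fin 4) ℂ) :=
  let mulX (k : Fin 4) : Module.End ℂ (MvPolynomial (Fin 4) ℂ) := LinearMap.mulLeft ℂ (X k)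
  let d (k : Fin 4) : Module.End ℂ (MvPolynomial (Fin 4) ℂ) := (pderiv k : Derivation ℂ _ _)
  ![mulX 0 + c • d 3, mulX 1 - c • d 2,
    mulX 2 + (10 * c) • (mulX 0 * d 3) + (5 * c ^ 2) • (d 3 * d 3), mulX 3]

open MvPolynomial in
lemma operator_zero (c : ℂ) (f : MvPolynomial (Fin 4) ℂ) :
    operator c 0 f = X 0 * f + c • pderiv 3 f := rfl

open MvPolynomial in
lemma operator_one (c : ℂ) (f : MvPolynomial (Fin 4) ℂ) :
    operator c 1 f = X 1 * f - c • pderiv 2 f := rfl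

open MvPolynomial in
lemma operator_two (c : ℂ) (f : MvPolynomial (Fin 4) ℂ) :
    operator c 2 f = X 2 * f + (10 * c) • (X 0 * pderiv 3 f) +
      (5 * c ^ 2) • pderiv 3 (pderiv 3 f) := rfl

open MvPolynomial in
lemma operator_three (c : ℂ) (f : MvPolynomial (Fin 4) ℂ) :
    operator c 3 f = X 3 * f := rfl

lemma pderiv_pderiv_comm (f : MvPolynomial (Fin 4) ℂ) :
    MvPolynomial.pderiv 2 (MvPolynomial.pderiv 3 f) =
      MvPolynomial.pderiv 3 (MvPolynomial.pderiv 2 f) := by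
  have h : ⁅MvPolynomial.pderiv (R := ℂ) (2 : Fin 4), MvPolynomial.pderiv (R := ℂ) (3 : Fin 4)⁆ =
      0 := by
    refine MvPolynomial.derivation_ext fun k => ?_
    rw [Derivation.commutator_apply]
    simp [MvPolynomial.pderiv_X, Pi.single_apply, apply_ite]
  have := congrArg (fun D => D f) h
  rwa [Derivation.commutator_apply, Derivation.zero_apply, sub_eq_zero] at this

/-- The values of the commutators `[u_i, u_j]`, `i < j`, in the quantised algebra. -/
noncomputable def commValue (c : ℂ) : Fin 4 → Fin 4 → Free4 :=
  ![![0, 0, 0, algebraMap ℂ Free4 c], ![0, 0, -algebraMap ℂ Free4 c, 0],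
    ![0, 0, 0, (10 * c) • g 0], ![0, 0, 0, 0]]

lemma operator_comm (c : ℂ) {i j : Fin 4} (hij : i < j) :
    operator c i * operator c j - operator c j * operator c i =
      FreeAlgebra.lift ℂ (operator c) (commValue c i j) := by
  have h (k l : Fin 4) (hkl : k ≠ l) : MvPolynomial.pderiv k (MvPolynomial.X l) =
      (0 : MvPolynomial (Fin 4) ℂ) := MvPolynomial.pderiv_X_of_ne hkl.symm
  have h5 : (MvPolynomial.C 5 : MvPolynomial (Fin 4) ℂ) = 5 := rfl
  have h10 : (MvPolynomial.C 10 : MvPolynomial (Fin 4) ℂ) = 10 := rfl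
  refine LinearMap.ext fun f => ?_
  fin_cases i <;> fin_cases j <;> first | exact absurd hij (by decide) | skip
  all_goals
    simp [commValue, operator_zero, operator_one, operator_two, operator_three, pderiv_pderiv_comm,
      MvPolynomial.smul_eq_C_mul, Derivation.leibniz, h,
      MvPolynomial.derivation_C]
    try simp only [h5, h10]
    try ring

open MvPolynomial in
lemma lift_operator_normalMonomial (c : ℂ) (a : Fin 4 → ℕ) :
    FreeAlgebra.lift ℂ (operator c) (normalMonomial a) 1 =
      monomial (Finsupp.equivFunOnFinite.symm a) 1 := by
  have hX (k l : Fin 4) (n : ℕ) (f : MvPolynomial (Fin 4) ℂ) (hkl : l ≠ k)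
      (hf : pderiv k f = 0) : pderiv k (X l ^ n * f) = 0 := by
    simp [Derivation.leibniz, Derivation.leibniz_pow, pderiv_X_of_ne hkl, hf]
  have step (k l : Fin 4) (hkl : l ≠ k)
      (hk : ∀ f : MvPolynomial (Fin 4) ℂ, pderiv k f = 0 → operator c l f = X l * f) (n : ℕ)
      (f : MvPolynomial (Fin 4) ℂ) (hf : pderiv k f = 0) :
      (operator c l ^ n) f = X l ^ n * f := by
    induction n with
    | zero => simp
    | succ n ih =>
      rw [pow_succ', Module.End.mul_apply, ih, hk _ (hX k l n f hkl hf), pow_succ']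
      ring
  have h₀ := step 3 0 (by decide) fun f hf => by rw [operator_zero, hf, smul_zero, add_zero]
  have h₁ := step 2 1 (by decide) fun f hf => by rw [operator_one, hf, smul_zero, sub_zero]
  have h₂ := step 3 2 (by decide) fun f hf => by
    rw [operator_two, hf, map_zero, mul_zero, smul_zero, smul_zero, add_zero, add_zero]
  have h₃ (n : ℕ) (f : MvPolynomial (Fin 4) ℂ) : (operator c 3 ^ n) f = X 3 ^ n * f := by
    induction n with
    | zero => simp
    | succ n ih =>
      rw [pow_succ', Module.End.mul_apply, ih, operator_three, pow_succ']
      ring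
  have e (k : Fin 4) : pderiv k (1 : MvPolynomial (Fin 4) ℂ) = 0 := Derivation.map_one_eq_zero _
  simp only [normalMonomial, map_mul, map_pow, FreeAlgebra.lift_ι_apply, Module.End.mul_apply]
  rw [h₀ _ _ (e 3), h₁ _ _ (hX _ _ _ _ (by decide) (e 2)),
    h₂ _ _ (hX _ _ _ _ (by decide) (hX _ _ _ _ (by decide) (e 3)))]
  rw [h₃, monomial_eq, _root_.map_one, one_mul, Finsupp.prod_fintype _ _ fun i => pow_zero _,
    Fin.prod_univ_four]
  simp only [Finsupp.equivFunOnFinite_symm_apply_apply]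
  ring

/-- The two-sided ideal generated by the `u_i u_j - u_j u_i - h i j` with `i < j`. -/
noncomputable def commIdeal (h : Fin 4 → Fin 4 → Free4) : Submodule ℂ Free4 :=
  Submodule.span ℂ {x | ∃ (a b : Free4) (i j : Fin 4),
    i < j ∧ x = a * (g i * g j - g j * g i - h i j) * b}

lemma linearIndependent_of_commValue (c : ℂ) {h : Fin 4 → Fin 4 → Free4}
    (hh : ∀ i j, i < j → h i j = commValue c i j) :
    LinearIndependent ℂ fun a =>
      Submodule.Quotient.mk (p := commIdeal h) (normalMonomial a) := by
  let φ : Free4 →ₗ[ℂ] MvPolynomial (Fin 4) ℂ :=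
    LinearMap.applyₗ (1 : MvPolynomial (Fin 4) ℂ) ∘ₗ
      (FreeAlgebra.lift ℂ (operator c)).toLinearMap
  have hφ : commIdeal h ≤ LinearMap.ker φ := by
    refine Submodule.span_le.2 ?_
    rintro _ ⟨a, b, i, j, hij, rfl⟩
    have : FreeAlgebra.lift ℂ (operator c) (g i * g j - g j * g i - h i j) = 0 := by
      rw [map_sub, map_sub, map_mul, map_mul, hh i j hij, ← operator_comm c hij]
      simp
    simp only [φ, SetLike.mem_coe, LinearMap.mem_ker, LinearMap.comp_apply,
      AlgHom.toLinearMap_apply, map_mul, this]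
    simp
  refine LinearIndependent.of_comp ((commIdeal h).liftQ φ hφ) ?_
  have : ((commIdeal h).liftQ φ hφ ∘ fun a => Submodule.Quotient.mk (normalMonomial a)) =
      MvPolynomial.basisMonomials (Fin 4) ℂ ∘ Finsupp.equivFunOnFinite.symm := by
    funext a
    exact (lift_operator_normalMonomial c a).trans (by simp)
  rw [this]
  exact (MvPolynomial.basisMonomials (Fin 4) ℂ).linearIndependent.comp _ (Equiv.injective _)

end Representation

section Assembly

variable {α₄ α₆ : ℂ} {𝒟 : Free4 →ₗ[ℂ] Free4} {h : Fin 4 → Fin 4 → Free4}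

lemma mul_mem_commIdeal (a : Free4) {x : Free4} (hx : x ∈ commIdeal h) :
    a * x ∈ commIdeal h := by
  induction hx using Submodule.span_induction with
  | mem x hx =>
    obtain ⟨b, d, i, j, hij, rfl⟩ := hx
    exact Submodule.subset_span ⟨a * b, d, i, j, hij, by simp only [mul_assoc]⟩
  | zero => simp
  | add x y _ _ hx hy => rw [mul_add]; exact add_mem hx hy
  | smul c x _ hx => rw [mul_smul_comm]; exact Submodule.smul_mem _ _ hx

lemma commIdeal_mul_mem {x : Free4} (a : Free4) (hx : x ∈ commIdeal h) :
    x * a ∈ commIdeal h := by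
  induction hx using Submodule.span_induction with
  | mem x hx =>
    obtain ⟨b, d, i, j, hij, rfl⟩ := hx
    exact Submodule.subset_span ⟨b, d * a, i, j, hij, by simp only [mul_assoc]⟩
  | zero => simp
  | add x y _ _ hx hy => rw [add_mul]; exact add_mem hx hy
  | smul c x _ hx => rw [smul_mul_assoc]; exact Submodule.smul_mem _ _ hx

lemma comm_sub_mem_commIdeal (h : Fin 4 → Fin 4 → Free4) {i j : Fin 4} (hij : i < j) :
    g i * g j - g j * g i - h i j ∈ commIdeal h :=
  Submodule.subset_span ⟨1, 1, i, j, hij, by rw [one_mul, mul_one]⟩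

lemma isStraightening_commIdeal
    (hh : ∀ i j : Fin 4, i < j → h i j ∈ normalSpan ((i : ℕ) + (j : ℕ) + 4)) :
    IsStraightening (commIdeal h) := by
  have key (i j : Fin 4) (hij : i < j) :
      g i * g j - g j * g i ∈ wordFiltration (wt i + wt j) ⊔ commIdeal h := by
    have h₁ : h i j ∈ wordFiltration (wt i + wt j) :=
      wordFiltration_mono (by simp only [wt]; omega) (normalSpan_le_wordFiltration _ (hh i j hij))
    simpa using Submodule.add_mem_sup h₁ (comm_sub_mem_commIdeal h hij)
  refine ⟨fun a x => mul_mem_commIdeal a, fun x a => commIdeal_mul_mem a, fun i j => ?_⟩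
  rcases lt_trichotomy i j with hij | rfl | hij
  · exact key i j hij
  · simp
  · rw [← neg_sub, add_comm]
    exact neg_mem (key j i hij)

lemma IsNovikovDerivation.map_mem_commIdeal (h𝒟 : IsNovikovDerivation α₄ α₆ 𝒟)
    (hp : ∀ i j : Fin 4, i < j → 𝒟 (g i * g j - g j * g i - h i j) ∈ commIdeal h)
    {x : Free4} (hx : x ∈ commIdeal h) : 𝒟 x ∈ commIdeal h := by
  induction hx using Submodule.span_induction with
  | mem x hx =>
    obtain ⟨a, b, i, j, hij, rfl⟩ := hx
    have hm := comm_sub_mem_commIdeal h hij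
    rw [h𝒟.leibniz, h𝒟.leibniz]
    exact add_mem (commIdeal_mul_mem _ (add_mem (mul_mem_commIdeal _ hm)
      (mul_mem_commIdeal _ (hp i j hij)))) (commIdeal_mul_mem _ (mul_mem_commIdeal _ hm))
  | zero => simp
  | add x y _ _ hx hy => rw [map_add]; exact add_mem hx hy
  | smul c x _ hx => rw [map_smul]; exact Submodule.smul_mem _ _ hx

lemma linearRHS_sub_mem {Q : Submodule ℂ Free4} (hl : ∀ a x : Free4, x ∈ Q → a * x ∈ Q)
    (hr : ∀ x a : Free4, x ∈ Q → x * a ∈ Q) (α₄ : ℂ) {x₀ x₁ x₂ y₀ y₁ y₂ : Free4}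
    (h₀ : x₀ - y₀ ∈ Q) (h₁ : x₁ - y₁ ∈ Q) (h₂ : x₂ - y₂ ∈ Q) :
    linearRHS α₄ x₀ x₁ x₂ - linearRHS α₄ y₀ y₁ y₂ ∈ Q := by
  rw [← linearRHS_sub]
  exact linearRHS_mem hl hr α₄ h₀ h₁ h₂

lemma linearRHS_zero_neg_algebraMap (α₄ c : ℂ) :
    linearRHS α₄ 0 0 (-algebraMap ℂ Free4 c) = -((10 * c) • g 0) := by
  have h10 : ((10 * c) • g 0 : Free4) = 10 * (c • g 0) := by
    rw [mul_smul, Algebra.smul_def, map_ofNat]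
  rw [linearRHS, h10, mul_neg, neg_mul, ← Algebra.commutes, ← Algebra.smul_def]
  noncomm_ring
  simp

lemma linearRHS_zero_algebraMap_zero (α₄ c : ℂ) :
    linearRHS α₄ 0 (algebraMap ℂ Free4 c) 0 = (10 * c) • g 1 := by
  have h10 : ((10 * c) • g 1 : Free4) = 10 * (c • g 1) := by
    rw [mul_smul, Algebra.smul_def, map_ofNat]
  rw [linearRHS, h10, ← Algebra.commutes c (g 1), ← Algebra.smul_def]
  noncomm_ring
  simp

lemma IsNovikovDerivation.map_mem_commIdeal_of_commValue (h𝒟 : IsNovikovDerivation α₄ α₆ 𝒟)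
    (c : ℂ) (hh : ∀ i j, i < j → h i j = commValue c i j) {x : Free4} (hx : x ∈ commIdeal h) :
    𝒟 x ∈ commIdeal h := by
  have hl : ∀ a x : Free4, x ∈ commIdeal h → a * x ∈ commIdeal h :=
    fun a x => mul_mem_commIdeal a
  have hr : ∀ x a : Free4, x ∈ commIdeal h → x * a ∈ commIdeal h :=
    fun x a => commIdeal_mul_mem a
  have m {i j : Fin 4} (hij : i < j) := comm_sub_mem_commIdeal h hij
  have m₀₁ := m (i := 0) (j := 1) (by decide)
  have m₀₂ := m (i := 0) (j := 2) (by decide)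
  have m₀₃ := m (i := 0) (j := 3) (by decide)
  have m₁₂ := m (i := 1) (j := 2) (by decide)
  have m₁₃ := m (i := 1) (j := 3) (by decide)
  have m₂₃ := m (i := 2) (j := 3) (by decide)
  have v₀₁ : h 0 1 = 0 := hh 0 1 (by decide)
  have v₀₂ : h 0 2 = 0 := hh 0 2 (by decide)
  have v₀₃ : h 0 3 = algebraMap ℂ Free4 c := hh 0 3 (by decide)
  have v₁₂ : h 1 2 = -algebraMap ℂ Free4 c := hh 1 2 (by decide)
  have v₁₃ : h 1 3 = 0 := hh 1 3 (by decide)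
  have v₂₃ : h 2 3 = (10 * c) • g 0 := hh 2 3 (by decide)
  rw [v₀₁, sub_zero] at m₀₁
  rw [v₀₂, sub_zero] at m₀₂
  rw [v₀₃] at m₀₃
  rw [v₁₂, sub_neg_eq_add] at m₁₂
  rw [v₁₃, sub_zero] at m₁₃
  rw [v₂₃] at m₂₃
  refine h𝒟.map_mem_commIdeal (fun i j hij => ?_) hx
  fin_cases i <;> fin_cases j <;> first | exact absurd hij (by decide) | skip
  · change 𝒟 (g 0 * g 1 - g 1 * g 0 - h 0 1) ∈ _
    rw [v₀₁, sub_zero, h𝒟.map_comm₀₁]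
    exact m₀₂
  · change 𝒟 (g 0 * g 2 - g 2 * g 0 - h 0 2) ∈ _
    rw [v₀₂, sub_zero, h𝒟.map_comm₀₂]
    convert add_mem m₁₂ m₀₃ using 1
    abel
  · change 𝒟 (g 0 * g 3 - g 3 * g 0 - h 0 3) ∈ _
    rw [v₀₃, map_sub, h𝒟.map_algebraMap, sub_zero, h𝒟.map_comm₀₃]
    exact add_mem m₁₃ (linearRHS_mem hl hr α₄ (zero_mem _) m₀₁ m₀₂)
  · change 𝒟 (g 1 * g 2 - g 2 * g 1 - h 1 2) ∈ _
    rw [v₁₂, map_sub, map_neg, h𝒟.map_algebraMap, neg_zero, sub_zero, h𝒟.map_comm₁₂]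
    exact m₁₃
  · change 𝒟 (g 1 * g 3 - g 3 * g 1 - h 1 3) ∈ _
    rw [v₁₃, sub_zero, h𝒟.map_comm₁₃]
    have := linearRHS_sub_mem hl hr α₄ (x₀ := -(g 0 * g 1 - g 1 * g 0)) (y₀ := 0) (x₁ := 0)
      (y₁ := 0) (x₂ := g 1 * g 2 - g 2 * g 1) (y₂ := -algebraMap ℂ Free4 c)
      (by simpa using neg_mem m₀₁) (by simp) (by simpa using m₁₂)
    rw [linearRHS_zero_neg_algebraMap] at this
    convert add_mem m₂₃ this using 1
    abel
  · change 𝒟 (g 2 * g 3 - g 3 * g 2 - h 2 3) ∈ _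
    rw [v₂₃, map_sub, map_smul, h𝒟.map_g0, h𝒟.map_comm₂₃, ← linearRHS_zero_algebraMap_zero α₄]
    refine linearRHS_sub_mem hl hr α₄ ?_ ?_ ?_
    · simpa using neg_mem m₀₂
    · convert neg_mem m₁₂ using 1
      abel
    · simp

lemma normalMonomial_mem_normalSpan {a : Fin 4 → ℕ} {n : ℕ} (ha : expWt a < n) :
    normalMonomial a ∈ normalSpan n :=
  Submodule.subset_span ⟨a, ha, rfl⟩

lemma algebraMap_mem_normalSpan (c : ℂ) {n : ℕ} (hn : 0 < n) :
    algebraMap ℂ Free4 c ∈ normalSpan n := by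
  rw [Algebra.algebraMap_eq_smul_one]
  have := normalMonomial_mem_normalSpan (a := 0) (n := n) (by simpa [expWt] using hn)
  exact Submodule.smul_mem _ _ (by simpa [normalMonomial] using this)

lemma g_zero_mem_normalSpan {n : ℕ} (hn : 2 < n) : g 0 ∈ normalSpan n := by
  have := normalMonomial_mem_normalSpan (a := ![1, 0, 0, 0]) (n := n) (by simpa [expWt] using hn)
  simpa [normalMonomial] using this

/-- A combination of iterated derivatives of commutators which is annihilated by `𝒟`. -/
lemma IsNovikovDerivation.map_first_integral (h𝒟 : IsNovikovDerivation α₄ α₆ 𝒟) :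
    𝒟 ((2 : ℂ) • (g 1 * g 2 - g 2 * g 1) - 𝒟 (𝒟 (g 0 * g 1 - g 1 * g 0)) +
      5 * ((g 0 * g 1 - g 1 * g 0) * g 0 + g 0 * (g 0 * g 1 - g 1 * g 0))) = 0 := by
  have h5 (x : Free4) : 𝒟 (5 * x) = 5 * 𝒟 x := by
    have h5' : (5 : Free4) = algebraMap ℂ Free4 5 := (map_ofNat _ 5).symm
    rw [h𝒟.leibniz, h5', h𝒟.map_algebraMap, zero_mul, zero_add]
  have h := h𝒟.map_comm₀₃
  rw [linearRHS] at h
  rw [map_add, map_sub, map_smul, h5, map_add, h𝒟.leibniz _ (g 0), h𝒟.leibniz (g 0),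
    h𝒟.map_comm₀₁, h𝒟.map_comm₀₂, map_add, h, h𝒟.map_comm₁₂, h𝒟.map_g0, two_smul]
  simp only [smul_zero, mul_zero, zero_mul]
  noncomm_ring

theorem IsNovikovDerivation.exists_eq_commValue (h𝒟 : IsNovikovDerivation α₄ α₆ 𝒟)
    (hh : ∀ i j : Fin 4, i < j → h i j ∈ normalSpan ((i : ℕ) + (j : ℕ) + 4))
    (hD : ∀ x ∈ commIdeal h, 𝒟 x ∈ commIdeal h)
    (hli : LinearIndependent ℂ fun a =>
      Submodule.Quotient.mk (p := commIdeal h) (normalMonomial a)) :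
    ∃ c : ℂ, ∀ i j, i < j → h i j = commValue c i j := by
  have hQ := isStraightening_commIdeal hh
  have m {i j : Fin 4} (hij : i < j) := comm_sub_mem_commIdeal h hij
  have m₀₁ := m (i := 0) (j := 1) (by decide)
  have m₀₂ := m (i := 0) (j := 2) (by decide)
  have m₀₃ := m (i := 0) (j := 3) (by decide)
  have m₁₂ := m (i := 1) (j := 2) (by decide)
  have m₁₃ := m (i := 1) (j := 3) (by decide)
  have m₂₃ := m (i := 2) (j := 3) (by decide)
  have n₀₁ : h 0 1 ∈ normalSpan 5 := hh 0 1 (by decide)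
  have n₀₂ : h 0 2 ∈ normalSpan 6 := hh 0 2 (by decide)
  have n₀₃ : h 0 3 ∈ normalSpan 7 := hh 0 3 (by decide)
  have n₁₂ : h 1 2 ∈ normalSpan 7 := hh 1 2 (by decide)
  have n₁₃ : h 1 3 ∈ normalSpan 8 := hh 1 3 (by decide)
  have n₂₃ : h 2 3 ∈ normalSpan 9 := hh 2 3 (by decide)
  have eq_of_sub_mem {n : ℕ} {x y : Free4} (hx : x ∈ normalSpan n) (hy : y ∈ normalSpan n)
      (hxy : x - y ∈ commIdeal h) : x = y :=
    sub_eq_zero.1 (normalSpan_inter_eq_zero hli (sub_mem hx hy) hxy)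
  have hl := hQ.mul_left
  have hr := hQ.mul_right
  set J : Free4 := (2 : ℂ) • h 1 2 - 𝒟 (𝒟 (h 0 1)) + 5 * (h 0 1 * g 0 + g 0 * h 0 1) with hJ
  have hJw : J ∈ wordFiltration 7 := by
    have w := normalSpan_le_wordFiltration _ n₀₁
    have w0 : g 0 ∈ wordFiltration 3 := g_mem 0 (by simp)
    exact add_mem (sub_mem (Submodule.smul_mem _ _ (normalSpan_le_wordFiltration _ n₁₂))
      (h𝒟.map_mem (h𝒟.map_mem w))) (ofNat_mul_mem 5 (add_mem
        (mul_mem_wordFiltration (by omega) w w0) (mul_mem_wordFiltration (by omega) w0 w)))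
  have hDJ : 𝒟 J ∈ commIdeal h := by
    have := hD _ (add_mem (sub_mem (Submodule.smul_mem _ (2 : ℂ) m₁₂) (hD _ (hD _ m₀₁)))
      (hl 5 _ (add_mem (hr _ (g 0) m₀₁) (hl (g 0) _ m₀₁))))
    rw [← neg_mem_iff, ← map_neg]
    rw [← sub_zero (𝒟 _), ← h𝒟.map_first_integral, ← map_sub] at this
    convert this using 2
    rw [hJ, map_sub, map_sub]
    simp only [two_smul]
    noncomm_ring
  obtain ⟨N, hN, q, hq, hNq⟩ := Submodule.mem_sup.1 (hQ.wordFiltration_le 7 hJw)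
  obtain ⟨c, rfl⟩ := h𝒟.eq_const hQ hli hN (by
    rw [eq_sub_of_add_eq hNq, map_sub]
    exact sub_mem hDJ (hD _ hq))
  have v₀₁ : h 0 1 = 0 := by
    refine h𝒟.eq_zero_of_obstruction hQ hli (c := c) n₀₁ rfl
      (h𝒟.obstruction_mem hl hr hD m₀₁ ?_)
    have := add_mem m₁₂ (Submodule.smul_mem _ (2⁻¹ : ℂ) hq)
    convert this using 1
    rw [eq_sub_of_add_eq' hNq, hJ]
    have : h 1 2 = (2⁻¹ : ℂ) • (2 : ℂ) • h 1 2 := by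
      rw [smul_smul, inv_mul_cancel₀ two_ne_zero, one_smul]
    nth_rw 1 [this]
    simp only [smul_sub, smul_add]
    abel
  rw [v₀₁, sub_zero] at m₀₁
  have v₀₂ : h 0 2 = 0 := by
    refine normalSpan_inter_eq_zero hli n₀₂ ?_
    have := sub_mem (hD _ m₀₁) m₀₂
    rwa [h𝒟.map_comm₀₁, sub_sub_cancel] at this
  rw [v₀₂, sub_zero] at m₀₂
  obtain ⟨c', hc⟩ : ∃ c' : ℂ, -2 * c' = c := ⟨-c / 2, by ring⟩
  have v₁₂ : h 1 2 = -algebraMap ℂ Free4 c' := by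
    refine eq_of_sub_mem n₁₂ (neg_mem (algebraMap_mem_normalSpan c' (by omega))) ?_
    have := Submodule.smul_mem _ (2⁻¹ : ℂ) hq
    rw [eq_sub_of_add_eq' hNq, hJ, v₀₁, ← hc] at this
    convert this using 1
    simp only [map_zero, sub_zero, zero_mul, mul_zero, add_zero, smul_sub, smul_smul,
      Algebra.algebraMap_eq_smul_one]
    module
  rw [v₁₂] at m₁₂
  have v₀₃ : h 0 3 = algebraMap ℂ Free4 c' := by
    refine eq_of_sub_mem n₀₃ (algebraMap_mem_normalSpan c' (by omega)) ?_
    have := sub_mem (sub_mem (hD _ m₀₂) m₁₂) m₀₃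
    rw [h𝒟.map_comm₀₂] at this
    convert this using 1
    abel
  have v₁₃ : h 1 3 = 0 := by
    refine normalSpan_inter_eq_zero hli n₁₃ ?_
    have := sub_mem (hD _ m₁₂) m₁₃
    rwa [map_sub, map_neg, h𝒟.map_algebraMap, neg_zero, sub_zero, h𝒟.map_comm₁₂,
      sub_sub_cancel] at this
  rw [v₁₃, sub_zero] at m₁₃
  have v₂₃ : h 2 3 = (10 * c') • g 0 := by
    refine eq_of_sub_mem n₂₃ (Submodule.smul_mem _ _ (g_zero_mem_normalSpan (by omega))) ?_
    have h₁ := linearRHS_sub_mem hl hr α₄ (x₀ := -(g 0 * g 1 - g 1 * g 0)) (y₀ := 0) (x₁ := 0)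
      (y₁ := 0) (by simpa using neg_mem m₀₁) (by simp) m₁₂
    rw [linearRHS_zero_neg_algebraMap] at h₁
    have := sub_mem (sub_mem (hD _ m₁₃) m₂₃) h₁
    rw [h𝒟.map_comm₁₃] at this
    convert this using 1
    abel
  refine ⟨c', fun i j hij => ?_⟩
  fin_cases i <;> fin_cases j <;>
    first | exact absurd hij (by decide) | exact v₀₁ | exact v₀₂ | exact v₀₃ | exact v₁₂ |
      exact v₁₃ | exact v₂₃

end Assembly

end Novikov

/-- Classification of quantisation ideals of the non-commutative `N = 2` Novikov
equation: the two-sided ideal `Q` generated by `p_{ij} = u_iu_j − u_ju_i − h_{ij}`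
(`0 ≤ i < j ≤ 3`, `h_{ij}` in the span of the normally ordered monomials of weight
`< i + j + 4`) is a quantisation ideal (i.e. `𝒟`-invariant with PBW basis) if and
only if for some `c ∈ ℂ`: `h₀₁ = h₀₂ = h₁₃ = 0`, `h₀₃ = c`, `h₁₂ = −c`,
`h₂₃ = 10c·u₀`. -/
theorem nc_N2_quantisation_ideal_classification (α₄ α₆ : ℂ)
    (𝒟 : FreeAlgebra ℂ (Fin 4) →ₗ[ℂ] FreeAlgebra ℂ (Fin 4))
    (hleib : ∀ x y : FreeAlgebra ℂ (Fin 4), 𝒟 (x * y) = 𝒟 x * y + x * 𝒟 y)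
    (u : Fin 4 → FreeAlgebra ℂ (Fin 4)) (hu : ∀ k, u k = FreeAlgebra.ι ℂ k)
    (h0 : 𝒟 (u 0) = u 1) (h1 : 𝒟 (u 1) = u 2) (h2 : 𝒟 (u 2) = u 3)
    (h3 : 𝒟 (u 3) = 5 * (u 2 * u 0 + u 0 * u 2) + 5 * (u 1) ^ 2 - 10 * (u 0) ^ 3
        - (16 * α₄) • u 0 + algebraMap ℂ (FreeAlgebra ℂ (Fin 4)) (32 * α₆))
    (h : Fin 4 → Fin 4 → FreeAlgebra ℂ (Fin 4))
    (hh : ∀ i j : Fin 4, i < j →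
      h i j ∈ Submodule.span ℂ {m : FreeAlgebra ℂ (Fin 4) | ∃ a : Fin 4 → ℕ,
        5 * a 3 + 4 * a 2 + 3 * a 1 + 2 * a 0 < (i : ℕ) + (j : ℕ) + 4 ∧
        m = u 3 ^ a 3 * u 2 ^ a 2 * u 1 ^ a 1 * u 0 ^ a 0})
    -- `Q` is the two-sided ideal generated by the six polynomials `p_{ij}`
    (Q : Submodule ℂ (FreeAlgebra ℂ (Fin 4)))
    (hQ : Q = Submodule.span ℂ
        {x : FreeAlgebra ℂ (Fin 4) | ∃ (a b : FreeAlgebra ℂ (Fin 4)) (i j : Fin 4),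
          i < j ∧ x = a * (u i * u j - u j * u i - h i j) * b}) :
    ((∀ x ∈ Q, 𝒟 x ∈ Q) ∧
      LinearIndependent ℂ (fun a : Fin 4 → ℕ =>
        (Submodule.Quotient.mk (p := Q)
          (u 3 ^ a 3 * u 2 ^ a 2 * u 1 ^ a 1 * u 0 ^ a 0))) ∧
      Submodule.span ℂ (Set.range (fun a : Fin 4 → ℕ =>
        (Submodule.Quotient.mk (p := Q)
          (u 3 ^ a 3 * u 2 ^ a 2 * u 1 ^ a 1 * u 0 ^ a 0)))) = ⊤)
    ↔ (∃ c : ℂ,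
        h 0 1 = 0 ∧ h 0 2 = 0 ∧ h 1 3 = 0 ∧
        h 0 3 = algebraMap ℂ (FreeAlgebra ℂ (Fin 4)) c ∧
        h 1 2 = - algebraMap ℂ (FreeAlgebra ℂ (Fin 4)) c ∧
        h 2 3 = (10 * c) • u 0) := by
  obtain rfl : u = fun k => FreeAlgebra.ι ℂ k := funext hu
  have h𝒟 : Novikov.IsNovikovDerivation α₄ α₆ 𝒟 := ⟨hleib, h0, h1, h2, h3⟩
  subst hQ
  constructor
  · rintro ⟨hD, hli, -⟩
    obtain ⟨c, hc⟩ := h𝒟.exists_eq_commValue hh hD hli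
    exact ⟨c, hc 0 1 (by decide), hc 0 2 (by decide), hc 1 3 (by decide), hc 0 3 (by decide),
      hc 1 2 (by decide), hc 2 3 (by decide)⟩
  · rintro ⟨c, h₀₁, h₀₂, h₁₃, h₀₃, h₁₂, h₂₃⟩
    have hc : ∀ i j, i < j → h i j = Novikov.commValue c i j := by
      intro i j hij
      fin_cases i <;> fin_cases j <;>
        first | exact absurd hij (by decide) | exact h₀₁ | exact h₀₂ | exact h₀₃ | exact h₁₂ |
          exact h₁₃ | exact h₂₃
    exact ⟨fun _ => h𝒟.map_mem_commIdeal_of_commValue c hc,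
      Novikov.linearIndependent_of_commValue c hc,
      (Novikov.isStraightening_commIdeal hh).span_eq_top⟩
end
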